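/- There exist constants c₂ > 0, C > 0 and a threshold N₀ such that for every n ≥ N₀, every set A ⊆ [n] × [n] ⊂ ℤ² containing no (tilted) square satisfies |A| ≤ C·n²/(log log n)^{c₂}. -/

import Mathlib

/-- The plane over `ZMod p`. -/
abbrev Plane (p : ℕ) := ZMod p × ZMod p

/-- The additive character of the plane with frequency `ξ`. -/
noncomputable def chi {p : ℕ} [NeZero p] (ξ x : Plane p) : ℂ :=
  ZMod.stdAddChar (ξ.1 * x.1 + ξ.2 * x.2)

section chi

variable {p : ℕ} [NeZero p]

lemma chi_add_left (ξ η x : Plane p) : chi (ξ + η) x = chi ξ x * chi η x := by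
  unfold chi
  rw [← AddChar.map_add_eq_mul]
  congr 1
  simp only [Prod.fst_add, Prod.snd_add]
  ring

lemma chi_comm (ξ x : Plane p) : chi ξ x = chi x ξ := by
  unfold chi
  congr 1
  ring

lemma chi_add_right (ξ x y : Plane p) : chi ξ (x + y) = chi ξ x * chi ξ y := by
  rw [chi_comm, chi_add_left, chi_comm x, chi_comm y]

@[simp] lemma chi_zero_left (x : Plane p) : chi 0 x = 1 := by
  simp [chi]

@[simp] lemma chi_zero_right (x : Plane p) : chi x 0 = 1 := by
  simp [chi]

@[simp] lemma norm_chi (ξ x : Plane p) : ‖chi ξ x‖ = 1 := by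
  simp [chi]

lemma conj_chi (ξ x : Plane p) : (starRingEnd ℂ) (chi ξ x) = chi (-ξ) x := by
  unfold chi
  rw [← AddChar.map_neg_eq_conj]
  congr 1
  simp only [Prod.fst_neg, Prod.snd_neg]
  ring

lemma chi_neg_right (ξ x : Plane p) : chi ξ (-x) = chi (-ξ) x := by
  unfold chi
  congr 1
  simp only [Prod.fst_neg, Prod.snd_neg]
  ring

lemma sum_chi (x : Plane p) :
    ∑ ξ : Plane p, chi ξ x = if x = 0 then (p : ℂ) ^ 2 else 0 := by
  have h : ∀ t : ZMod p, ∑ s : ZMod p, (ZMod.stdAddChar (s * t) : ℂ) =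
      if t = 0 then (p : ℂ) else 0 := by
    intro t
    have := AddChar.sum_mulShift (R := ZMod p) (R' := ℂ) t (ZMod.isPrimitive_stdAddChar p)
    rw [this]
    simp
  have h2 : ∑ ξ : Plane p, chi ξ x =
      (∑ s : ZMod p, (ZMod.stdAddChar (s * x.1) : ℂ)) *
        ∑ s : ZMod p, (ZMod.stdAddChar (s * x.2) : ℂ) := by
    rw [Finset.sum_mul_sum, ← Finset.univ_product_univ, Finset.sum_product]
    simp only [chi, AddChar.map_add_eq_mul]
  rw [h2, h, h]
  obtain ⟨a, b⟩ := x
  simp only [Prod.mk_eq_zero]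
  split_ifs <;> simp_all [sq]

/-- Parseval's identity for sums of characters at distinct points. -/
lemma parseval {ι : Type*} (S : Finset ι) (g : ι → ℂ) (L : ι → Plane p)
    (hL : Set.InjOn L S) :
    ∑ ξ : Plane p, ‖∑ s ∈ S, g s * chi ξ (L s)‖ ^ 2 = (p : ℝ) ^ 2 * ∑ s ∈ S, ‖g s‖ ^ 2 := by
  classical
  have key : ∑ ξ : Plane p, ((‖∑ s ∈ S, g s * chi ξ (L s)‖ ^ 2 : ℝ) : ℂ) =
      (((p : ℝ) ^ 2 * ∑ s ∈ S, ‖g s‖ ^ 2 : ℝ) : ℂ) := by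
    have e1 : ∀ ξ : Plane p, ((‖∑ s ∈ S, g s * chi ξ (L s)‖ ^ 2 : ℝ) : ℂ) =
        ∑ s ∈ S, ∑ t ∈ S, g s * (starRingEnd ℂ) (g t) * chi ξ (L s - L t) := by
      intro ξ
      push_cast
      rw [← Complex.mul_conj', map_sum, Finset.sum_mul_sum]
      refine Finset.sum_congr rfl fun s _ => Finset.sum_congr rfl fun t _ => ?_
      rw [map_mul, conj_chi, sub_eq_add_neg, chi_add_right, chi_neg_right]
      ring
    simp_rw [e1]
    rw [Finset.sum_comm]
    push_cast
    rw [Finset.mul_sum]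
    refine Finset.sum_congr rfl fun s hs => ?_
    rw [Finset.sum_comm]
    simp_rw [← Finset.mul_sum, sum_chi, sub_eq_zero]
    rw [Finset.sum_eq_single s]
    · rw [if_pos rfl, Complex.mul_conj']; ring
    · intro t ht hts
      rw [if_neg, mul_zero]
      exact fun h => hts (hL ht hs h.symm)
    · exact fun h => absurd hs h
  exact_mod_cast key

/-- Fourier inversion. -/
lemma inversion (F : Plane p → ℂ) (y : Plane p) :
    ∑ ξ : Plane p, (∑ x, F x * chi ξ x) * chi ξ (-y) = (p : ℂ) ^ 2 * F y := by
  simp_rw [Finset.sum_mul]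
  rw [Finset.sum_comm]
  have : ∀ x, ∑ ξ : Plane p, F x * chi ξ x * chi ξ (-y) =
      F x * (if x - y = 0 then (p : ℂ) ^ 2 else 0) := by
    intro x
    rw [← sum_chi, Finset.mul_sum]
    refine Finset.sum_congr rfl fun ξ _ => ?_
    rw [sub_eq_add_neg, chi_add_right]; ring
  simp_rw [this, sub_eq_zero]
  simp [mul_comm]

/-- A bilinear sum weighted by `F` is controlled by the Fourier transform of `F`. -/
lemma trilinear_le {ι κ : Type*} (S : Finset ι) (T : Finset κ) (g : ι → ℂ) (k : κ → ℂ)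
    (L : ι → Plane p) (M : κ → Plane p) (hL : Set.InjOn L S) (hM : Set.InjOn M T)
    (F : Plane p → ℂ) (W : ℝ) (hW : ∀ ξ, ‖∑ x, F x * chi ξ x‖ ≤ W) :
    ‖∑ s ∈ S, ∑ t ∈ T, g s * k t * F (L s + M t)‖ ≤
      W * (√(∑ s ∈ S, ‖g s‖ ^ 2) * √(∑ t ∈ T, ‖k t‖ ^ 2)) := by
  have hp : (0 : ℝ) < (p : ℝ) ^ 2 := by
    have : 0 < p := Nat.pos_of_ne_zero (NeZero.ne p)
    positivity
  have hW0 : 0 ≤ W := (norm_nonneg _).trans (hW 0)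
  have e1 : (p : ℂ) ^ 2 * ∑ s ∈ S, ∑ t ∈ T, g s * k t * F (L s + M t) =
      ∑ ξ : Plane p, (∑ x, F x * chi ξ x) *
        ((∑ s ∈ S, g s * chi ξ (-L s)) * ∑ t ∈ T, k t * chi ξ (-M t)) := by
    have e0 : ∀ ξ : Plane p, (∑ x, F x * chi ξ x) *
        ((∑ s ∈ S, g s * chi ξ (-L s)) * ∑ t ∈ T, k t * chi ξ (-M t)) =
        ∑ s ∈ S, ∑ t ∈ T, (∑ x, F x * chi ξ x) *
          ((g s * chi ξ (-L s)) * (k t * chi ξ (-M t))) := by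
      intro ξ
      rw [Finset.sum_mul_sum, Finset.mul_sum]
      exact Finset.sum_congr rfl fun s _ => Finset.mul_sum _ _ _
    simp_rw [e0]
    rw [Finset.mul_sum]
    symm
    rw [Finset.sum_comm]
    refine Finset.sum_congr rfl fun s _ => ?_
    rw [Finset.sum_comm, Finset.mul_sum]
    refine Finset.sum_congr rfl fun t _ => ?_
    symm
    rw [show (p : ℂ) ^ 2 * (g s * k t * F (L s + M t)) =
      g s * k t * ((p : ℂ) ^ 2 * F (L s + M t)) by ring, ← inversion, Finset.mul_sum]
    refine Finset.sum_congr rfl fun ξ _ => ?_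
    rw [neg_add, chi_add_right]
    ring
  have hLn : Set.InjOn (fun s => -L s) S := fun s hs t ht h => hL hs ht (neg_injective h)
  have hMn : Set.InjOn (fun s => -M s) T := fun s hs t ht h => hM hs ht (neg_injective h)
  have e2 : (p : ℝ) ^ 2 * ‖∑ s ∈ S, ∑ t ∈ T, g s * k t * F (L s + M t)‖ ≤
      (p : ℝ) ^ 2 * (W * (√(∑ s ∈ S, ‖g s‖ ^ 2) * √(∑ t ∈ T, ‖k t‖ ^ 2))) := by
    calc (p : ℝ) ^ 2 * ‖∑ s ∈ S, ∑ t ∈ T, g s * k t * F (L s + M t)‖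
        = ‖(p : ℂ) ^ 2 * ∑ s ∈ S, ∑ t ∈ T, g s * k t * F (L s + M t)‖ := by simp
      _ ≤ ∑ ξ : Plane p, W * (‖∑ s ∈ S, g s * chi ξ (-L s)‖ * ‖∑ t ∈ T, k t * chi ξ (-M t)‖) := by
          rw [e1]
          refine (norm_sum_le _ _).trans (Finset.sum_le_sum fun ξ _ => ?_)
          rw [norm_mul, norm_mul]
          exact mul_le_mul_of_nonneg_right (hW ξ) (by positivity)
      _ ≤ W * (√(∑ ξ : Plane p, ‖∑ s ∈ S, g s * chi ξ (-L s)‖ ^ 2) *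
            √(∑ ξ : Plane p, ‖∑ t ∈ T, k t * chi ξ (-M t)‖ ^ 2)) := by
          rw [← Finset.mul_sum]
          exact mul_le_mul_of_nonneg_left (Real.sum_mul_le_sqrt_mul_sqrt _ _ _) hW0
      _ = _ := by
          rw [parseval S g _ hLn, parseval T k _ hMn, Real.sqrt_mul hp.le, Real.sqrt_mul hp.le,
            Real.sqrt_sq (by positivity)]
          ring
  exact le_of_mul_le_mul_left e2 hp

end chi

section vonNeumann

variable {p : ℕ} [NeZero p]

lemma card_plane : Fintype.card (Plane p) = p ^ 2 := by
  simp [Plane, Fintype.card_prod, ZMod.card, sq]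

/-- Three-point configurations are controlled by linear characters. -/
lemma three_point_le (F G₁ G₂ : Plane p → ℝ) (h₁ : ∀ x, |G₁ x| ≤ 1) (h₂ : ∀ x, |G₂ x| ≤ 1)
    (a b : Plane p →+ Plane p) (ha : Function.Injective a) (hb : Function.Injective b)
    (hab : Function.Injective (a - b)) (W : ℝ)
    (hW : ∀ ξ, ‖∑ x, (F x : ℂ) * chi ξ x‖ ≤ W) :
    ∑ x, ∑ d, F x * G₁ (x + a d) * G₂ (x + b d) ≤ (p : ℝ) ^ 2 * W := by
  have hW0 : 0 ≤ W := (norm_nonneg _).trans (hW 0)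
  let T : Plane p × Plane p → Plane p × Plane p := fun q => (a q.2 - b q.1, q.1 - q.2)
  have hT : Function.Bijective T := by
    rw [← Finite.injective_iff_bijective]
    rintro ⟨s, t⟩ ⟨s', t'⟩ h
    simp only [T, Prod.mk.injEq] at h
    obtain ⟨h, h'⟩ := h
    have e : (a - b) s = (a - b) s' := by
      have := congrArg a h'
      simp only [map_sub, AddMonoidHom.sub_apply] at this ⊢
      linear_combination (exp := 1) h + this
    have e2 := hab e
    subst e2
    simpa using h'
  have e1 : ∑ x, ∑ d, F x * G₁ (x + a d) * G₂ (x + b d) =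
      ∑ s, ∑ t, G₁ ((a - b) s) * G₂ ((a - b) t) * F (-b s + a t) := by
    rw [← Fintype.sum_prod_type', ← Fintype.sum_prod_type', ← hT.sum_comp]
    refine Finset.sum_congr rfl fun q _ => ?_
    simp only [T, map_sub, AddMonoidHom.sub_apply]
    rw [show a q.2 - b q.1 + (a q.1 - a q.2) = a q.1 - b q.1 by abel,
      show a q.2 - b q.1 + (b q.1 - b q.2) = a q.2 - b q.2 by abel,
      show -b q.1 + a q.2 = a q.2 - b q.1 by abel]
    ring
  have hs : ∀ G : Plane p → ℝ, (∀ x, |G x| ≤ 1) →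
      √(∑ s : Plane p, ‖(G ((a - b) s) : ℂ)‖ ^ 2) ≤ p := by
    intro G hG
    rw [Real.sqrt_le_left (by positivity)]
    calc ∑ s : Plane p, ‖(G ((a - b) s) : ℂ)‖ ^ 2 ≤ ∑ s : Plane p, (1 : ℝ) := by
          refine Finset.sum_le_sum fun s _ => ?_
          rw [Complex.norm_real, Real.norm_eq_abs, sq_abs]
          exact (sq_le_one_iff_abs_le_one _).2 (hG _)
      _ = (p : ℝ) ^ 2 := by simp [sq]
  have := trilinear_le Finset.univ Finset.univ (fun s => (G₁ ((a - b) s) : ℂ))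
    (fun s => (G₂ ((a - b) s) : ℂ)) (fun s => -b s) a
    (fun s _ t _ h => hb (neg_injective h)) ha.injOn (fun x => (F x : ℂ)) W hW
  rw [e1]
  calc _ ≤ ‖((∑ s, ∑ t, G₁ ((a - b) s) * G₂ ((a - b) t) * F (-b s + a t) : ℝ) : ℂ)‖ := by
        rw [Complex.norm_real]; exact Real.le_norm_self _
    _ ≤ W * (p * p) := by
        push_cast
        refine this.trans (mul_le_mul_of_nonneg_left ?_ hW0)
        exact mul_le_mul (hs _ h₁) (hs _ h₂) (Real.sqrt_nonneg _) (by positivity)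
    _ = _ := by ring

/-- Four-point configurations are controlled by the characters of multiplicative derivatives. -/
theorem von_neumann (f g₁ g₂ g₃ : Plane p → ℝ) (h₁ : ∀ x, |g₁ x| ≤ 1)
    (h₂ : ∀ x, |g₂ x| ≤ 1) (h₃ : ∀ x, |g₃ x| ≤ 1)
    (a b c : Plane p →+ Plane p) (ha : Function.Injective a) (hb : Function.Injective b)
    (hab : Function.Injective (a - b)) (hc : Function.Injective c) :
    ∃ φ : Plane p → Plane p,
      (∑ x, ∑ d, f x * g₁ (x + a d) * g₂ (x + b d) * g₃ (x + c d)) ^ 2 ≤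
        (p : ℝ) ^ 4 * ∑ h, ‖∑ x, ((f x * f (x + h) : ℝ) : ℂ) * chi (φ h) x‖ := by
  have hmax : ∀ h : Plane p, ∃ ξ, ∀ η, ‖∑ x, ((f x * f (x + h) : ℝ) : ℂ) * chi η x‖ ≤
      ‖∑ x, ((f x * f (x + h) : ℝ) : ℂ) * chi ξ x‖ := fun h => Finite.exists_max _
  choose φ hφ using hmax
  refine ⟨φ, ?_⟩
  let u : Plane p → Plane p → ℝ :=
    fun y d => f (y - c d) * g₁ (y - c d + a d) * g₂ (y - c d + b d)
  have e1 : ∑ x, ∑ d, f x * g₁ (x + a d) * g₂ (x + b d) * g₃ (x + c d) =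
      ∑ y, g₃ y * ∑ d, u y d := by
    simp_rw [Finset.mul_sum]
    rw [Finset.sum_comm]
    symm
    rw [Finset.sum_comm]
    refine Finset.sum_congr rfl fun d _ => ?_
    rw [← Equiv.sum_comp (Equiv.addRight (c d))]
    refine Finset.sum_congr rfl fun x _ => ?_
    simp only [Equiv.coe_addRight, u, add_sub_cancel_right]
    ring
  have e2 : ∑ y, (∑ d, u y d) ^ 2 = ∑ h, ∑ x, ∑ d, (f x * f (x + -c h)) *
      (g₁ (x + a d) * g₁ (x + a d + (a h - c h))) *
      (g₂ (x + b d) * g₂ (x + b d + (b h - c h))) := by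
    simp_rw [sq, Finset.sum_mul_sum]
    have : ∀ y d, ∑ e, u y d * u y e = ∑ h, u y d * u y (h + d) := by
      intro y d
      rw [← Equiv.sum_comp (Equiv.addRight d)]
      rfl
    simp_rw [this]
    have e3 : ∀ y, ∑ d, ∑ h, u y d * u y (h + d) = ∑ h, ∑ d, u y d * u y (h + d) :=
      fun y => Finset.sum_comm
    simp_rw [e3]
    rw [Finset.sum_comm]
    refine Finset.sum_congr rfl fun h _ => ?_
    rw [Finset.sum_comm]
    symm
    rw [Finset.sum_comm]
    refine Finset.sum_congr rfl fun d _ => ?_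
    symm
    rw [← Equiv.sum_comp (Equiv.addRight (c d))]
    refine Finset.sum_congr rfl fun x _ => ?_
    simp only [Equiv.coe_addRight, u, add_sub_cancel_right, map_add]
    rw [show x + c d - (c h + c d) = x + -c h by abel,
      show x + -c h + (a h + a d) = x + a d + (a h - c h) by abel,
      show x + -c h + (b h + b d) = x + b d + (b h - c h) by abel]
    ring
  have hmul : ∀ {s t : ℝ}, |s| ≤ 1 → |t| ≤ 1 → |s * t| ≤ 1 := by
    intro s t hs ht
    rw [abs_mul]
    exact mul_le_one₀ hs (abs_nonneg _) ht
  have e4 : ∑ y, (∑ d, u y d) ^ 2 ≤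
      (p : ℝ) ^ 2 * ∑ h, ‖∑ x, ((f x * f (x + h) : ℝ) : ℂ) * chi (φ h) x‖ := by
    have hbij : Function.Bijective (fun h => -c h) := by
      rw [← Finite.injective_iff_bijective]
      exact fun s t h => hc (neg_injective h)
    rw [e2, ← hbij.sum_comp (fun h => ‖∑ x, ((f x * f (x + h) : ℝ) : ℂ) * chi (φ h) x‖),
      Finset.mul_sum]
    refine Finset.sum_le_sum fun h _ => ?_
    exact three_point_le (fun x => f x * f (x + -c h))
      (fun x => g₁ x * g₁ (x + (a h - c h))) (fun x => g₂ x * g₂ (x + (b h - c h)))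
      (fun x => hmul (h₁ _) (h₁ _)) (fun x => hmul (h₂ _) (h₂ _)) a b ha hb hab _ (hφ _)
  rw [e1]
  calc (∑ y, g₃ y * ∑ d, u y d) ^ 2 ≤ (∑ y, g₃ y ^ 2) * ∑ y, (∑ d, u y d) ^ 2 :=
        Finset.sum_mul_sq_le_sq_mul_sq _ _ _
    _ ≤ (p : ℝ) ^ 2 * ((p : ℝ) ^ 2 * ∑ h, ‖∑ x, ((f x * f (x + h) : ℝ) : ℂ) * chi (φ h) x‖) := by
        refine mul_le_mul ?_ e4 (Finset.sum_nonneg fun _ _ => sq_nonneg _) (by positivity)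
        calc ∑ y, g₃ y ^ 2 ≤ ∑ y : Plane p, (1 : ℝ) :=
              Finset.sum_le_sum fun y _ => (sq_le_one_iff_abs_le_one _).2 (h₃ y)
          _ = (p : ℝ) ^ 2 := by simp [sq]
    _ = _ := by ring

end vonNeumann

section quadruples

variable {p : ℕ} [NeZero p]

lemma sum_plane_prod {M : Type*} [AddCommMonoid M] (G : Plane p × Plane p → M) :
    ∑ q, G q = ∑ a : Plane p, ∑ b : Plane p, G (a, b) := Fintype.sum_prod_type G

lemma sum_norm_sq_sum_chi {ι : Type*} (I : Finset ι) (L : ι → Plane p) :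
    ∑ k : Plane p, ‖∑ i ∈ I, chi (L i) k‖ ^ 2 =
      (p : ℝ) ^ 2 * ((I ×ˢ I).filter fun q => L q.1 = L q.2).card := by
  have key : ((∑ k : Plane p, ‖∑ i ∈ I, chi (L i) k‖ ^ 2 : ℝ) : ℂ) =
      (((p : ℝ) ^ 2 * ((I ×ˢ I).filter fun q => L q.1 = L q.2).card : ℝ) : ℂ) := by
    push_cast
    have e1 : ∀ k : Plane p, (‖∑ i ∈ I, chi (L i) k‖ : ℂ) ^ 2 =
        ∑ q ∈ I ×ˢ I, chi k (L q.1 - L q.2) := by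
      intro k
      rw [← Complex.mul_conj', map_sum, Finset.sum_mul_sum, Finset.sum_product]
      refine Finset.sum_congr rfl fun s _ => Finset.sum_congr rfl fun t _ => ?_
      rw [conj_chi, ← chi_add_left, chi_comm, sub_eq_add_neg]
    simp_rw [e1]
    rw [Finset.sum_comm]
    simp_rw [sum_chi, sub_eq_zero]
    rw [← Finset.sum_filter, Finset.sum_const, nsmul_eq_mul, mul_comm]
  exact_mod_cast key

/-- A Weyl-type inequality: correlations are controlled by the autocorrelation of the weight. -/
lemma sum_norm_sq_correlation_le (F : Plane p → ℝ) (hF : ∀ x, |F x| ≤ 1) (B : Finset (Plane p))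
    (u : Plane p → ℂ) :
    ∑ y, ‖∑ h ∈ B, (F (y + h) : ℂ) * u h‖ ^ 2 ≤ (p : ℝ) ^ 2 *
      ∑ t : Plane p, ‖∑ i ∈ (B ×ˢ B).filter (fun i => i.1 - i.2 = t),
        u i.1 * (starRingEnd ℂ) (u i.2)‖ := by
  let R : Plane p → ℂ := fun t => ∑ y, (F (y + t) * F y : ℝ)
  have hR : ∀ t, ‖R t‖ ≤ (p : ℝ) ^ 2 := by
    intro t
    calc ‖R t‖ ≤ ∑ y : Plane p, (1 : ℝ) := by
          refine (norm_sum_le _ _).trans (Finset.sum_le_sum fun y _ => ?_)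
          rw [Complex.norm_real, Real.norm_eq_abs, abs_mul]
          exact mul_le_one₀ (hF _) (abs_nonneg _) (hF _)
      _ = (p : ℝ) ^ 2 := by simp [sq]
  have key : ((∑ y, ‖∑ h ∈ B, (F (y + h) : ℂ) * u h‖ ^ 2 : ℝ) : ℂ) =
      ∑ t : Plane p, R t * ∑ i ∈ (B ×ˢ B).filter (fun i => i.1 - i.2 = t),
        u i.1 * (starRingEnd ℂ) (u i.2) := by
    push_cast
    have e1 : ∀ y : Plane p, (‖∑ h ∈ B, (F (y + h) : ℂ) * u h‖ : ℂ) ^ 2 =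
        ∑ q ∈ B ×ˢ B, u q.1 * (starRingEnd ℂ) (u q.2) * (F (y + q.1) * F (y + q.2) : ℝ) := by
      intro k
      rw [← Complex.mul_conj', map_sum, Finset.sum_mul_sum, Finset.sum_product]
      refine Finset.sum_congr rfl fun s _ => Finset.sum_congr rfl fun t _ => ?_
      rw [map_mul, Complex.conj_ofReal]
      push_cast
      ring
    simp_rw [e1]
    rw [Finset.sum_comm, ← Finset.sum_fiberwise (B ×ˢ B) (fun i => i.1 - i.2)]
    refine Finset.sum_congr rfl fun t _ => ?_
    rw [Finset.mul_sum]
    refine Finset.sum_congr rfl fun i hi => ?_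
    rw [← Finset.mul_sum, mul_comm]
    congr 1
    rw [← (Finset.mem_filter.1 hi).2, ← Equiv.sum_comp (Equiv.addRight (-i.2))]
    refine Finset.sum_congr rfl fun y _ => ?_
    simp only [Equiv.coe_addRight]
    rw [show y + -i.2 + i.1 = y + (i.1 - i.2) by abel, neg_add_cancel_right]
  have h0 : 0 ≤ ∑ y, ‖∑ h ∈ B, (F (y + h) : ℂ) * u h‖ ^ 2 :=
    Finset.sum_nonneg fun _ _ => by positivity
  calc _ = ‖((∑ y, ‖∑ h ∈ B, (F (y + h) : ℂ) * u h‖ ^ 2 : ℝ) : ℂ)‖ := by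
        rw [Complex.norm_real, Real.norm_of_nonneg h0]
    _ ≤ _ := by
        rw [key, Finset.mul_sum]
        refine (norm_sum_le _ _).trans (Finset.sum_le_sum fun t _ => ?_)
        rw [norm_mul]
        exact mul_le_mul_of_nonneg_right (hR t) (norm_nonneg _)

/-- If many derivatives of `f` correlate with characters, then the frequencies satisfy many
additive relations. -/
theorem many_quadruples (f : Plane p → ℝ) (hf : ∀ x, |f x| ≤ 1) (φ : Plane p → Plane p)
    (B : Finset (Plane p)) (τ : ℝ) (hτ : 0 ≤ τ) (hB : τ * (p : ℝ) ^ 2 ≤ B.card)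
    (hφ : ∀ h ∈ B, τ * (p : ℝ) ^ 2 ≤ ‖∑ x, ((f x * f (x + h) : ℝ) : ℂ) * chi (φ h) x‖) :
    τ ^ 12 * (p : ℝ) ^ 6 ≤ ((((B ×ˢ B) ×ˢ (B ×ˢ B)).filter fun q =>
      q.1.1 - q.1.2 = q.2.1 - q.2.2 ∧ φ q.1.1 - φ q.1.2 = φ q.2.1 - φ q.2.2).card : ℕ) := by
  set N : ℝ := (p : ℝ) ^ 2 with hN
  have hN0 : 0 < N := by
    have : 0 < p := Nat.pos_of_ne_zero (NeZero.ne p)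
    positivity
  obtain ⟨Q, hQ⟩ : ∃ Q : ℝ, Q = ((((B ×ˢ B) ×ˢ (B ×ˢ B)).filter fun q =>
      q.1.1 - q.1.2 = q.2.1 - q.2.2 ∧ φ q.1.1 - φ q.1.2 = φ q.2.1 - φ q.2.2).card : ℕ) :=
    ⟨_, rfl⟩
  rw [← hQ]
  let F : Plane p → Plane p → ℝ := fun k y => f y * f (y + k)
  have hF : ∀ k y, |F k y| ≤ 1 := by
    intro k y
    simp only [F, abs_mul]
    exact mul_le_one₀ (hf _) (abs_nonneg _) (hf _)
  let U : Plane p → Plane p → ℂ := fun k t =>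
    ∑ i ∈ (B ×ˢ B).filter (fun i => i.1 - i.2 = t), chi (φ i.1) k * (starRingEnd ℂ) (chi (φ i.2) k)
  let X : Plane p → Plane p → ℂ := fun k y => ∑ h ∈ B, (F k (y + h) : ℂ) * chi (φ h) k
  have s1 : τ ^ 3 * N ^ 3 ≤
      ∑ h ∈ B, ‖∑ x, ((f x * f (x + h) : ℝ) : ℂ) * chi (φ h) x‖ ^ 2 := by
    calc τ ^ 3 * N ^ 3 = (τ * N) * (τ * N) ^ 2 := by ring
      _ ≤ B.card * (τ * N) ^ 2 := mul_le_mul_of_nonneg_right hB (by positivity)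
      _ = ∑ h ∈ B, (τ * N) ^ 2 := by simp
      _ ≤ _ := Finset.sum_le_sum fun h hh => pow_le_pow_left₀ (by positivity) (hφ h hh) 2
  have s2 : ((∑ h ∈ B, ‖∑ x, ((f x * f (x + h) : ℝ) : ℂ) * chi (φ h) x‖ ^ 2 : ℝ) : ℂ) =
      ∑ q : Plane p × Plane p, (F q.1 q.2 : ℂ) * X q.1 q.2 := by
    push_cast
    have e1 : ∀ h, (‖∑ x, (f x : ℂ) * f (x + h) * chi (φ h) x‖ : ℂ) ^ 2 =
        ∑ q : Plane p × Plane p, (F q.1 q.2 : ℂ) * ((F q.1 (q.2 + h) : ℂ) * chi (φ h) q.1) := by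
      intro h
      rw [← Complex.mul_conj', map_sum, Finset.sum_mul_sum, sum_plane_prod, Finset.sum_comm]
      symm
      rw [Finset.sum_comm]
      refine Finset.sum_congr rfl fun y _ => ?_
      rw [← Equiv.sum_comp (Equiv.subRight y)]
      refine Finset.sum_congr rfl fun x _ => ?_
      simp only [Equiv.subRight_apply, F, map_mul, Complex.conj_ofReal, conj_chi]
      rw [show y + (x - y) = x by abel, show y + h + (x - y) = x + h by abel, sub_eq_add_neg,
        chi_add_right, chi_neg_right]
      push_cast
      ring
    simp_rw [e1, X]
    rw [Finset.sum_comm]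
    simp_rw [Finset.mul_sum]
  have s3 : (τ ^ 3 * N ^ 3) ^ 2 ≤ N ^ 2 * ∑ q : Plane p × Plane p, ‖X q.1 q.2‖ ^ 2 := by
    have : τ ^ 3 * N ^ 3 ≤ ∑ q : Plane p × Plane p, 1 * ‖X q.1 q.2‖ := by
      refine (s1.trans (Real.le_norm_self _)).trans ?_
      rw [← Complex.norm_real, s2]
      refine (norm_sum_le _ _).trans (Finset.sum_le_sum fun q _ => ?_)
      rw [norm_mul, Complex.norm_real]
      exact mul_le_mul_of_nonneg_right (hF _ _) (norm_nonneg _)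
    refine (pow_le_pow_left₀ (by positivity) this 2).trans
      ((Finset.sum_mul_sq_le_sq_mul_sq _ _ _).trans (le_of_eq ?_))
    congr 1
    simp [hN, Fintype.card_prod]
    ring
  have s4 : ∑ q : Plane p × Plane p, ‖X q.1 q.2‖ ^ 2 ≤
      N * ∑ q : Plane p × Plane p, ‖U q.1 q.2‖ := by
    rw [sum_plane_prod, sum_plane_prod, Finset.mul_sum]
    exact Finset.sum_le_sum fun k _ =>
      sum_norm_sq_correlation_le (F k) (hF k) B (fun h => chi (φ h) k)
  have s5 : ∑ q : Plane p × Plane p, ‖U q.1 q.2‖ ^ 2 = N * Q := by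
    rw [sum_plane_prod, Finset.sum_comm]
    have : ∀ t, ∑ k : Plane p, ‖U k t‖ ^ 2 = N *
        ∑ i ∈ (((B ×ˢ B) ×ˢ (B ×ˢ B)).filter fun q => q.1.1 - q.1.2 = q.2.1 - q.2.2 ∧
          φ q.1.1 - φ q.1.2 = φ q.2.1 - φ q.2.2).filter (fun q => q.1.1 - q.1.2 = t), (1 : ℝ) := by
      intro t
      have e : ∀ k, U k t = ∑ i ∈ (B ×ˢ B).filter (fun i => i.1 - i.2 = t),
          chi (φ i.1 - φ i.2) k := by
        intro k
        refine Finset.sum_congr rfl fun i _ => ?_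
        rw [conj_chi, ← chi_neg_right, chi_neg_right, sub_eq_add_neg, chi_add_left]
      simp_rw [e]
      rw [sum_norm_sq_sum_chi]
      simp only [Finset.sum_const, nsmul_eq_mul, mul_one]
      congr 3
      ext q
      simp only [Finset.mem_filter, Finset.mem_product]
      constructor
      · rintro ⟨⟨⟨h1, h2⟩, h3, h4⟩, h5⟩
        exact ⟨⟨⟨h1, h3⟩, h2.trans h4.symm, h5⟩, h2⟩
      · rintro ⟨⟨⟨h1, h3⟩, h2, h5⟩, h6⟩
        exact ⟨⟨⟨h1, h6⟩, h3, h2 ▸ h6⟩, h5⟩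
    simp_rw [this]
    rw [← Finset.mul_sum, Finset.sum_fiberwise]
    simp [hQ]
  have s6 : (∑ q : Plane p × Plane p, ‖U q.1 q.2‖) ^ 2 ≤ N ^ 3 * Q := by
    have := Finset.sum_mul_sq_le_sq_mul_sq (Finset.univ : Finset (Plane p × Plane p))
      (fun _ => (1 : ℝ)) (fun q => ‖U q.1 q.2‖)
    simp only [one_mul, s5] at this
    refine this.trans (le_of_eq ?_)
    simp [hN, Fintype.card_prod]
    ring
  have s7 : (τ ^ 3 * N ^ 3) ^ 2 ≤ N ^ 3 * ∑ q : Plane p × Plane p, ‖U q.1 q.2‖ := by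
    refine s3.trans ((mul_le_mul_of_nonneg_left s4 (by positivity)).trans (le_of_eq ?_))
    ring
  have s8 : N ^ 9 * (τ ^ 12 * N ^ 3) ≤ N ^ 9 * Q := by
    calc N ^ 9 * (τ ^ 12 * N ^ 3) = ((τ ^ 3 * N ^ 3) ^ 2) ^ 2 := by ring
      _ ≤ (N ^ 3 * ∑ q : Plane p × Plane p, ‖U q.1 q.2‖) ^ 2 :=
          pow_le_pow_left₀ (by positivity) s7 2
      _ = N ^ 6 * (∑ q : Plane p × Plane p, ‖U q.1 q.2‖) ^ 2 := by ring
      _ ≤ N ^ 6 * (N ^ 3 * Q) := mul_le_mul_of_nonneg_left s6 (by positivity)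
      _ = _ := by ring
  have := le_of_mul_le_mul_left s8 (by positivity)
  rw [show (p : ℝ) ^ 6 = N ^ 3 by rw [hN]; ring]
  exact this

end quadruples

section BalogSzemerediGowers

open scoped Pointwise

variable {G : Type*} [AddCommGroup G] [DecidableEq G]

/-- The pairs of elements of `A` with difference `D`. -/
def diffPairs (A : Finset G) (D : G) : Finset (G × G) :=
  (A ×ˢ A).filter fun q => q.1 - q.2 = D

lemma mem_diffPairs {A : Finset G} {D : G} {q : G × G} :
    q ∈ diffPairs A D ↔ (q.1 ∈ A ∧ q.2 ∈ A) ∧ q.1 - q.2 = D := by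
  simp [diffPairs]

lemma card_diffPairs_le (A : Finset G) (D : G) : (diffPairs A D).card ≤ A.card := by
  refine Finset.card_le_card_of_injOn Prod.fst (fun q hq => (mem_diffPairs.1 hq).1.1) ?_
  rintro ⟨x, y⟩ h ⟨x', y'⟩ h' (rfl : x = x')
  have h1 := (mem_diffPairs.1 h).2
  have h2 := (mem_diffPairs.1 h').2
  simp only at h1 h2
  rw [← h2] at h1
  simpa using h1

/-- Elements represented in many ways as an alternating sum of eight elements are few. -/
lemma card_mul_le_pow_eight (A X : Finset G) (w : ℝ)
    (hw : ∀ D ∈ X, ∃ T : Finset (G × G × G), ∃ a a' : G, a - a' = D ∧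
      w ≤ ∑ q ∈ T, ((diffPairs A (a - q.2.1)).card : ℝ) * (diffPairs A (q.1 - q.2.1)).card *
        ((diffPairs A (q.1 - q.2.2)).card * (diffPairs A (a' - q.2.2)).card)) :
    X.card * w ≤ (A.card : ℝ) ^ 8 := by
  let S : Finset (((G × G) × (G × G)) × ((G × G) × (G × G))) :=
    ((A ×ˢ A) ×ˢ (A ×ˢ A)) ×ˢ ((A ×ˢ A) ×ˢ (A ×ˢ A))
  let σ : ((G × G) × (G × G)) × ((G × G) × (G × G)) → G := fun s =>
    (s.1.1.1 - s.1.1.2) - (s.1.2.1 - s.1.2.2) + ((s.2.1.1 - s.2.1.2) - (s.2.2.1 - s.2.2.2))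
  have hS : (S.card : ℝ) = (A.card : ℝ) ^ 8 := by
    simp only [S, Finset.card_product]
    push_cast
    ring
  have key : ∀ D ∈ X, w ≤ ((S.filter fun s => σ s = D).card : ℝ) := by
    intro D hD
    obtain ⟨T, a, a', haa, hT⟩ := hw D hD
    let Φ : G × G × G → Finset (((G × G) × (G × G)) × ((G × G) × (G × G))) := fun q =>
      (diffPairs A (a - q.2.1) ×ˢ diffPairs A (q.1 - q.2.1)) ×ˢ
        (diffPairs A (q.1 - q.2.2) ×ˢ diffPairs A (a' - q.2.2))
    have hdis : (T : Set (G × G × G)).PairwiseDisjoint Φ := by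
      intro q _ q' _ hqq
      rw [Function.onFun, Finset.disjoint_left]
      intro s hs hs'
      apply hqq
      simp only [Φ, Finset.mem_product, mem_diffPairs] at hs hs'
      obtain ⟨⟨⟨_, e1⟩, _, e2⟩, ⟨_, e3⟩, _, e4⟩ := hs
      obtain ⟨⟨⟨_, e1'⟩, _, e2'⟩, ⟨_, e3'⟩, _, e4'⟩ := hs'
      have h1 : q.2.1 = q'.2.1 := by simpa using e1.symm.trans e1'
      have h2 : q.2.2 = q'.2.2 := by simpa using e4.symm.trans e4'
      have h3 : q.1 = q'.1 := by simpa [h1] using e2.symm.trans e2'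
      exact Prod.ext h3 (Prod.ext h1 h2)
    have hsub : T.biUnion Φ ⊆ S.filter fun s => σ s = D := by
      intro s hs
      obtain ⟨q, _, hs⟩ := Finset.mem_biUnion.1 hs
      simp only [Φ, Finset.mem_product, mem_diffPairs] at hs
      obtain ⟨⟨⟨m1, e1⟩, m2, e2⟩, ⟨m3, e3⟩, m4, e4⟩ := hs
      rw [Finset.mem_filter]
      refine ⟨by simp only [S, Finset.mem_product]; exact ⟨⟨m1, m2⟩, m3, m4⟩, ?_⟩
      simp only [σ, e1, e2, e3, e4, ← haa]
      abel
    refine hT.trans ?_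
    have := Finset.card_le_card hsub
    rw [Finset.card_biUnion hdis] at this
    refine le_trans (le_of_eq ?_) (Nat.cast_le.2 this)
    push_cast
    refine Finset.sum_congr rfl fun q _ => ?_
    simp only [Φ, Finset.card_product]
    push_cast
    ring
  calc X.card * w = ∑ D ∈ X, w := by simp
    _ ≤ ∑ D ∈ X, ((S.filter fun s => σ s = D).card : ℝ) := Finset.sum_le_sum key
    _ = ((X.biUnion fun D => S.filter fun s => σ s = D).card : ℝ) := by
        rw [Finset.card_biUnion]
        · push_cast; rfl
        · intro D _ D' _ hne
          rw [Function.onFun, Finset.disjoint_left]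
          intro s hs hs'
          exact hne ((Finset.mem_filter.1 hs).2.symm.trans (Finset.mem_filter.1 hs').2)
    _ ≤ S.card := by
        refine Nat.cast_le.2 (Finset.card_le_card ?_)
        intro s hs
        obtain ⟨D, _, hs⟩ := Finset.mem_biUnion.1 hs
        exact (Finset.mem_filter.1 hs).1
    _ = _ := hS

set_option maxHeartbeats 1000000 in
/-- **Balog–Szemerédi–Gowers theorem**: a set of large additive energy has a large subset of small
doubling. -/
theorem balog_szemeredi_gowers (A : Finset G) (c : ℝ) (hc : 0 < c)
    (hE : c * (A.card : ℝ) ^ 3 ≤ ((((A ×ˢ A) ×ˢ (A ×ˢ A)).filter fun q =>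
      q.1.1 - q.1.2 = q.2.1 - q.2.2).card : ℕ)) :
    ∃ A' ⊆ A, (c / 8) * A.card ≤ A'.card ∧
      (c / 2) ^ 10 * ((A' - A').card : ℝ) ≤ 2 ^ 14 * A'.card := by
  rcases A.eq_empty_or_nonempty with rfl | hne
  · exact ⟨∅, by simp⟩
  set n : ℝ := (A.card : ℝ) with hn
  have hn0 : 0 < n := by rw [hn]; exact_mod_cast hne.card_pos
  set α : ℝ := c / 2 with hα
  have hα0 : 0 < α := by positivity
  set β : ℝ := α ^ 2 / 32 with hβ
  have hβ0 : 0 < β := by positivity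
  let r : G → ℝ := fun D => (diffPairs A D).card
  have hr0 : ∀ D, 0 ≤ r D := fun D => Nat.cast_nonneg _
  let N : G → Finset G := fun y => A.filter fun a => α * n ≤ r (a - y)
  -- many popular pairs
  have s1 : α * n ^ 2 ≤ ∑ y ∈ A, ((N y).card : ℝ) := by
    have e : (((((A ×ˢ A) ×ˢ (A ×ˢ A)).filter fun q =>
        q.1.1 - q.1.2 = q.2.1 - q.2.2).card : ℕ) : ℝ) = ∑ y ∈ A, ∑ a ∈ A, r (a - y) := by
      rw [Finset.card_filter, Finset.sum_product, Finset.sum_product, Finset.sum_comm]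
      push_cast
      refine Finset.sum_congr rfl fun y _ => Finset.sum_congr rfl fun a _ => ?_
      simp only [r, diffPairs]
      rw [Finset.card_filter]
      push_cast
      exact Finset.sum_congr rfl fun q _ => by simp only [eq_comm]
    have e2 : ∀ y ∈ A, ∑ a ∈ A, r (a - y) ≤ n * (N y).card + n * (α * n) := by
      intro y _
      rw [← Finset.sum_filter_add_sum_filter_not A (fun a => α * n ≤ r (a - y))]
      refine add_le_add ?_ ?_
      · calc _ ≤ ∑ a ∈ N y, n := Finset.sum_le_sum fun a _ => by
              exact Nat.cast_le.2 (card_diffPairs_le A _)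
          _ = _ := by simp [mul_comm]
      · calc _ ≤ ∑ a ∈ A.filter (fun a => ¬ α * n ≤ r (a - y)), α * n :=
              Finset.sum_le_sum fun a ha => (not_le.1 (Finset.mem_filter.1 ha).2).le
          _ ≤ ∑ a ∈ A, α * n :=
              Finset.sum_le_sum_of_subset_of_nonneg (Finset.filter_subset _ _)
                fun _ _ _ => by positivity
          _ = _ := by simp [hn]
    have e3 := Finset.sum_le_sum e2
    rw [← e, Finset.sum_add_distrib, ← Finset.mul_sum, Finset.sum_const, nsmul_eq_mul, ← hn] at e3
    have e4 : n * (α * n ^ 2) ≤ n * ∑ y ∈ A, ((N y).card : ℝ) := by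
      have := hE.trans e3
      have h2 : c = 2 * α := by rw [hα]; ring
      rw [h2] at this
      linarith
    exact le_of_mul_le_mul_left e4 hn0
  have s2 : α ^ 2 * n ^ 3 ≤ ∑ y ∈ A, ((N y).card : ℝ) ^ 2 := by
    have h1 := Finset.sum_mul_sq_le_sq_mul_sq A (fun _ => (1 : ℝ)) (fun y => ((N y).card : ℝ))
    simp only [one_mul, one_pow, Finset.sum_const, nsmul_eq_mul, mul_one] at h1
    rw [← hn] at h1
    have h2 : (α * n ^ 2) ^ 2 ≤ n * ∑ y ∈ A, ((N y).card : ℝ) ^ 2 :=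
      (pow_le_pow_left₀ (by positivity) s1 2).trans h1
    refine le_of_mul_le_mul_left (le_trans (le_of_eq ?_) h2) hn0
    ring
  -- common neighbours
  let C : G → G → Finset G := fun a b => A.filter fun y => α * n ≤ r (a - y) ∧ α * n ≤ r (b - y)
  let bad : G → Finset (G × G) := fun y =>
    ((N y) ×ˢ (N y)).filter fun q => ((C q.1 q.2).card : ℝ) < β * n
  have s3 : ∑ y ∈ A, ((bad y).card : ℝ) ≤ β * n ^ 3 := by
    have e : ∀ y ∈ A, ((bad y).card : ℝ) = ∑ q ∈ A ×ˢ A,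
        if ((C q.1 q.2).card : ℝ) < β * n ∧ (α * n ≤ r (q.1 - y) ∧ α * n ≤ r (q.2 - y))
          then 1 else 0 := by
      intro y _
      rw [← Finset.sum_filter, Finset.sum_const, nsmul_eq_mul, mul_one]
      congr 2
      ext q
      simp only [bad, N, Finset.mem_filter, Finset.mem_product]
      tauto
    rw [Finset.sum_congr rfl e, Finset.sum_comm]
    calc _ ≤ ∑ q ∈ A ×ˢ A, β * n := by
          refine Finset.sum_le_sum fun q _ => ?_
          by_cases h : ((C q.1 q.2).card : ℝ) < β * n
          · simp only [h, true_and]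
            rw [← Finset.sum_filter, Finset.sum_const, nsmul_eq_mul, mul_one]
            exact h.le
          · simp only [h, false_and, if_false, Finset.sum_const_zero]
            positivity
      _ = _ := by
          rw [Finset.sum_const, nsmul_eq_mul, Finset.card_product]
          push_cast
          rw [← hn]; ring
  obtain ⟨y, hy, hyN⟩ : ∃ y ∈ A, β * n ^ 2 ≤ ((N y).card : ℝ) ^ 2 / 16 - (bad y).card := by
    by_contra! hcon
    have h1 := Finset.sum_lt_sum_of_nonempty hne hcon
    rw [Finset.sum_sub_distrib, ← Finset.sum_div, Finset.sum_const, nsmul_eq_mul, ← hn] at h1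
    have h2 : β * n ^ 3 = α ^ 2 * n ^ 3 / 32 := by rw [hβ]; ring
    nlinarith
  set M : ℝ := ((N y).card : ℝ) with hM
  have hM1 : α * n / 2 ≤ M := by
    have h1 : (α * n / 2) ^ 2 ≤ M ^ 2 := by
      have h0 : (0 : ℝ) ≤ (bad y).card := Nat.cast_nonneg _
      have h2 : β * n ^ 2 = (α * n) ^ 2 / 32 := by rw [hβ]; ring
      nlinarith [sq_nonneg (α * n)]
    exact le_of_sq_le_sq h1 (Nat.cast_nonneg _)
  have hM0 : 0 < M := lt_of_lt_of_le (by positivity) hM1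
  have hbad : ((bad y).card : ℝ) ≤ M ^ 2 / 16 := by
    have : 0 < β * n ^ 2 := by positivity
    linarith
  let bd : G → Finset G := fun a => (N y).filter fun b => ((C a b).card : ℝ) < β * n
  let A' : Finset G := (N y).filter fun a => ((bd a).card : ℝ) ≤ M / 4
  have hA'N : A' ⊆ N y := Finset.filter_subset _ _
  have s4 : 3 / 4 * M ≤ A'.card := by
    have h1 : ∑ a ∈ N y, ((bd a).card : ℝ) ≤ M ^ 2 / 16 := by
      refine le_trans (le_of_eq ?_) hbad
      simp only [bad, bd]
      rw [Finset.card_filter, Finset.sum_product]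
      push_cast
      refine Finset.sum_congr rfl fun a _ => ?_
      rw [Finset.card_filter]
      push_cast
      rfl
    have h2 : ∑ a ∈ (N y).filter (fun a => ¬ ((bd a).card : ℝ) ≤ M / 4), M / 4 ≤
        ∑ a ∈ N y, ((bd a).card : ℝ) := by
      refine (Finset.sum_le_sum fun a ha => (not_le.1 (Finset.mem_filter.1 ha).2).le).trans ?_
      exact Finset.sum_le_sum_of_subset_of_nonneg (Finset.filter_subset _ _)
        fun _ _ _ => Nat.cast_nonneg _
    rw [Finset.sum_const, nsmul_eq_mul] at h2
    have h3 : (A'.card : ℝ) +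
        ((N y).filter (fun a => ¬ ((bd a).card : ℝ) ≤ M / 4)).card = M := by
      rw [hM]
      exact_mod_cast Finset.card_filter_add_card_filter_not (s := N y)
        (fun a => ((bd a).card : ℝ) ≤ M / 4)
    have h4 := h2.trans h1
    have h5 : (((N y).filter (fun a => ¬ ((bd a).card : ℝ) ≤ M / 4)).card : ℝ) ≤ M / 4 := by
      refine le_of_mul_le_mul_right (h4.trans (le_of_eq ?_)) (by positivity : 0 < M / 4)
      ring
    linarith
  refine ⟨A', hA'N.trans (Finset.filter_subset _ _), ?_, ?_⟩
  · rw [show c / 8 = α / 4 by rw [hα]; ring]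
    have : 0 < α * n := by positivity
    linarith
  have s5 : ((A' - A').card : ℝ) * (M / 2 * (β * n) ^ 2 * (α * n) ^ 4) ≤ n ^ 8 := by
    refine card_mul_le_pow_eight A (A' - A') _ ?_
    intro D hD
    obtain ⟨a, ha, a', ha', rfl⟩ := Finset.mem_sub.1 hD
    let gd : Finset G := (N y).filter fun b => β * n ≤ (C a b).card ∧ β * n ≤ (C a' b).card
    have hgd : M / 2 ≤ gd.card := by
      have h1 : N y ⊆ gd ∪ (bd a ∪ bd a') := by
        intro b hb
        simp only [gd, bd, Finset.mem_union, Finset.mem_filter, hb, true_and]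
        by_cases h : ((C a b).card : ℝ) < β * n
        · exact Or.inr (Or.inl h)
        · by_cases h' : ((C a' b).card : ℝ) < β * n
          · exact Or.inr (Or.inr h')
          · exact Or.inl ⟨not_lt.1 h, not_lt.1 h'⟩
      have h2 : M ≤ gd.card + ((bd a).card + (bd a').card) := by
        rw [hM]
        exact_mod_cast (Finset.card_le_card h1).trans ((Finset.card_union_le _ _).trans
          (Nat.add_le_add_left (Finset.card_union_le _ _) _))
      have h3 := (Finset.mem_filter.1 ha).2
      have h4 := (Finset.mem_filter.1 ha').2
      linarith
    refine ⟨(gd ×ˢ (A ×ˢ A)).filter fun q => q.2.1 ∈ C a q.1 ∧ q.2.2 ∈ C a' q.1, a, a', rfl, ?_⟩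
    calc M / 2 * (β * n) ^ 2 * (α * n) ^ 4
        ≤ (((gd ×ˢ (A ×ˢ A)).filter fun q => q.2.1 ∈ C a q.1 ∧ q.2.2 ∈ C a' q.1).card : ℝ) *
          (α * n) ^ 4 := by
          refine mul_le_mul_of_nonneg_right ?_ (by positivity)
          rw [Finset.card_filter, Finset.sum_product]
          push_cast
          calc M / 2 * (β * n) ^ 2 ≤ gd.card * (β * n) ^ 2 :=
                mul_le_mul_of_nonneg_right hgd (by positivity)
            _ = ∑ b ∈ gd, (β * n) ^ 2 := by simp
            _ ≤ _ := by
                refine Finset.sum_le_sum fun b hb => ?_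
                have hb' := (Finset.mem_filter.1 hb).2
                rw [← Finset.sum_filter, Finset.sum_const, nsmul_eq_mul, mul_one]
                have : (A ×ˢ A).filter (fun q => q.1 ∈ C a b ∧ q.2 ∈ C a' b) =
                    C a b ×ˢ C a' b := by
                  ext q
                  simp only [Finset.mem_filter, Finset.mem_product, C]
                  tauto
                rw [this, Finset.card_product]
                push_cast
                rw [sq]
                exact mul_le_mul hb'.1 hb'.2 (by positivity) (Nat.cast_nonneg _)
      _ = ∑ q ∈ (gd ×ˢ (A ×ˢ A)).filter fun q => q.2.1 ∈ C a q.1 ∧ q.2.2 ∈ C a' q.1,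
          (α * n) * (α * n) * ((α * n) * (α * n)) := by
          rw [Finset.sum_const, nsmul_eq_mul]; ring
      _ ≤ _ := by
          refine Finset.sum_le_sum fun q hq => ?_
          have hq' := (Finset.mem_filter.1 hq).2
          have h1 := (Finset.mem_filter.1 hq'.1).2
          have h2 := (Finset.mem_filter.1 hq'.2).2
          have h0 : 0 ≤ α * n := by positivity
          exact mul_le_mul (mul_le_mul h1.1 h1.2 h0 (hr0 _)) (mul_le_mul h2.2 h2.1 h0 (hr0 _))
            (by positivity) (mul_nonneg (hr0 _) (hr0 _))
  have s6 : ((A' - A').card : ℝ) * (α ^ 9 / 4096) ≤ n := by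
    have h1 : n ^ 7 * (((A' - A').card : ℝ) * (α ^ 9 / 4096)) ≤ n ^ 7 * n := by
      calc n ^ 7 * (((A' - A').card : ℝ) * (α ^ 9 / 4096))
          = ((A' - A').card : ℝ) * (α * n / 2 / 2 * (β * n) ^ 2 * (α * n) ^ 4) := by
            rw [hβ]; ring
        _ ≤ ((A' - A').card : ℝ) * (M / 2 * (β * n) ^ 2 * (α * n) ^ 4) := by gcongr
        _ ≤ n ^ 8 := s5
        _ = n ^ 7 * n := by ring
    exact le_of_mul_le_mul_left h1 (by positivity)
  have s7 : α * (((A' - A').card : ℝ) * (α ^ 9 / 4096)) ≤ α * n :=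
    mul_le_mul_of_nonneg_left s6 hα0.le
  have s8 : α ^ 10 * ((A' - A').card : ℝ) =
      4096 * (α * (((A' - A').card : ℝ) * (α ^ 9 / 4096))) := by ring
  rw [s8]
  linarith

end BalogSzemerediGowers

section FreimanModel

open scoped Pointwise

variable {p : ℕ}

/-- The graph of `φ` over `H`. -/
def graphOver (H : Finset (Plane p)) (φ : Plane p → Plane p) : Finset (Plane p × Plane p) :=
  H.image fun h => (h, φ h)

lemma mk_mem_graphOver {H : Finset (Plane p)} {φ : Plane p → Plane p} {h : Plane p} (hh : h ∈ H) :
    (h, φ h) ∈ graphOver H φ := Finset.mem_image_of_mem _ hh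

lemma card_graphOver (H : Finset (Plane p)) (φ : Plane p → Plane p) :
    (graphOver H φ).card = H.card :=
  Finset.card_image_of_injective _ fun _ _ h => congrArg Prod.fst h

/-- The nonzero elements of the fibre of `6Γ - 6Γ` over `0`, where `Γ` is the graph of `φ`. -/
def zeroFibre [NeZero p] (H : Finset (Plane p)) (φ : Plane p → Plane p) : Finset (Plane p) :=
  Finset.univ.filter fun ξ => ξ ≠ 0 ∧
    ((0, ξ) : Plane p × Plane p) ∈ 6 • graphOver H φ - 6 • graphOver H φ

lemma card_zeroFibre_le [NeZero p] (H : Finset (Plane p)) (φ : Plane p → Plane p)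
    (hH : H.Nonempty) (K : ℝ)
    (hK : ((graphOver H φ - graphOver H φ).card : ℝ) ≤ K * (graphOver H φ).card) :
    ((zeroFibre H φ).card : ℝ) ≤ K ^ 13 := by
  set Γ := graphOver H φ with hΓ
  have hne : Γ.Nonempty := hH.image _
  have hpos : (0 : ℝ) < Γ.card := by exact_mod_cast hne.card_pos
  have h1 : (zeroFibre H φ).card * Γ.card ≤ (7 • Γ - 6 • Γ).card := by
    rw [← Finset.card_product]
    refine Finset.card_le_card_of_injOn (fun q => (0, q.1) + q.2) ?_ ?_
    · rintro ⟨ξ, g⟩ hq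
      simp only [Finset.coe_product, Set.mem_prod, Finset.mem_coe] at hq
      obtain ⟨x, hx, y, hy, hxy⟩ := Finset.mem_sub.1 (Finset.mem_filter.1 hq.1).2.2
      simp only [Finset.mem_coe]
      rw [← hxy, show x - y + g = (x + g) - y by abel]
      refine Finset.sub_mem_sub ?_ hy
      rw [show (7 : ℕ) = 6 + 1 from rfl, succ_nsmul]
      exact Finset.add_mem_add hx hq.2
    · rintro ⟨ξ, g⟩ hq ⟨ξ', g'⟩ hq' h
      simp only [Finset.coe_product, Set.mem_prod, Finset.mem_coe] at hq hq'
      obtain ⟨a, _, rfl⟩ := Finset.mem_image.1 hq.2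
      obtain ⟨b, _, rfl⟩ := Finset.mem_image.1 hq'.2
      simp only [Prod.mk_add_mk, zero_add, Prod.mk.injEq] at h
      obtain ⟨rfl, h⟩ := h
      rw [add_left_inj] at h
      rw [h]
  have h2 := Finset.pluennecke_ruzsa_inequality_nsmul_sub_nsmul_sub hne Γ 7 6
  have h3 : ((7 • Γ - 6 • Γ).card : ℝ) ≤ (((Γ - Γ).card : ℝ) / Γ.card) ^ 13 * Γ.card := by
    have h := (NNRat.cast_le (K := ℝ)).2 h2
    push_cast at h
    exact h
  have h4 : ((Γ - Γ).card : ℝ) / Γ.card ≤ K := (div_le_iff₀ hpos).2 hK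
  have h5 : ((zeroFibre H φ).card : ℝ) * Γ.card ≤ K ^ 13 * Γ.card := by
    calc ((zeroFibre H φ).card : ℝ) * Γ.card ≤ ((7 • Γ - 6 • Γ).card : ℝ) := by exact_mod_cast h1
      _ ≤ _ := h3
      _ ≤ _ := by gcongr
  exact le_of_mul_le_mul_right h5 hpos

variable [Fact p.Prime]

lemma card_dot_eq_le (ξ : Plane p) (hξ : ξ ≠ 0) (t : ZMod p) :
    (Finset.univ.filter fun s : Plane p => s.1 * ξ.1 + s.2 * ξ.2 = t).card ≤ p := by
  by_cases h : ξ.1 = 0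
  · have h2 : ξ.2 ≠ 0 := fun h2 => hξ (Prod.ext h h2)
    refine (Finset.card_le_card_of_injOn (t := (Finset.univ : Finset (ZMod p))) Prod.fst
      (fun _ _ => Finset.mem_coe.2 (Finset.mem_univ _)) ?_).trans (by simp [ZMod.card])
    intro s hs s' hs' e
    have h3 := (Finset.mem_filter.1 hs).2
    have h4 := (Finset.mem_filter.1 hs').2
    simp only [h, mul_zero, zero_add] at h3 h4
    exact Prod.ext e (mul_right_cancel₀ h2 (h3.trans h4.symm))
  · refine (Finset.card_le_card_of_injOn (t := (Finset.univ : Finset (ZMod p))) Prod.snd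
      (fun _ _ => Finset.mem_coe.2 (Finset.mem_univ _)) ?_).trans (by simp [ZMod.card])
    intro s hs s' hs' e
    have h3 := (Finset.mem_filter.1 hs).2
    have h4 := (Finset.mem_filter.1 hs').2
    refine Prod.ext (mul_right_cancel₀ h ?_) e
    rw [← e] at h4
    exact add_right_cancel (h3.trans h4.symm)

/-- A frequency `s` whose inner products with a small set avoid a short interval. -/
lemma exists_dot_avoiding (A : Finset (Plane p)) (hA : ∀ ξ ∈ A, ξ ≠ 0) (L : ℕ)
    (hL : A.card * (12 * L + 1) < p) :
    ∃ s : Plane p, ∀ ξ ∈ A, ∀ z : ℤ, |z| ≤ 6 * L → s.1 * ξ.1 + s.2 * ξ.2 ≠ (z : ZMod p) := by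
  by_contra! hcon
  have h1 : (Finset.univ : Finset (Plane p)) ⊆
      (A ×ˢ Finset.Icc (-(6 * L : ℤ)) (6 * L)).biUnion fun q =>
        Finset.univ.filter fun s : Plane p => s.1 * q.1.1 + s.2 * q.1.2 = (q.2 : ZMod p) := by
    intro s _
    obtain ⟨ξ, hξ, z, hz, e⟩ := hcon s
    rw [Finset.mem_biUnion]
    refine ⟨(ξ, z), ?_, by simpa using e⟩
    rw [Finset.mem_product, Finset.mem_Icc]
    exact ⟨hξ, abs_le.1 hz⟩
  have h2 := (Finset.card_le_card h1).trans Finset.card_biUnion_le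
  have h3 := h2.trans (Finset.sum_le_card_nsmul _ _ p fun q hq =>
    card_dot_eq_le q.1 (hA _ (Finset.mem_product.1 hq).1) _)
  rw [Finset.card_univ, card_plane, Finset.card_product, Int.card_Icc, smul_eq_mul] at h3
  rw [show ((6 * L : ℤ) + 1 - -(6 * L)).toNat = 12 * L + 1 by omega] at h3
  have hp : 0 < p := (Fact.out : p.Prime).pos
  nlinarith

/-- A dense part of `H` on which `φ` is a Freiman homomorphism of order six. -/
theorem exists_freiman_hom (H : Finset (Plane p)) (φ : Plane p → Plane p)
    (hH : H.Nonempty) (K : ℝ) (hK1 : 1 ≤ K)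
    (hK : ((graphOver H φ - graphOver H φ).card : ℝ) ≤ K * (graphOver H φ).card)
    (hp : 32 * K ^ 13 ≤ p) :
    ∃ H' ⊆ H, (H.card : ℝ) ≤ 64 * K ^ 13 * H'.card ∧ zeroFibre H' φ = ∅ := by
  have hp0 : 0 < p := (Fact.out : p.Prime).pos
  set A := zeroFibre H φ with hA
  have hAK : (A.card : ℝ) ≤ K ^ 13 := card_zeroFibre_le H φ hH K hK
  have hK0 : 1 ≤ K ^ 13 := one_le_pow₀ hK1
  set L : ℕ := ⌊(p : ℝ) / (16 * K ^ 13)⌋₊ with hL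
  have hx : 2 ≤ (p : ℝ) / (16 * K ^ 13) := by
    rw [le_div_iff₀ (by positivity)]; linarith
  have hL1 : (L : ℝ) ≤ (p : ℝ) / (16 * K ^ 13) := Nat.floor_le (by positivity)
  have hL2 : (p : ℝ) / (16 * K ^ 13) < L + 1 := Nat.lt_floor_add_one _
  have hL3 : 1 ≤ L := by
    have : (1 : ℝ) < L + 1 := by linarith
    have : (0 : ℝ) < L := by linarith
    exact_mod_cast this
  have hL4 : (L : ℝ) * (16 * K ^ 13) ≤ p := (le_div_iff₀ (by positivity)).1 hL1
  have hL5 : (p : ℝ) < (L + 1) * (16 * K ^ 13) := (div_lt_iff₀ (by positivity)).1 hL2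
  have hL3' : (1 : ℝ) ≤ L := by exact_mod_cast hL3
  obtain ⟨s, hs⟩ := exists_dot_avoiding A (fun ξ hξ => (Finset.mem_filter.1 hξ).2.1) L (by
    have : (A.card : ℝ) * (12 * L + 1) < p := by
      calc (A.card : ℝ) * (12 * L + 1) ≤ K ^ 13 * (12 * L + 1) := by gcongr
        _ < K ^ 13 * (16 * L) := by gcongr; linarith
        _ ≤ p := by linarith
    exact_mod_cast this)
  let lam : Plane p → ZMod p := fun ξ => s.1 * ξ.1 + s.2 * ξ.2
  have lam_add : ∀ x y, lam (x + y) = lam x + lam y := by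
    intro x y
    simp only [lam, Prod.fst_add, Prod.snd_add]
    ring
  let cell : Plane p → ℕ := fun h => (lam (φ h)).val / L
  have hcell : ∀ h ∈ H, cell h ∈ Finset.range (p / L + 1) := by
    intro h _
    rw [Finset.mem_range, Nat.lt_succ_iff]
    exact Nat.div_le_div_right (ZMod.val_lt _).le
  obtain ⟨j, _, hj⟩ := Finset.exists_le_card_fiber_of_nsmul_le_card_of_maps_to (M := ℝ)
    (b := (H.card : ℝ) / (p / L + 1 : ℕ)) hcell ⟨0, by simp⟩ (by
      rw [Finset.card_range, nsmul_eq_mul, mul_div_cancel₀]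
      positivity)
  refine ⟨H.filter fun h => cell h = j, Finset.filter_subset _ _, ?_, ?_⟩
  · rw [div_le_iff₀ (by positivity)] at hj
    have h1 : ((p / L + 1 : ℕ) : ℝ) ≤ 32 * K ^ 13 + 1 := by
      push_cast
      have : ((p / L : ℕ) : ℝ) ≤ p / L := Nat.cast_div_le
      have : (p : ℝ) / L ≤ 32 * K ^ 13 := by
        rw [div_le_iff₀ (by positivity)]
        nlinarith
      linarith
    have h2 : ((p / L + 1 : ℕ) : ℝ) ≤ 64 * K ^ 13 := by linarith
    calc (H.card : ℝ) ≤ _ := hj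
      _ ≤ _ := by rw [mul_comm]; gcongr
  · rw [Finset.eq_empty_iff_forall_notMem]
    intro ξ hξ
    obtain ⟨hξ0, hξ⟩ := (Finset.mem_filter.1 hξ).2
    have hsub : graphOver (H.filter fun h => cell h = j) φ ⊆ graphOver H φ :=
      Finset.image_subset_image (Finset.filter_subset _ _)
    have hξA : ξ ∈ A := by
      rw [hA, zeroFibre, Finset.mem_filter]
      exact ⟨Finset.mem_univ _, hξ0, Finset.sub_subset_sub (Finset.nsmul_subset_nsmul_left hsub)
        (Finset.nsmul_subset_nsmul_left hsub) hξ⟩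
    have key : ∀ n : ℕ, ∀ x ∈ n • graphOver (H.filter fun h => cell h = j) φ,
        ∃ z : ℤ, 0 ≤ z ∧ z ≤ n * L ∧ lam x.2 = ((z + n * (j * L) : ℤ) : ZMod p) := by
      intro n
      induction n with
      | zero =>
        intro x hx
        rw [zero_nsmul, Finset.mem_zero] at hx
        exact ⟨0, le_rfl, by simp, by simp [hx, lam]⟩
      | succ n ih =>
        intro x hx
        rw [succ_nsmul] at hx
        obtain ⟨y, hy, g, hg, rfl⟩ := Finset.mem_add.1 hx
        obtain ⟨z, hz0, hz1, hz⟩ := ih y hy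
        obtain ⟨h, hh, rfl⟩ := Finset.mem_image.1 hg
        have hc : (lam (φ h)).val / L = j := (Finset.mem_filter.1 hh).2
        have hm := Nat.div_add_mod (lam (φ h)).val L
        rw [hc] at hm
        have hr : (lam (φ h)).val % L ≤ L := (Nat.mod_lt _ (by omega)).le
        obtain ⟨ρ, hρ⟩ : ∃ ρ, ρ = (lam (φ h)).val % L := ⟨_, rfl⟩
        rw [← hρ] at hm hr
        have e : ((L * j + ρ : ℕ) : ZMod p) = lam (φ h) := by
          rw [hm, ZMod.natCast_val, ZMod.cast_id', id]
        refine ⟨z + ρ, by positivity, ?_, ?_⟩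
        · push_cast
          have : (ρ : ℤ) ≤ L := by exact_mod_cast hr
          linarith
        · rw [Prod.snd_add, lam_add, hz]
          push_cast at e ⊢
          linear_combination -e
    obtain ⟨x, hx, y, hy, hxy⟩ := Finset.mem_sub.1 hξ
    obtain ⟨z, hz0, hz1, hz⟩ := key 6 x hx
    obtain ⟨w, hw0, hw1, hw⟩ := key 6 y hy
    refine hs ξ hξA (z - w) ?_ ?_
    · push_cast at hz1 hw1
      rw [abs_le]
      constructor <;> linarith
    · have e : x = y + (0, ξ) := by rw [← hxy]; abel
      have e2 : lam x.2 = lam y.2 + lam ξ := by rw [e, Prod.snd_add, lam_add]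
      rw [hz, hw] at e2
      have e3 : lam ξ = ((z - w : ℤ) : ZMod p) := by
        push_cast at e2 ⊢
        linear_combination -e2
      exact e3

end FreimanModel

section Bogolyubov

variable {p : ℕ} [NeZero p]

/-- Bogolyubov's lemma: `H + H - H - H` contains a Bohr neighbourhood of bounded rank. -/
theorem bogolyubov (H : Finset (Plane p)) (hH : H.Nonempty) :
    ∃ Λ : Finset (Plane p), (Λ.card : ℝ) * H.card ^ 2 ≤ 2 * p ^ 4 ∧
      ∀ x, (∀ ξ ∈ Λ, 0 ≤ (chi ξ x).re) →
        ∃ a ∈ H, ∃ b ∈ H, ∃ c ∈ H, ∃ d ∈ H, x = a + b - c - d := by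
  classical
  have hp : (0 : ℝ) < (p : ℝ) ^ 2 := by
    have : 0 < p := Nat.pos_of_ne_zero (NeZero.ne p)
    positivity
  have hc : (0 : ℝ) < (H.card : ℝ) := by exact_mod_cast hH.card_pos
  set F : Plane p → ℂ := fun ξ => ∑ h ∈ H, chi ξ h with hF
  have hF0 : F 0 = H.card := by simp [hF]
  have hpars : ∑ ξ : Plane p, ‖F ξ‖ ^ 2 = (p : ℝ) ^ 2 * H.card := by
    have := parseval H (fun _ => (1 : ℂ)) id Function.injective_id.injOn
    simpa [hF] using this
  set θ : ℝ := (H.card : ℝ) ^ 3 / (2 * p ^ 2) with hθ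
  have hθ0 : 0 < θ := by positivity
  set Λ : Finset (Plane p) := Finset.univ.filter fun ξ => θ ≤ ‖F ξ‖ ^ 2 with hΛ
  refine ⟨Λ, ?_, ?_⟩
  · have h1 : (Λ.card : ℝ) * θ ≤ (p : ℝ) ^ 2 * H.card := by
      rw [← hpars, ← nsmul_eq_mul, ← Finset.sum_const]
      calc ∑ _ξ ∈ Λ, θ ≤ ∑ ξ ∈ Λ, ‖F ξ‖ ^ 2 :=
            Finset.sum_le_sum fun ξ hξ => (Finset.mem_filter.1 hξ).2
        _ ≤ _ := Finset.sum_le_sum_of_subset_of_nonneg (Finset.subset_univ _)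
            fun _ _ _ => by positivity
    rw [hθ, mul_div_assoc', div_le_iff₀ (by positivity)] at h1
    refine le_of_mul_le_mul_right ?_ hc
    nlinarith
  · intro x hx
    by_contra! hcon
    have h0 : ∑ ξ : Plane p, ((‖F ξ‖ ^ 4 : ℝ) : ℂ) * chi ξ (-x) = 0 := by
      have e1 : ∀ ξ, F ξ ^ 2 = ∑ q ∈ H ×ˢ H, chi ξ (q.1 + q.2) := by
        intro ξ
        rw [sq, hF, Finset.sum_mul_sum, Finset.sum_product]
        simp only [chi_add_right]
      have e : ∀ ξ : Plane p, ((‖F ξ‖ ^ 4 : ℝ) : ℂ) * chi ξ (-x) =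
          ∑ q ∈ H ×ˢ H, ∑ r ∈ H ×ˢ H, chi ξ (q.1 + q.2 - r.1 - r.2 - x) := by
        intro ξ
        have e2 : ((‖F ξ‖ ^ 4 : ℝ) : ℂ) = F ξ ^ 2 * (starRingEnd ℂ) (F ξ ^ 2) := by
          rw [map_pow, ← mul_pow, Complex.mul_conj']
          push_cast
          ring
        rw [e2, e1, map_sum, Finset.sum_mul_sum, Finset.sum_mul]
        refine Finset.sum_congr rfl fun q _ => ?_
        rw [Finset.sum_mul]
        refine Finset.sum_congr rfl fun r _ => ?_
        rw [conj_chi, ← chi_neg_right, ← chi_add_right, ← chi_add_right]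
        congr 1
        abel
      simp_rw [e]
      rw [Finset.sum_comm]
      refine Finset.sum_eq_zero fun q hq => ?_
      rw [Finset.sum_comm]
      refine Finset.sum_eq_zero fun r hr => ?_
      rw [Finset.mem_product] at hq hr
      rw [sum_chi, if_neg]
      intro h
      exact hcon q.1 hq.1 q.2 hq.2 r.1 hr.1 r.2 hr.2 (sub_eq_zero.1 h).symm
    have h1 : ∑ ξ : Plane p, ‖F ξ‖ ^ 4 * (chi ξ x).re = 0 := by
      have := congrArg Complex.re h0
      rw [Complex.re_sum] at this
      simp only [Complex.re_ofReal_mul, Complex.zero_re] at this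
      rw [← this]
      refine Finset.sum_congr rfl fun ξ _ => ?_
      rw [chi_neg_right, ← conj_chi, Complex.conj_re]
    have hre : ∀ ξ, -1 ≤ (chi ξ x).re := fun ξ => by
      have := Complex.abs_re_le_norm (chi ξ x)
      rw [norm_chi] at this
      exact (abs_le.1 this).1
    have h2 : ∀ ξ ≠ (0 : Plane p), -(θ * ‖F ξ‖ ^ 2) ≤ ‖F ξ‖ ^ 4 * (chi ξ x).re := by
      intro ξ _
      by_cases hm : ξ ∈ Λ
      · have := hx ξ hm
        have h3 : 0 ≤ θ * ‖F ξ‖ ^ 2 := by positivity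
        have h4 : 0 ≤ ‖F ξ‖ ^ 4 * (chi ξ x).re := by positivity
        linarith
      · have h3 : ‖F ξ‖ ^ 2 ≤ θ := by
          by_contra h
          exact hm (Finset.mem_filter.2 ⟨Finset.mem_univ _, (not_le.1 h).le⟩)
        have h4 : ‖F ξ‖ ^ 4 ≤ θ * ‖F ξ‖ ^ 2 := by
          calc ‖F ξ‖ ^ 4 = ‖F ξ‖ ^ 2 * ‖F ξ‖ ^ 2 := by ring
            _ ≤ _ := by gcongr
        nlinarith [hre ξ, pow_nonneg (norm_nonneg (F ξ)) 4]
    have h3 : (H.card : ℝ) ^ 4 - θ * (p ^ 2 * H.card) ≤ 0 := by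
      rw [← hpars, ← h1, Finset.mul_sum, ← Finset.add_sum_erase _ _ (Finset.mem_univ (0 : Plane p)),
        ← Finset.add_sum_erase _ (fun ξ => ‖F ξ‖ ^ 4 * (chi ξ x).re) (Finset.mem_univ (0 : Plane p)),
        hF0]
      have h4 := Finset.sum_le_sum (s := Finset.univ.erase (0 : Plane p))
        fun ξ hξ => h2 ξ (Finset.ne_of_mem_erase hξ)
      rw [Finset.sum_neg_distrib] at h4
      have h5 : 0 ≤ θ * ‖(H.card : ℂ)‖ ^ 2 := by positivity
      simp only [chi_zero_left, Complex.one_re, mul_one, Complex.norm_natCast] at h4 h5 ⊢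
      linarith
    have h4 : θ * (p ^ 2 * H.card) = (H.card : ℝ) ^ 4 / 2 := by
      have : (p : ℝ) ≠ 0 := fun h => by rw [h] at hp; norm_num at hp
      rw [hθ]; field_simp
    have : 0 < (H.card : ℝ) ^ 4 := by positivity
    linarith

end Bogolyubov

section Dirichlet

/-- Simultaneous Dirichlet approximation. -/
theorem exists_simultaneous_approx {ι : Type*} (S : Finset ι) (θ : ι → ℝ) (M : ℕ) (hM : 1 ≤ M) :
    ∃ d : ℕ, 1 ≤ d ∧ d ≤ M ^ S.card ∧ ∀ i ∈ S, ∃ z : ℤ, |d * θ i - z| ≤ 1 / M := by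
  classical
  have hM0 : (0 : ℝ) < M := by exact_mod_cast hM
  let f : ℕ → (i : ι) → i ∈ S → ℕ := fun d i _ => ⌊(M : ℝ) * Int.fract (d * θ i)⌋₊
  have hmaps : ∀ d ∈ Finset.range (M ^ S.card + 1), f d ∈ S.pi fun _ => Finset.range M := by
    intro d _
    rw [Finset.mem_pi]
    intro i _
    rw [Finset.mem_range, Nat.floor_lt (by positivity)]
    have := Int.fract_lt_one (d * θ i)
    nlinarith
  obtain ⟨a, ha, b, hb, hab, he⟩ := Finset.exists_ne_map_eq_of_card_lt_of_maps_to
    (by rw [Finset.card_pi, Finset.prod_const, Finset.card_range, Finset.card_range]; omega) hmaps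
  wlog hlt : a < b generalizing a b
  · exact this b hb a ha hab.symm he.symm (by omega)
  rw [Finset.mem_range] at ha hb
  refine ⟨b - a, by omega, by omega, fun i hi => ⟨⌊b * θ i⌋ - ⌊a * θ i⌋, ?_⟩⟩
  have h1 : ⌊(M : ℝ) * Int.fract (a * θ i)⌋₊ = ⌊(M : ℝ) * Int.fract (b * θ i)⌋₊ :=
    congrFun (congrFun he i) hi
  have h2 := Nat.floor_le (a := (M : ℝ) * Int.fract (a * θ i)) (by positivity)
  have h3 := Nat.lt_floor_add_one ((M : ℝ) * Int.fract (a * θ i))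
  have h4 := Nat.floor_le (a := (M : ℝ) * Int.fract (b * θ i)) (by positivity)
  have h5 := Nat.lt_floor_add_one ((M : ℝ) * Int.fract (b * θ i))
  rw [← h1] at h4 h5
  have h6 : ((b - a : ℕ) : ℝ) * θ i - ((⌊b * θ i⌋ - ⌊a * θ i⌋ : ℤ) : ℝ) =
      Int.fract (b * θ i) - Int.fract (a * θ i) := by
    rw [Nat.cast_sub hlt.le, Int.fract, Int.fract]
    push_cast
    ring
  rw [h6, le_div_iff₀ hM0]
  calc |Int.fract (b * θ i) - Int.fract (a * θ i)| * M
      = |(Int.fract (b * θ i) - Int.fract (a * θ i)) * M| := by rw [abs_mul, abs_of_pos hM0]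
    _ ≤ 1 := by rw [abs_le]; constructor <;> linarith

lemma norm_exp_sub_one_le (t : ℝ) (z : ℤ) :
    ‖Complex.exp (2 * Real.pi * Complex.I * t) - 1‖ ≤ 2 * Real.pi * |t - z| := by
  have h : Complex.exp (2 * Real.pi * Complex.I * t) =
      Complex.exp (Complex.I * ((2 * Real.pi * (t - z) : ℝ) : ℂ)) := by
    rw [Complex.exp_eq_exp_iff_exists_int]
    refine ⟨z, ?_⟩
    push_cast
    ring
  rw [h]
  refine (Real.norm_exp_I_mul_ofReal_sub_one_le).trans ?_
  rw [Real.norm_eq_abs, abs_mul, abs_of_pos (by positivity)]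

variable {p : ℕ} [NeZero p]

lemma chi_intCast (ξ : Plane p) (i j : ℤ) :
    chi ξ ((i : ZMod p), (j : ZMod p)) = Complex.exp (2 * Real.pi * Complex.I *
      ((i * ((ξ.1.val : ℝ) / p) + j * ((ξ.2.val : ℝ) / p) : ℝ) : ℂ)) := by
  have h : ξ.1 * (i : ZMod p) + ξ.2 * (j : ZMod p) =
      (((ξ.1.val : ℤ) * i + (ξ.2.val : ℤ) * j : ℤ) : ZMod p) := by
    push_cast
    simp
  rw [chi, h, ZMod.stdAddChar_coe]
  congr 1
  push_cast
  ring

/-- A character is almost constant on a grid whose step nearly annihilates its frequency. -/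
lemma norm_chi_sub_one_le (ξ : Plane p) (d : ℕ) (ε : ℝ)
    (h1 : ∃ z : ℤ, |d * ((ξ.1.val : ℝ) / p) - z| ≤ ε)
    (h2 : ∃ z : ℤ, |d * ((ξ.2.val : ℝ) / p) - z| ≤ ε) (m : ℝ) (i j : ℤ)
    (hi : |(i : ℝ)| ≤ m) (hj : |(j : ℝ)| ≤ m) :
    ‖chi ξ (((d * i : ℤ) : ZMod p), ((d * j : ℤ) : ZMod p)) - 1‖ ≤ 4 * Real.pi * m * ε := by
  obtain ⟨z, hz⟩ := h1
  obtain ⟨w, hw⟩ := h2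
  rw [chi_intCast]
  refine (norm_exp_sub_one_le _ (i * z + j * w)).trans ?_
  have h3 : |((d * i : ℤ) : ℝ) * ((ξ.1.val : ℝ) / p) + ((d * j : ℤ) : ℝ) * ((ξ.2.val : ℝ) / p) -
      ((i * z + j * w : ℤ) : ℝ)| ≤ m * ε + m * ε := by
    have e : ((d * i : ℤ) : ℝ) * ((ξ.1.val : ℝ) / p) + ((d * j : ℤ) : ℝ) * ((ξ.2.val : ℝ) / p) -
      ((i * z + j * w : ℤ) : ℝ) = i * (d * ((ξ.1.val : ℝ) / p) - z) +
        j * (d * ((ξ.2.val : ℝ) / p) - w) := by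
      push_cast; ring
    rw [e]
    refine (abs_add_le _ _).trans ?_
    rw [abs_mul, abs_mul]
    have := (abs_nonneg _).trans hi
    gcongr
  have := Real.pi_pos
  nlinarith

end Dirichlet

section Linearisation

open scoped Pointwise

variable {p : ℕ}

lemma sum_mem_nsmul_graphOver {H : Finset (Plane p)} {φ : Plane p → Plane p} :
    ∀ (n : ℕ) (a : Fin n → Plane p), (∀ i, a i ∈ H) →
      ((∑ i, a i, ∑ i, φ (a i)) : Plane p × Plane p) ∈ n • graphOver H φ := by
  intro n
  induction n with
  | zero => intro a _; simp
  | succ n ih =>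
    intro a ha
    rw [succ_nsmul, Fin.sum_univ_castSucc, Fin.sum_univ_castSucc, ← Prod.mk_add_mk]
    exact Finset.add_mem_add (ih _ fun i => ha _) (mk_mem_graphOver (ha _))

variable [NeZero p]

/-- A trivial zero fibre makes `φ` a Freiman homomorphism of order six. -/
lemma sum_eq_of_zeroFibre_eq_empty {H : Finset (Plane p)} {φ : Plane p → Plane p}
    (h : zeroFibre H φ = ∅) (a b : Fin 6 → Plane p) (ha : ∀ i, a i ∈ H) (hb : ∀ i, b i ∈ H)
    (hab : ∑ i, a i = ∑ i, b i) : ∑ i, φ (a i) = ∑ i, φ (b i) := by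
  by_contra hne
  have : ∑ i, φ (a i) - ∑ i, φ (b i) ∈ zeroFibre H φ := by
    rw [zeroFibre, Finset.mem_filter]
    refine ⟨Finset.mem_univ _, sub_ne_zero.2 hne, ?_⟩
    have := Finset.sub_mem_sub (sum_mem_nsmul_graphOver (φ := φ) 6 a ha)
      (sum_mem_nsmul_graphOver (φ := φ) 6 b hb)
    rwa [Prod.mk_sub_mk, hab, sub_self] at this
  rw [h] at this
  exact absurd this (Finset.notMem_empty _)

/-- A locally additive function on an interval of integers is linear. -/
lemma eq_zsmul_of_locally_additive {V : Type*} [AddCommGroup V] (g : ℤ → V) (m : ℤ) (hm : 1 ≤ m)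
    (hg : ∀ i j, |i| ≤ m → |j| ≤ m → |i + j| ≤ m → g (i + j) = g i + g j) (i : ℤ) (hi : |i| ≤ m) :
    g i = i • g 1 := by
  have h0 : g 0 = 0 := by
    have := hg 0 0 (by simp; omega) (by simp; omega) (by simp; omega)
    simpa using this
  have hnat : ∀ k : ℕ, (k : ℤ) ≤ m → g k = (k : ℤ) • g 1 := by
    intro k
    induction k with
    | zero => intro _; simp [h0]
    | succ k ih =>
      intro hk
      push_cast at hk ⊢
      rw [hg k 1 (by rw [abs_le]; omega) (by rw [abs_le]; omega) (by rw [abs_le]; omega),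
        ih (by omega), add_smul, one_smul]
  rw [abs_le] at hi
  rcases le_total 0 i with h | h
  · obtain ⟨k, rfl⟩ := Int.eq_ofNat_of_zero_le h
    exact hnat k hi.2
  · obtain ⟨k, hk⟩ := Int.eq_ofNat_of_zero_le (neg_nonneg.2 h)
    have h1 := hg i (-i) (by rw [abs_le]; omega) (by rw [abs_le]; omega) (by simp; omega)
    rw [add_neg_cancel, h0, hk, hnat k (by omega), ← hk, neg_smul] at h1
    exact (sub_eq_zero.1 (by rw [h1]; abel))

/-- The increments of `φ` along a suitable grid are given by a linear function. -/
theorem exists_linear_on_grid (H : Finset (Plane p)) (φ : Plane p → Plane p) (hH : H.Nonempty)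
    (hφ : zeroFibre H φ = ∅) (σ : ℝ) (hσ : 0 < σ) (hσH : σ * p ^ 2 ≤ H.card) (m : ℕ)
    (hm : 1 ≤ m) :
    ∃ d : ℕ, 1 ≤ d ∧ (d : ℝ) ≤ ((16 * m : ℕ) : ℝ) ^ (4 * σ⁻¹ ^ 2) ∧ ∃ ψ₁ ψ₂ : Plane p,
      ∀ i j : ℤ, |i| ≤ m → |j| ≤ m → ∀ h ∈ H,
        h + (((d * i : ℤ) : ZMod p), ((d * j : ℤ) : ZMod p)) ∈ H →
        φ (h + (((d * i : ℤ) : ZMod p), ((d * j : ℤ) : ZMod p))) = φ h + (i • ψ₁ + j • ψ₂) := by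
  classical
  obtain ⟨Λ, hΛ, hbog⟩ := bogolyubov H hH
  have hp : (0 : ℝ) < p := by exact_mod_cast Nat.pos_of_ne_zero (NeZero.ne p)
  have hcard : (Λ.card : ℝ) ≤ 2 * σ⁻¹ ^ 2 := by
    have h1 : (Λ.card : ℝ) * (σ * p ^ 2) ^ 2 ≤ 2 * p ^ 4 := hΛ.trans' (by gcongr)
    have h2 : (Λ.card : ℝ) * σ ^ 2 ≤ 2 := by
      refine le_of_mul_le_mul_right (a := (p : ℝ) ^ 4) ?_ (by positivity)
      nlinarith
    rw [inv_pow, ← div_eq_mul_inv, le_div_iff₀ (by positivity)]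
    exact h2
  obtain ⟨d, hd1, hd2, hd⟩ := exists_simultaneous_approx (Λ ×ˢ (Finset.univ : Finset Bool))
    (fun q => ((if q.2 then q.1.1 else q.1.2).val : ℝ) / p) (16 * m) (by omega)
  have hR : ∀ i j : ℤ, |i| ≤ m → |j| ≤ m → ∀ ξ ∈ Λ,
      0 ≤ (chi ξ (((d * i : ℤ) : ZMod p), ((d * j : ℤ) : ZMod p))).re := by
    intro i j hi hj ξ hξ
    have h1 := hd (ξ, true) (by simp [hξ])
    have h2 := hd (ξ, false) (by simp [hξ])
    have h3 := norm_chi_sub_one_le ξ d _ h1 h2 m i j (by exact_mod_cast hi) (by exact_mod_cast hj)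
    have hm0 : (1 : ℝ) ≤ m := by exact_mod_cast hm
    have h4 : 4 * Real.pi * m * (1 / ((16 * m : ℕ) : ℝ)) ≤ 1 := by
      push_cast
      rw [mul_one_div, div_le_one (by positivity)]
      nlinarith [Real.pi_lt_four]
    have h5 := Complex.abs_re_le_norm
      (chi ξ (((d * i : ℤ) : ZMod p), ((d * j : ℤ) : ZMod p)) - 1)
    rw [Complex.sub_re, Complex.one_re] at h5
    have := (abs_le.1 (h5.trans (h3.trans h4))).1
    linarith
  have hex : ∀ i j : ℤ, ∃ η : Plane p, |i| ≤ m → |j| ≤ m → ∃ a ∈ H, ∃ b ∈ H, ∃ c ∈ H, ∃ e ∈ H,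
      (((d * i : ℤ) : ZMod p), ((d * j : ℤ) : ZMod p)) = a + b - c - e ∧
        η = φ a + φ b - φ c - φ e := by
    intro i j
    by_cases hi : |i| ≤ m
    · by_cases hj : |j| ≤ m
      · obtain ⟨a, ha, b, hb, c, hc, e, he, h⟩ := hbog _ (hR i j hi hj)
        exact ⟨_, fun _ _ => ⟨a, ha, b, hb, c, hc, e, he, h, rfl⟩⟩
      · exact ⟨0, fun _ h => absurd h hj⟩
    · exact ⟨0, fun h => absurd h hi⟩
  choose ψ hψ using hex
  have hadd : ∀ i j i' j' : ℤ, |i| ≤ m → |j| ≤ m → |i'| ≤ m → |j'| ≤ m → |i + i'| ≤ m →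
      |j + j'| ≤ m → ψ (i + i') (j + j') = ψ i j + ψ i' j' := by
    intro i j i' j' hi hj hi' hj' hii hjj
    obtain ⟨a, ha, b, hb, c, hc, e, he, h1, h2⟩ := hψ i j hi hj
    obtain ⟨a', ha', b', hb', c', hc', e', he', h1', h2'⟩ := hψ i' j' hi' hj'
    obtain ⟨a'', ha'', b'', hb'', c'', hc'', e'', he'', h1'', h2''⟩ := hψ _ _ hii hjj
    have key := sum_eq_of_zeroFibre_eq_empty hφ ![a, b, a', b', c'', e''] ![c, e, c', e', a'', b'']
      (by simp [Fin.forall_fin_succ, *]) (by simp [Fin.forall_fin_succ, *]) (by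
        have h3 : ((((d * (i + i') : ℤ) : ZMod p), ((d * (j + j') : ℤ) : ZMod p)) : Plane p) =
            (((d * i : ℤ) : ZMod p), ((d * j : ℤ) : ZMod p)) +
            (((d * i' : ℤ) : ZMod p), ((d * j' : ℤ) : ZMod p)) := by
          rw [Prod.mk_add_mk]
          push_cast
          congr 1 <;> ring
        rw [h1, h1', h1''] at h3
        simp only [Fin.sum_univ_six]
        simp only [Matrix.cons_val]
        rw [← sub_eq_zero] at h3 ⊢
        rw [← neg_eq_zero, ← h3]
        abel)
    simp only [Fin.sum_univ_six] at key
    simp only [Matrix.cons_val] at key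
    rw [h2, h2', h2'']
    rw [← sub_eq_zero] at key ⊢
    rw [← neg_eq_zero, ← key]
    abel
  have hlin : ∀ i j : ℤ, |i| ≤ m → |j| ≤ m → ψ i j = i • ψ 1 0 + j • ψ 0 1 := by
    intro i j hi hj
    have hm' : (1 : ℤ) ≤ m := by exact_mod_cast hm
    have h0 : |(0 : ℤ)| ≤ m := by simp
    have h1 := eq_zsmul_of_locally_additive (fun i => ψ i 0) m hm'
      (fun i j hi hj hij => by simpa using hadd i 0 j 0 hi h0 hj h0 hij (by simp)) i hi
    have h2 := eq_zsmul_of_locally_additive (fun j => ψ 0 j) m hm'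
      (fun i j hi hj hij => by simpa using hadd 0 i 0 j h0 hi h0 hj (by simp) hij) j hj
    have h3 := hadd i 0 0 j hi h0 h0 hj (by simpa) (by simpa)
    rw [add_zero, zero_add] at h3
    rw [h3]
    exact congrArg₂ _ h1 h2
  refine ⟨d, hd1, ?_, ψ 1 0, ψ 0 1, ?_⟩
  · rw [Finset.card_product, Finset.card_univ, Fintype.card_bool] at hd2
    have hb : (1 : ℝ) ≤ ((16 * m : ℕ) : ℝ) := by exact_mod_cast (by omega : 1 ≤ 16 * m)
    calc (d : ℝ) ≤ ((16 * m : ℕ) : ℝ) ^ (Λ.card * 2) := by exact_mod_cast hd2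
      _ = ((16 * m : ℕ) : ℝ) ^ ((Λ.card * 2 : ℕ) : ℝ) := (Real.rpow_natCast _ _).symm
      _ ≤ _ := Real.rpow_le_rpow_of_exponent_le hb (by push_cast; linarith)
  · intro i j hi hj h hh hh'
    rw [← hlin i j hi hj]
    obtain ⟨a, ha, b, hb, c, hc, e, he, h1, h2⟩ := hψ i j hi hj
    obtain ⟨v, hv⟩ : ∃ v : Plane p, v = (((d * i : ℤ) : ZMod p), ((d * j : ℤ) : ZMod p)) := ⟨_, rfl⟩
    rw [← hv] at h1 hh' ⊢
    have key := sum_eq_of_zeroFibre_eq_empty hφ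
      ![h + v, c, e, h, h, h] ![h, a, b, h, h, h]
      (by simp [Fin.forall_fin_succ, hh', hc, he, hh])
      (by simp [Fin.forall_fin_succ, hh, ha, hb]) (by
        simp only [Fin.sum_univ_six]
        simp only [Matrix.cons_val]
        rw [h1]
        abel)
    simp only [Fin.sum_univ_six] at key
    simp only [Matrix.cons_val] at key
    rw [h2]
    rw [← sub_eq_zero] at key ⊢
    rw [← key]
    abel

end Linearisation

section QuadraticRecurrence

/-- The additive character `t ↦ exp (2πit)` of the real line. -/
noncomputable def expi (t : ℝ) : ℂ := Complex.exp (2 * Real.pi * Complex.I * t)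

lemma expi_add (s t : ℝ) : expi (s + t) = expi s * expi t := by
  rw [expi, expi, expi, ← Complex.exp_add]
  congr 1
  push_cast
  ring

@[simp] lemma expi_zero : expi 0 = 1 := by simp [expi]

@[simp] lemma norm_expi (t : ℝ) : ‖expi t‖ = 1 := by
  rw [expi, show 2 * Real.pi * Complex.I * t = ((2 * Real.pi * t : ℝ) : ℂ) * Complex.I by
    push_cast; ring]
  exact Complex.norm_exp_ofReal_mul_I _

lemma conj_expi (t : ℝ) : (starRingEnd ℂ) (expi t) = expi (-t) := by
  rw [expi, expi, ← Complex.exp_conj]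
  congr 1
  simp only [map_mul, Complex.conj_ofReal, Complex.conj_I, map_ofNat]
  push_cast
  ring

lemma expi_nat_mul (n : ℕ) (t : ℝ) : expi (n * t) = expi t ^ n := by
  rw [expi, expi, ← Complex.exp_nat_mul]
  congr 1
  push_cast
  ring

lemma expi_sub_int (t : ℝ) (z : ℤ) : expi (t - z) = expi t := by
  rw [expi, expi, Complex.exp_eq_exp_iff_exists_int]
  refine ⟨-z, ?_⟩
  push_cast
  ring

lemma four_mul_abs_le_norm_expi_sub_one (t : ℝ) (ht : |t| ≤ 1 / 2) :
    4 * |t| ≤ ‖expi t - 1‖ := by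
  rw [expi, show 2 * Real.pi * Complex.I * t = Complex.I * ((2 * Real.pi * t : ℝ) : ℂ) by
    push_cast; ring, Complex.norm_exp_I_mul_ofReal_sub_one, norm_mul, Real.norm_eq_abs,
    Real.norm_eq_abs, abs_two]
  have hpi := Real.pi_pos
  have h := Real.mul_abs_le_abs_sin (x := 2 * Real.pi * t / 2) (by
    rw [show 2 * Real.pi * t / 2 = Real.pi * t by ring, abs_mul, abs_of_pos hpi]
    nlinarith)
  rw [show 2 * Real.pi * t / 2 = Real.pi * t by ring, abs_mul, abs_of_pos hpi] at h
  rw [show 2 * Real.pi * t / 2 = Real.pi * t by ring]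
  have e : 2 / Real.pi * (Real.pi * |t|) = 2 * |t| := by field_simp
  linarith

lemma norm_geom_sum_expi_le (t ε : ℝ) (hε : 0 < ε) (h : ∀ z : ℤ, ε ≤ |t - z|) (n : ℕ) :
    ‖∑ j ∈ Finset.range n, expi t ^ j‖ ≤ 1 / (2 * ε) := by
  have h1 : 4 * ε ≤ ‖1 - expi t‖ := by
    rw [norm_sub_rev, ← expi_sub_int t (round t)]
    have := four_mul_abs_le_norm_expi_sub_one (t - round t) (abs_sub_round t)
    have := h (round t)
    linarith
  have h2 := mul_neg_geom_sum (expi t) n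
  have h3 : ‖1 - expi t ^ n‖ ≤ 2 := by
    refine (norm_sub_le _ _).trans ?_
    rw [norm_pow, norm_expi, norm_one]
    norm_num
  rw [← h2, norm_mul] at h3
  rw [le_div_iff₀ (by positivity)]
  nlinarith [norm_nonneg (∑ j ∈ Finset.range n, expi t ^ j)]

/-- Expanding the square of a sum according to the differences of the indices. -/
lemma norm_sq_sum_add (a : ℕ → ℂ) (Q : ℕ) :
    ‖∑ q ∈ Finset.range Q, a q‖ ^ 2 + ∑ q ∈ Finset.range Q, ‖a q‖ ^ 2 =
      2 * (∑ h ∈ Finset.range Q, ∑ k ∈ Finset.range (Q - h),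
        a (h + k) * (starRingEnd ℂ) (a k)).re := by
  rw [← Finset.sum_range_diag_flip Q (fun h k => a (h + k) * (starRingEnd ℂ) (a k))]
  have e : ∀ m, ∑ k ∈ Finset.range (m + 1), a (k + (m - k)) * (starRingEnd ℂ) (a (m - k)) =
      a m * (starRingEnd ℂ) (∑ k ∈ Finset.range (m + 1), a k) := by
    intro m
    rw [← Finset.sum_range_reflect, map_sum, Finset.mul_sum]
    refine Finset.sum_congr rfl fun k hk => ?_
    rw [Finset.mem_range] at hk
    rw [show m + 1 - 1 - k + (m - (m + 1 - 1 - k)) = m by omega,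
      show m - (m + 1 - 1 - k) = k by omega]
  simp_rw [e]
  induction Q with
  | zero => simp
  | succ Q ih =>
    rw [Finset.sum_range_succ, Finset.sum_range_succ _ Q, Finset.sum_range_succ _ Q,
      Complex.add_re, mul_add, ← ih, Finset.sum_range_succ _ Q, map_add]
    simp only [Complex.sq_norm, Complex.normSq_apply, Complex.add_re, Complex.add_im,
      Complex.mul_re, Complex.conj_re, Complex.conj_im]
    ring

/-- If a sequence stays away from the integers, then some exponential sum along it is large. -/
lemma exists_large_exponential_sum (θ : ℕ → ℝ) (Q K : ℕ) (hQ : 1 ≤ Q) (hK : 1 ≤ K)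
    (h : ∀ q < Q, ∀ z : ℤ, 1 / (K : ℝ) ≤ |θ q - z|) :
    ∃ k : ℕ, 1 ≤ k ∧ k < K ^ 2 ∧
      (Q : ℝ) / (4 * K ^ 2) ≤ ‖∑ q ∈ Finset.range Q, expi (k * θ q)‖ := by
  by_contra! hcon
  have hK0 : (1 : ℝ) ≤ K := by exact_mod_cast hK
  have hQ0 : (1 : ℝ) ≤ Q := by exact_mod_cast hQ
  have h1 : ∀ q ∈ Finset.range Q, ‖∑ j ∈ Finset.range (K ^ 2), expi (θ q) ^ j‖ ^ 2 ≤ K ^ 2 / 4 := by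
    intro q hq
    have := norm_geom_sum_expi_le (θ q) (1 / K) (by positivity) (h q (Finset.mem_range.1 hq)) (K ^ 2)
    rw [show 1 / (2 * (1 / (K : ℝ))) = K / 2 by field_simp] at this
    calc _ ≤ ((K : ℝ) / 2) ^ 2 := by gcongr
      _ = _ := by ring
  have h2 : ∀ q, ‖∑ j ∈ Finset.range (K ^ 2), expi (θ q) ^ j‖ ^ 2 + (K : ℝ) ^ 2 =
      2 * (∑ h ∈ Finset.range (K ^ 2), ((K ^ 2 - h : ℕ) : ℂ) * expi (h * θ q)).re := by
    intro q
    have e := norm_sq_sum_add (fun j => expi (θ q) ^ j) (K ^ 2)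
    simp only [norm_pow, norm_expi, one_pow, Finset.sum_const, Finset.card_range, nsmul_eq_mul,
      mul_one] at e
    push_cast at e
    rw [e]
    congr 2
    refine Finset.sum_congr rfl fun h _ => ?_
    have e2 : ∀ k, expi (θ q) ^ (h + k) * (starRingEnd ℂ) (expi (θ q) ^ k) = expi (h * θ q) := by
      intro k
      rw [map_pow, conj_expi, pow_add, mul_assoc, ← mul_pow, ← expi_add, add_neg_cancel, expi_zero,
        one_pow, mul_one, expi_nat_mul]
    simp only [map_pow] at e2 ⊢
    simp only [e2, Finset.sum_const, Finset.card_range, nsmul_eq_mul]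
  have h3 : ∑ q ∈ Finset.range Q, ‖∑ j ∈ Finset.range (K ^ 2), expi (θ q) ^ j‖ ^ 2 ≤
      Q * ((K : ℝ) ^ 2 / 4) := by
    have := Finset.sum_le_sum h1
    simpa using this
  have h4 : ∑ q ∈ Finset.range Q, ‖∑ j ∈ Finset.range (K ^ 2), expi (θ q) ^ j‖ ^ 2 +
      Q * (K : ℝ) ^ 2 = 2 * (∑ h ∈ Finset.range (K ^ 2), ((K ^ 2 - h : ℕ) : ℂ) *
        ∑ q ∈ Finset.range Q, expi (h * θ q)).re := by
    have := Finset.sum_congr (rfl : Finset.range Q = Finset.range Q) fun q _ => h2 q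
    rw [Finset.sum_add_distrib, Finset.sum_const, Finset.card_range, nsmul_eq_mul,
      ← Finset.mul_sum, ← Complex.re_sum, Finset.sum_comm] at this
    simp_rw [Finset.mul_sum]
    exact this
  obtain ⟨J, hJ⟩ : ∃ J, K ^ 2 = J + 1 := ⟨K ^ 2 - 1, by
    have := Nat.one_le_pow 2 K hK
    omega⟩
  have hJ' : (K : ℝ) ^ 2 = J + 1 := by exact_mod_cast hJ
  rw [hJ, Finset.sum_range_succ' _ J, Complex.add_re] at h4
  have h5 : (((J + 1 - 0 : ℕ) : ℂ) * ∑ q ∈ Finset.range Q, expi ((0 : ℕ) * θ q)).re =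
      Q * (K : ℝ) ^ 2 := by
    simp [hJ']
    ring
  rw [h5] at h4
  have h6 : ‖∑ h ∈ Finset.range J, ((J + 1 - (h + 1) : ℕ) : ℂ) *
      ∑ q ∈ Finset.range Q, expi ((h + 1 : ℕ) * θ q)‖ ≤ Q * (K : ℝ) ^ 2 / 4 := by
    calc _ ≤ ∑ h ∈ Finset.range J, (K : ℝ) ^ 2 * (Q / (4 * K ^ 2)) := by
          refine (norm_sum_le _ _).trans (Finset.sum_le_sum fun h hh => ?_)
          rw [Finset.mem_range] at hh
          rw [norm_mul, Complex.norm_natCast]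
          have h7 := (hcon (h + 1) (by omega) (by omega)).le
          gcongr
          rw [hJ']
          exact_mod_cast (by omega : J + 1 - (h + 1) ≤ J + 1)
      _ = (J : ℝ) * (Q / 4) := by
          rw [Finset.sum_const, Finset.card_range, nsmul_eq_mul]
          field_simp
      _ ≤ _ := by rw [hJ']; nlinarith
  have h7 := (abs_le.1 ((Complex.abs_re_le_norm _).trans h6)).1
  have : 0 < (Q : ℝ) * K ^ 2 := by positivity
  rw [hJ] at h3
  linarith

/-- Weyl differencing: a large quadratic exponential sum forces a rational phase. -/
lemma exists_approx_of_large_quadratic_sum (β : ℝ) (Q K : ℕ) (hK : 1 ≤ K) (hQ : 128 * K ^ 4 < Q)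
    (h : (Q : ℝ) / (4 * K ^ 2) ≤ ‖∑ q ∈ Finset.range Q, expi (β * ((q : ℝ) + 1) ^ 2)‖) :
    ∃ l : ℕ, 1 ≤ l ∧ l ≤ 128 * K ^ 4 ∧ ∃ z : ℤ, |2 * l * β - z| ≤ 64 * K ^ 4 / Q := by
  classical
  have hK0 : (1 : ℝ) ≤ K := by exact_mod_cast hK
  have hQ1 : 128 * (K : ℝ) ^ 4 < Q := by exact_mod_cast hQ
  have hQ0 : (0 : ℝ) < Q := hQ1.trans' (by positivity)
  set ε : ℝ := 32 * K ^ 4 / Q with hε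
  have hε0 : 0 < ε := by positivity
  set G := (Finset.range Q).filter fun h : ℕ => ∃ z : ℤ, |2 * h * β - z| < ε with hG
  have h1 := norm_sq_sum_add (fun q : ℕ => expi (β * ((q : ℝ) + 1) ^ 2)) Q
  have h2 : ∀ h ∈ Finset.range Q, ‖∑ k ∈ Finset.range (Q - h),
      expi (β * (((h + k : ℕ) : ℝ) + 1) ^ 2) * (starRingEnd ℂ) (expi (β * ((k : ℝ) + 1) ^ 2))‖ ≤
      (if h ∈ G then (Q : ℝ) else 0) + 1 / (2 * ε) := by
    intro h hh
    have e : ∀ k : ℕ, expi (β * (((h + k : ℕ) : ℝ) + 1) ^ 2) *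
        (starRingEnd ℂ) (expi (β * ((k : ℝ) + 1) ^ 2)) =
        expi (β * (h ^ 2 + 2 * h)) * expi (2 * h * β) ^ k := by
      intro k
      rw [conj_expi, ← expi_add, ← expi_nat_mul, ← expi_add]
      congr 1
      push_cast
      ring
    simp_rw [e]
    rw [← Finset.mul_sum, norm_mul, norm_expi, one_mul]
    split_ifs with hm
    · have : ‖∑ k ∈ Finset.range (Q - h), expi (2 * h * β) ^ k‖ ≤ Q := by
        refine (norm_sum_le _ _).trans ?_
        simp only [norm_pow, norm_expi, one_pow, Finset.sum_const, Finset.card_range, nsmul_eq_mul,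
          mul_one]
        exact_mod_cast Nat.sub_le _ _
      have : 0 ≤ 1 / (2 * ε) := by positivity
      linarith
    · rw [zero_add]
      refine norm_geom_sum_expi_le _ _ hε0 (fun z => ?_) _
      by_contra hz
      exact hm (Finset.mem_filter.2 ⟨hh, z, not_le.1 hz⟩)
  have h3 : ‖∑ q ∈ Finset.range Q, expi (β * ((q : ℝ) + 1) ^ 2)‖ ^ 2 ≤
      2 * (G.card * Q + Q * (1 / (2 * ε))) := by
    have h4 : 0 ≤ ∑ q ∈ Finset.range Q, ‖expi (β * ((q : ℝ) + 1) ^ 2)‖ ^ 2 := by positivity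
    have h5 := (Complex.re_le_norm _).trans ((norm_sum_le (Finset.range Q) (fun h =>
      ∑ k ∈ Finset.range (Q - h), expi (β * (((h + k : ℕ) : ℝ) + 1) ^ 2) *
        (starRingEnd ℂ) (expi (β * ((k : ℝ) + 1) ^ 2)))).trans (Finset.sum_le_sum h2))
    rw [Finset.sum_add_distrib, ← Finset.sum_filter, Finset.filter_mem_eq_inter,
      Finset.inter_eq_right.2 (Finset.filter_subset _ _)] at h5
    simp only [Finset.sum_const, Finset.card_range, nsmul_eq_mul] at h5
    linarith
  have h4 : (Q : ℝ) / (64 * K ^ 4) ≤ G.card := by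
    have h5 : ((Q : ℝ) / (4 * K ^ 2)) ^ 2 ≤ 2 * (G.card * Q + Q * (1 / (2 * ε))) :=
      h3.trans' (by gcongr)
    have e1 : ((Q : ℝ) / (4 * K ^ 2)) ^ 2 = 4 * (Q * (Q / (64 * K ^ 4))) := by field_simp; ring
    have e2 : Q * (1 / (2 * ε)) = Q * (Q / (64 * K ^ 4)) := by rw [hε]; field_simp; ring
    rw [e1, e2] at h5
    refine le_of_mul_le_mul_left ?_ hQ0
    linarith
  obtain ⟨a, ha, b, hb, hab, he⟩ := Finset.exists_ne_map_eq_of_card_lt_of_maps_to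
    (s := G) (t := Finset.range (Q / (128 * K ^ 4) + 1)) (f := fun h => h / (128 * K ^ 4)) (by
      rw [Finset.card_range]
      have h5 : ((Q / (128 * K ^ 4) : ℕ) : ℝ) ≤ Q / (128 * K ^ 4) := by
        refine Nat.cast_div_le.trans ?_
        push_cast
        exact le_rfl
      have h6 : 1 < (Q : ℝ) / (128 * K ^ 4) := by rwa [one_lt_div (by positivity)]
      have h7 : (Q : ℝ) / (64 * K ^ 4) = Q / (128 * K ^ 4) + Q / (128 * K ^ 4) := by
        field_simp; ring
      have : ((Q / (128 * K ^ 4) + 1 : ℕ) : ℝ) < G.card := by push_cast at h5 ⊢; linarith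
      exact_mod_cast this) (by
      intro h hh
      have := Finset.mem_range.1 (Finset.mem_filter.1 hh).1
      rw [Finset.mem_coe, Finset.mem_range, Nat.lt_succ_iff]
      exact Nat.div_le_div_right this.le)
  wlog hlt : a < b generalizing a b
  · exact this b hb a ha hab.symm he.symm (by omega)
  obtain ⟨z, hz⟩ := (Finset.mem_filter.1 ha).2
  obtain ⟨w, hw⟩ := (Finset.mem_filter.1 hb).2
  refine ⟨b - a, by omega, ?_, w - z, ?_⟩
  · have h1 := Nat.div_add_mod a (128 * K ^ 4)
    have h2 := Nat.div_add_mod b (128 * K ^ 4)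
    have h3 := Nat.mod_lt b (show 0 < 128 * K ^ 4 by positivity)
    rw [← he] at h2
    omega
  · rw [Nat.cast_sub hlt.le, show 64 * (K : ℝ) ^ 4 / Q = ε + ε by rw [hε]; ring]
    push_cast
    rw [abs_lt] at hz hw
    rw [abs_le]
    constructor <;> linarith

/-- Quantitative recurrence of squares. -/
theorem exists_sq_approx (α : ℝ) (K : ℕ) (hK : 1 ≤ K) :
    ∃ q : ℕ, 1 ≤ q ∧ q ≤ 2 ^ 14 * K ^ 11 ∧ ∃ z : ℤ, |(q : ℝ) ^ 2 * α - z| ≤ 1 / K := by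
  by_contra! hcon
  have hK0 : (1 : ℝ) ≤ K := by exact_mod_cast hK
  set Q := 2 ^ 14 * K ^ 11 with hQ
  have hQ' : (Q : ℝ) = 2 ^ 14 * K ^ 11 := by rw [hQ]; push_cast; norm_num
  obtain ⟨k, hk1, hk2, hk⟩ := exists_large_exponential_sum
    (fun q => ((q : ℝ) + 1) ^ 2 * α) Q K (Nat.succ_le_of_lt (by positivity)) hK (by
      intro q hq z
      have := hcon (q + 1) (by omega) (by omega) z
      push_cast at this
      exact this.le)
  have hpow : K ^ 4 ≤ K ^ 11 := Nat.pow_le_pow_right hK (by norm_num)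
  have hpos : 0 < K ^ 4 := by positivity
  obtain ⟨l, hl1, hl2, z, hz⟩ := exists_approx_of_large_quadratic_sum (k * α) Q K hK (by omega) (by
    refine hk.trans (le_of_eq ?_)
    congr 1
    refine Finset.sum_congr rfl fun q _ => ?_
    congr 1
    ring)
  have hqle : 2 * k * l ≤ 256 * K ^ 6 := by
    calc 2 * k * l ≤ 2 * K ^ 2 * (128 * K ^ 4) := by gcongr
      _ = _ := by ring
  have hpow6 : K ^ 6 ≤ K ^ 11 := Nat.pow_le_pow_right hK (by norm_num)
  have h1 := hcon (2 * k * l) (Nat.succ_le_of_lt (by positivity)) (by omega) (2 * k * l * z)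
  have h2 : |((2 * k * l : ℕ) : ℝ) ^ 2 * α - ((2 * k * l * z : ℤ) : ℝ)| =
      (2 * k * l : ℕ) * |2 * l * (k * α) - z| := by
    rw [show ((2 * k * l : ℕ) : ℝ) ^ 2 * α - ((2 * k * l * z : ℤ) : ℝ) =
      (2 * k * l : ℕ) * (2 * l * (k * α) - z) by push_cast; ring, abs_mul, Nat.abs_cast]
  have hqle' : ((2 * k * l : ℕ) : ℝ) ≤ 256 * K ^ 6 := by exact_mod_cast hqle
  rw [h2] at h1
  have h3 : (2 * k * l : ℕ) * |2 * l * (k * α) - z| ≤ 256 * (K : ℝ) ^ 6 * (64 * K ^ 4 / Q) := by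
    gcongr
  have h4 : 256 * (K : ℝ) ^ 6 * (64 * K ^ 4 / Q) = 1 / K := by
    rw [hQ']; field_simp; ring
  linarith

/-- Simultaneous quantitative recurrence of squares. -/
theorem exists_simultaneous_sq_approx (n : ℕ) :
    ∃ C : ℕ, ∀ K : ℕ, 2 ≤ K → ∀ l : List ℝ, l.length = n →
      ∃ q : ℕ, 1 ≤ q ∧ q ≤ K ^ C ∧ ∀ α ∈ l, ∃ z : ℤ, |(q : ℝ) ^ 2 * α - z| ≤ 1 / K := by
  induction n with
  | zero =>
    refine ⟨0, fun K _ l hl => ⟨1, le_rfl, by simp, ?_⟩⟩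
    rw [List.length_eq_zero_iff.1 hl]
    simp
  | succ n ih =>
    obtain ⟨C, hC⟩ := ih
    refine ⟨14 + 11 * (1 + 2 * C) + C, fun K hK l hl => ?_⟩
    obtain ⟨α, l, rfl⟩ := List.exists_cons_of_length_eq_add_one hl
    have hK0 : (2 : ℝ) ≤ K := by exact_mod_cast hK
    obtain ⟨q, hq1, hq2, z, hz⟩ := exists_sq_approx α (K ^ (1 + 2 * C)) (Nat.one_le_pow _ _ (by omega))
    obtain ⟨r, hr1, hr2, hr⟩ := hC K hK (l.map fun β => (q : ℝ) ^ 2 * β) (by simpa using hl)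
    refine ⟨q * r, Nat.succ_le_of_lt (by positivity), ?_, ?_⟩
    · rw [pow_add, pow_add]
      gcongr
      refine hq2.trans ?_
      rw [mul_comm 11, pow_mul]
      gcongr
    · intro β hβ
      rcases List.mem_cons.1 hβ with rfl | hβ
      · refine ⟨r ^ 2 * z, ?_⟩
        have e : ((q * r : ℕ) : ℝ) ^ 2 * β - ((r ^ 2 * z : ℤ) : ℝ) =
            (r : ℝ) ^ 2 * ((q : ℝ) ^ 2 * β - z) := by push_cast; ring
        rw [e, abs_mul, abs_of_nonneg (by positivity)]
        have hr' : (r : ℝ) ≤ K ^ C := by exact_mod_cast hr2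
        calc (r : ℝ) ^ 2 * |(q : ℝ) ^ 2 * β - z|
            ≤ ((K : ℝ) ^ C) ^ 2 * (1 / ((K ^ (1 + 2 * C) : ℕ) : ℝ)) := by gcongr
          _ = (1 : ℝ) / K := by
            push_cast
            rw [pow_add, pow_one, mul_comm 2, pow_mul]
            field_simp
      · obtain ⟨w, hw⟩ := hr _ (List.mem_map_of_mem hβ)
        refine ⟨w, ?_⟩
        push_cast
        rwa [mul_pow, mul_comm ((q : ℝ) ^ 2), mul_assoc]

end QuadraticRecurrence

section LocalCorrelation

open scoped Pointwise

variable {p : ℕ} [NeZero p]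

/-- The multilinear estimate on a set of small doubling. -/
lemma sum_norm_correlation_le (F : Plane p → ℂ) (g : Plane p → ℝ) (hg : ∀ x, |g x| ≤ 1)
    (P T : Finset (Plane p)) (hT : T ⊆ P) (hPP : (P + P).card ≤ 4 * P.card) (W : ℝ)
    (hW : ∀ ξ, ‖∑ k ∈ P, F k * chi ξ k‖ ≤ W) :
    ∑ l ∈ T, ‖∑ k ∈ P, F k * g (k + l)‖ ≤ 2 * P.card * W := by
  classical
  have hW0 : 0 ≤ W := (norm_nonneg _).trans (hW 0)
  have hu : ∀ z : ℂ, ∃ u : ℂ, ‖u‖ ≤ 1 ∧ ((‖z‖ : ℝ) : ℂ) = u * z := by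
    intro z
    by_cases hz : z = 0
    · exact ⟨0, by simp, by simp [hz]⟩
    · have hz' : (‖z‖ : ℂ) ≠ 0 := by simpa using hz
      refine ⟨(starRingEnd ℂ) z / ‖z‖, ?_, ?_⟩
      · rw [norm_div, RCLike.norm_conj, Complex.norm_real, norm_norm, div_self (norm_ne_zero_iff.2 hz)]
      · rw [div_mul_eq_mul_div, mul_comm, Complex.mul_conj', sq, mul_div_assoc, div_self hz', mul_one]
  choose u hu1 hu2 using hu
  let F' : Plane p → ℂ := fun y => if y ∈ P then F y else 0
  have hF' : ∀ ξ, ‖∑ x, F' x * chi ξ x‖ ≤ W := by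
    intro ξ
    have : ∑ x, F' x * chi ξ x = ∑ k ∈ P, F k * chi ξ k := by
      simp only [F', ite_mul, zero_mul]
      rw [← Finset.sum_filter]
      congr 1
      ext; simp
    rw [this]
    exact hW ξ
  have key := trilinear_le (P + P) T (fun s => ((g s : ℝ) : ℂ))
    (fun l => u (∑ k ∈ P, F k * g (k + l))) id (fun l => -l) Function.injective_id.injOn
    neg_injective.injOn F' W hF'
  have e : ∑ s ∈ P + P, ∑ l ∈ T, ((g s : ℝ) : ℂ) * u (∑ k ∈ P, F k * g (k + l)) * F' (id s + -l) =
      ((∑ l ∈ T, ‖∑ k ∈ P, F k * g (k + l)‖ : ℝ) : ℂ) := by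
    rw [Finset.sum_comm]
    push_cast
    refine Finset.sum_congr rfl fun l hl => ?_
    rw [hu2, Finset.mul_sum]
    symm
    refine Finset.sum_of_injOn (fun k => k + l) (add_left_injective l).injOn ?_ ?_ ?_
    · intro k hk
      exact Finset.add_mem_add hk (hT hl)
    · intro s _ hs
      have : s + -l ∉ P := fun h => hs ⟨s + -l, h, by simp⟩
      simp [F', this]
    · intro k hk
      simp only [F', id, add_neg_cancel_right, if_pos hk]
      ring
  rw [e, Complex.norm_real, Real.norm_of_nonneg (by positivity)] at key
  refine key.trans ?_
  have h1 : ∑ s ∈ P + P, ‖((g s : ℝ) : ℂ)‖ ^ 2 ≤ 4 * P.card := by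
    calc _ ≤ ∑ s ∈ P + P, (1 : ℝ) := Finset.sum_le_sum fun s _ => by
          rw [Complex.norm_real, Real.norm_eq_abs]
          exact pow_le_one₀ (abs_nonneg _) (hg s)
      _ ≤ _ := by simpa using (by exact_mod_cast hPP : (((P + P).card : ℕ) : ℝ) ≤ 4 * P.card)
  have h2 : ∑ l ∈ T, ‖u (∑ k ∈ P, F k * g (k + l))‖ ^ 2 ≤ P.card := by
    calc _ ≤ ∑ l ∈ T, (1 : ℝ) := Finset.sum_le_sum fun s _ =>
          pow_le_one₀ (norm_nonneg _) (hu1 _)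
      _ ≤ _ := by simpa using Finset.card_le_card hT
  have h3 : √(4 * (P.card : ℝ)) * √P.card = 2 * P.card := by
    rw [Real.sqrt_mul (by norm_num), mul_assoc, Real.mul_self_sqrt (by positivity),
      show (4 : ℝ) = 2 ^ 2 by norm_num, Real.sqrt_sq (by norm_num)]
  calc _ ≤ W * (√(4 * (P.card : ℝ)) * √P.card) := by gcongr
    _ = _ := by rw [h3]; ring

/-- If the derivatives of `f` correlate with characters varying slowly along `P`, then `f`
correlates with characters on translates of `P`. -/
theorem exists_local_correlation (f : Plane p → ℝ) (hf : ∀ x, |f x| ≤ 1) (H : Finset (Plane p))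
    (φ : Plane p → Plane p) (τ : ℝ)
    (hτ : ∀ h ∈ H, τ * p ^ 2 ≤ ‖∑ x, ((f x * f (x + h) : ℝ) : ℂ) * chi (φ h) x‖)
    (P : Finset (Plane p)) (hP : P.Nonempty) (hPP : (P + P).card ≤ 4 * P.card)
    (hη : ∀ h ∈ H, ∀ h' ∈ H, h' - h ∈ P - P → ∀ k ∈ P, ‖chi (φ h' - φ h) k - 1‖ ≤ τ / 2) :
    ∃ ξ : Plane p → Plane p, τ / 4 * H.card * P.card ≤
      ∑ x, ‖∑ k ∈ P, ((f (x + k) : ℝ) : ℂ) * chi (ξ x) k‖ := by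
  classical
  have hmax : ∀ x : Plane p, ∃ ξ : Plane p, ∀ ξ', ‖∑ k ∈ P, ((f (x + k) : ℝ) : ℂ) * chi ξ' k‖ ≤
      ‖∑ k ∈ P, ((f (x + k) : ℝ) : ℂ) * chi ξ k‖ := fun x =>
    Finite.exists_max fun ξ => ‖∑ k ∈ P, ((f (x + k) : ℝ) : ℂ) * chi ξ k‖
  choose ξ hξ using hmax
  refine ⟨ξ, ?_⟩
  set W : Plane p → ℝ := fun x => ‖∑ k ∈ P, ((f (x + k) : ℝ) : ℂ) * chi (ξ x) k‖ with hW
  have hp : (0 : ℝ) < (p : ℝ) ^ 2 := by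
    have : 0 < p := Nat.pos_of_ne_zero (NeZero.ne p)
    positivity
  have hPpos : (0 : ℝ) < P.card := by exact_mod_cast hP.card_pos
  let T : Plane p → Finset (Plane p) := fun h₀ => P.filter fun l => h₀ + l ∈ H
  have hTcard : ∑ h₀, ((T h₀).card : ℝ) = P.card * H.card := by
    have e : ∀ h₀, ((T h₀).card : ℝ) = ∑ l ∈ P, if h₀ + l ∈ H then (1 : ℝ) else 0 := by
      intro h₀
      rw [Finset.card_filter]
      push_cast
      rfl
    simp_rw [e]
    rw [Finset.sum_comm]
    have e2 : ∀ l, ∑ h₀ : Plane p, (if h₀ + l ∈ H then (1 : ℝ) else 0) = H.card := by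
      intro l
      have := Fintype.sum_equiv (Equiv.addRight l) (fun h₀ => if h₀ + l ∈ H then (1 : ℝ) else 0)
        (fun y => if y ∈ H then (1 : ℝ) else 0) fun _ => rfl
      rw [this]
      simp
    simp_rw [e2]
    simp
  have hshift : ∀ G : Plane p → ℂ, (P.card : ℝ) * ‖∑ x, G x‖ ≤ ∑ x₀, ‖∑ k ∈ P, G (x₀ + k)‖ := by
    intro G
    have e : ∑ x₀, ∑ k ∈ P, G (x₀ + k) = P.card * ∑ x, G x := by
      rw [Finset.sum_comm]
      have e2 : ∀ k, ∑ x₀, G (x₀ + k) = ∑ x, G x := fun k =>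
        Fintype.sum_equiv (Equiv.addRight k) _ _ fun _ => rfl
      simp_rw [e2]
      simp
    calc (P.card : ℝ) * ‖∑ x, G x‖ = ‖∑ x₀, ∑ k ∈ P, G (x₀ + k)‖ := by rw [e, norm_mul]; simp
      _ ≤ _ := norm_sum_le _ _
  have hmain : ∀ h₀ x₀ : Plane p, ∑ l ∈ T h₀, ‖∑ k ∈ P,
      ((f (x₀ + k) * f (x₀ + k + (h₀ + l)) : ℝ) : ℂ) * chi (φ (h₀ + l)) (x₀ + k)‖ ≤
      2 * P.card * W x₀ + (T h₀).card * (P.card * (τ / 2)) := by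
    intro h₀ x₀
    rcases (T h₀).eq_empty_or_nonempty with hT | ⟨l₁, hl₁⟩
    · rw [hT]
      simp only [Finset.sum_empty, Finset.card_empty, Nat.cast_zero, zero_mul, add_zero]
      positivity
    have hl₁' := Finset.mem_filter.1 hl₁
    set θ := φ (h₀ + l₁) with hθ
    have h1 : ∀ l ∈ T h₀, ‖∑ k ∈ P,
        ((f (x₀ + k) * f (x₀ + k + (h₀ + l)) : ℝ) : ℂ) * chi (φ (h₀ + l)) (x₀ + k)‖ ≤
        ‖∑ k ∈ P, ((f (x₀ + k) : ℝ) : ℂ) * chi θ k * ((f (x₀ + h₀ + (k + l)) : ℝ) : ℂ)‖ +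
          P.card * (τ / 2) := by
      intro l hl
      have hl' := Finset.mem_filter.1 hl
      have e : ∑ k ∈ P, ((f (x₀ + k) * f (x₀ + k + (h₀ + l)) : ℝ) : ℂ) *
          chi (φ (h₀ + l)) (x₀ + k) = chi (φ (h₀ + l)) x₀ *
          (∑ k ∈ P, ((f (x₀ + k) : ℝ) : ℂ) * chi θ k * ((f (x₀ + h₀ + (k + l)) : ℝ) : ℂ) +
           ∑ k ∈ P, ((f (x₀ + k) : ℝ) : ℂ) * chi θ k * ((f (x₀ + h₀ + (k + l)) : ℝ) : ℂ) *
            (chi (φ (h₀ + l) - θ) k - 1)) := by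
        rw [← Finset.sum_add_distrib, Finset.mul_sum]
        refine Finset.sum_congr rfl fun k _ => ?_
        have e2 : chi (φ (h₀ + l)) k = chi θ k * chi (φ (h₀ + l) - θ) k := by
          rw [← chi_add_left, add_sub_cancel]
        rw [chi_add_right, e2, show x₀ + k + (h₀ + l) = x₀ + h₀ + (k + l) by abel]
        push_cast
        ring
      rw [e, norm_mul, norm_chi, one_mul]
      refine (norm_add_le _ _).trans (add_le_add le_rfl ?_)
      rw [← nsmul_eq_mul]
      refine (norm_sum_le _ _).trans (Finset.sum_le_card_nsmul _ _ _ fun k hk => ?_)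
      rw [norm_mul, norm_mul, norm_mul, norm_chi, Complex.norm_real, Complex.norm_real,
        Real.norm_eq_abs, Real.norm_eq_abs, mul_one]
      have h3 := hη _ hl₁'.2 _ hl'.2 (by
        rw [show h₀ + l - (h₀ + l₁) = l - l₁ by abel]
        exact Finset.sub_mem_sub hl'.1 hl₁'.1) k hk
      calc |f (x₀ + k)| * |f (x₀ + h₀ + (k + l))| * ‖chi (φ (h₀ + l) - θ) k - 1‖
          ≤ 1 * 1 * (τ / 2) := by
            gcongr
            · exact hf _
            · exact hf _
        _ = τ / 2 := by ring
    refine (Finset.sum_le_sum h1).trans ?_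
    rw [Finset.sum_add_distrib, Finset.sum_const, nsmul_eq_mul]
    refine add_le_add ?_ le_rfl
    refine sum_norm_correlation_le (fun k => ((f (x₀ + k) : ℝ) : ℂ) * chi θ k)
      (fun s => f (x₀ + h₀ + s)) (fun _ => hf _) P (T h₀) (Finset.filter_subset _ _) hPP (W x₀) ?_
    intro ξ'
    refine le_trans (le_of_eq ?_) (hξ x₀ (θ + ξ'))
    congr 1
    refine Finset.sum_congr rfl fun k _ => ?_
    rw [chi_add_left]
    ring
  have h1 : ∀ h₀, (T h₀).card * (P.card * (τ * p ^ 2)) ≤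
      ∑ x₀, (2 * P.card * W x₀ + (T h₀).card * (P.card * (τ / 2))) := by
    intro h₀
    calc (T h₀).card * (P.card * (τ * p ^ 2)) = ∑ l ∈ T h₀, P.card * (τ * p ^ 2) := by simp
      _ ≤ ∑ l ∈ T h₀, ∑ x₀, ‖∑ k ∈ P, ((f (x₀ + k) * f (x₀ + k + (h₀ + l)) : ℝ) : ℂ) *
          chi (φ (h₀ + l)) (x₀ + k)‖ := by
          refine Finset.sum_le_sum fun l hl => ?_
          refine (mul_le_mul_of_nonneg_left (hτ _ (Finset.mem_filter.1 hl).2) hPpos.le).trans ?_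
          exact hshift fun x => ((f x * f (x + (h₀ + l)) : ℝ) : ℂ) * chi (φ (h₀ + l)) x
      _ ≤ _ := by
          rw [Finset.sum_comm]
          exact Finset.sum_le_sum fun x₀ _ => hmain h₀ x₀
  have h2 := Finset.sum_le_sum fun h₀ (_ : h₀ ∈ Finset.univ) => h1 h₀
  have hc : ((Finset.univ : Finset (Plane p)).card : ℝ) = (p : ℝ) ^ 2 := by
    rw [Finset.card_univ, card_plane]; push_cast; rfl
  simp only [Finset.sum_add_distrib, Finset.sum_const, nsmul_eq_mul, ← Finset.sum_mul,
    ← Finset.mul_sum, hTcard, hc] at h2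
  refine le_of_mul_le_mul_left (a := 4 * (p : ℝ) ^ 2 * P.card) ?_ (by positivity)
  nlinarith

end LocalCorrelation

section Restriction

open scoped Pointwise

variable {p : ℕ} [Fact p.Prime]

/-- Passing from correlations of derivatives to a dense set on which the frequency map is a
Freiman homomorphism. -/
theorem exists_freiman_restriction (f : Plane p → ℝ) (hf : ∀ x, |f x| ≤ 1)
    (φ : Plane p → Plane p) (τ : ℝ) (hτ0 : 0 < τ) (hτ1 : τ ≤ 1 / 2)
    (hφ : 2 * τ * p ^ 4 ≤ ∑ h, ‖∑ x, ((f x * f (x + h) : ℝ) : ℂ) * chi (φ h) x‖)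
    (hp : τ⁻¹ ^ 1877 ≤ p) :
    ∃ H : Finset (Plane p), (∀ h ∈ H, τ * p ^ 2 ≤
      ‖∑ x, ((f x * f (x + h) : ℝ) : ℂ) * chi (φ h) x‖) ∧ τ ^ 1894 * p ^ 2 ≤ H.card ∧
      H.Nonempty ∧ zeroFibre H φ = ∅ := by
  classical
  have hp0 : (0 : ℝ) < p := by exact_mod_cast (Fact.out : p.Prime).pos
  set I : Plane p → ℝ := fun h => ‖∑ x, ((f x * f (x + h) : ℝ) : ℂ) * chi (φ h) x‖ with hI
  set B := Finset.univ.filter fun h => τ * p ^ 2 ≤ I h with hB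
  have hcardu : ((Finset.univ : Finset (Plane p)).card : ℝ) = (p : ℝ) ^ 2 := by
    rw [Finset.card_univ, card_plane]; push_cast; rfl
  have hBφ : ∀ h ∈ B, τ * p ^ 2 ≤ I h := fun h hh => (Finset.mem_filter.1 hh).2
  have hBcard : τ * p ^ 2 ≤ B.card := by
    have h1 : ∀ h, I h ≤ (if h ∈ B then (p : ℝ) ^ 2 else 0) + τ * p ^ 2 := by
      intro h
      split_ifs with hm
      · have : I h ≤ p ^ 2 := by
          rw [← hcardu]
          refine (norm_sum_le _ _).trans ?_
          rw [← nsmul_one]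
          refine Finset.sum_le_card_nsmul _ _ _ fun x _ => ?_
          rw [norm_mul, norm_chi, mul_one, Complex.norm_real, Real.norm_eq_abs, abs_mul]
          exact mul_le_one₀ (hf _) (abs_nonneg _) (hf _)
        have : 0 ≤ τ * (p : ℝ) ^ 2 := by positivity
        linarith
      · rw [zero_add]
        by_contra hlt
        exact hm (Finset.mem_filter.2 ⟨Finset.mem_univ _, (not_le.1 hlt).le⟩)
    have h2 := hφ.trans (Finset.sum_le_sum fun h (_ : h ∈ Finset.univ) => h1 h)
    rw [Finset.sum_add_distrib, ← Finset.sum_filter, Finset.filter_mem_eq_inter,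
      Finset.univ_inter, Finset.sum_const, Finset.sum_const, nsmul_eq_mul, nsmul_eq_mul,
      hcardu] at h2
    refine le_of_mul_le_mul_right (a := (p : ℝ) ^ 2) ?_ (by positivity)
    nlinarith
  have hBpos : (0 : ℝ) < B.card := lt_of_lt_of_le (by positivity) hBcard
  have hBle : (B.card : ℝ) ≤ p ^ 2 := by
    rw [← hcardu]; exact_mod_cast Finset.card_le_univ B
  have hquad := many_quadruples f hf φ B τ hτ0.le hBcard hBφ
  set Γ := graphOver B φ with hΓ
  have hE : τ ^ 12 * (Γ.card : ℝ) ^ 3 ≤ ((((Γ ×ˢ Γ) ×ˢ (Γ ×ˢ Γ)).filter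
      fun q => q.1.1 - q.1.2 = q.2.1 - q.2.2).card : ℕ) := by
    rw [hΓ, card_graphOver]
    calc τ ^ 12 * (B.card : ℝ) ^ 3 ≤ τ ^ 12 * ((p : ℝ) ^ 2) ^ 3 := by gcongr
      _ = τ ^ 12 * p ^ 6 := by ring
      _ ≤ _ := hquad
      _ ≤ _ := by
        have := Finset.card_le_card_of_injOn
          (s := ((B ×ˢ B) ×ˢ (B ×ˢ B)).filter fun q => q.1.1 - q.1.2 = q.2.1 - q.2.2 ∧
            φ q.1.1 - φ q.1.2 = φ q.2.1 - φ q.2.2)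
          (t := ((graphOver B φ ×ˢ graphOver B φ) ×ˢ (graphOver B φ ×ˢ graphOver B φ)).filter
            fun q => q.1.1 - q.1.2 = q.2.1 - q.2.2)
          (fun q => (((q.1.1, φ q.1.1), (q.1.2, φ q.1.2)), ((q.2.1, φ q.2.1), (q.2.2, φ q.2.2))))
          (by
            intro q hq
            simp only [Finset.coe_filter, Finset.mem_product, Set.mem_ofPred_eq] at hq ⊢
            exact ⟨⟨⟨mk_mem_graphOver hq.1.1.1, mk_mem_graphOver hq.1.1.2⟩,
              mk_mem_graphOver hq.1.2.1, mk_mem_graphOver hq.1.2.2⟩, Prod.ext hq.2.1 hq.2.2⟩)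
          (by
            rintro ⟨⟨a, b⟩, c, d⟩ _ ⟨⟨a', b'⟩, c', d'⟩ _ h
            simp only [Prod.mk.injEq] at h ⊢
            tauto)
        exact_mod_cast this
  obtain ⟨Γ', hΓ', h1, h2⟩ := balog_szemeredi_gowers Γ (τ ^ 12) (by positivity) hE
  set H := Γ'.image Prod.fst with hH
  have hHB : H ⊆ B := by
    intro h hh
    obtain ⟨g, hg, rfl⟩ := Finset.mem_image.1 hh
    obtain ⟨b, hb, rfl⟩ := Finset.mem_image.1 (hΓ' hg)
    exact hb
  have hgr : graphOver H φ = Γ' := by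
    ext g
    constructor
    · intro hg
      obtain ⟨h, hh, rfl⟩ := Finset.mem_image.1 hg
      obtain ⟨g', hg', rfl⟩ := Finset.mem_image.1 hh
      obtain ⟨b, hb, rfl⟩ := Finset.mem_image.1 (hΓ' hg')
      exact hg'
    · intro hg
      have : g.1 ∈ H := Finset.mem_image_of_mem _ hg
      obtain ⟨b, hb, rfl⟩ := Finset.mem_image.1 (hΓ' hg)
      exact mk_mem_graphOver this
  have hHcard : H.card = Γ'.card := by rw [← hgr, card_graphOver]
  rw [hΓ, card_graphOver, ← hHcard] at h1
  have hHpos : (0 : ℝ) < H.card := lt_of_lt_of_le (by positivity) h1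
  have hHne : H.Nonempty := Finset.card_pos.1 (by exact_mod_cast hHpos)
  have hinv : 2 ≤ τ⁻¹ := by
    rw [le_inv_comm₀ (by norm_num) hτ0]; simpa using hτ1
  have hinv1 : 1 ≤ τ⁻¹ := by linarith
  have htwo : ∀ k : ℕ, (2 : ℝ) ^ k ≤ τ⁻¹ ^ k := fun k => by gcongr
  set K : ℝ := τ⁻¹ ^ 144 with hK
  have hK1 : 1 ≤ K := one_le_pow₀ hinv1
  have hKd : ((graphOver H φ - graphOver H φ).card : ℝ) ≤ K * (graphOver H φ).card := by
    rw [hgr]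
    have e : ((τ ^ 12 / 2) ^ 10) * (τ⁻¹ ^ 120 * 2 ^ 10) = 1 := by
      rw [div_pow, ← pow_mul, inv_pow]; field_simp
    calc ((Γ' - Γ').card : ℝ) = (τ⁻¹ ^ 120 * 2 ^ 10) * ((τ ^ 12 / 2) ^ 10 * (Γ' - Γ').card) := by
          rw [← mul_assoc, mul_comm _ ((τ ^ 12 / 2) ^ 10), e, one_mul]
      _ ≤ (τ⁻¹ ^ 120 * 2 ^ 10) * (2 ^ 14 * Γ'.card) := by gcongr
      _ = τ⁻¹ ^ 120 * 2 ^ 24 * Γ'.card := by ring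
      _ ≤ τ⁻¹ ^ 120 * τ⁻¹ ^ 24 * Γ'.card := by
          have := htwo 24
          gcongr
      _ = K * Γ'.card := by rw [hK, ← pow_add]
  have hK13 : K ^ 13 = τ⁻¹ ^ 1872 := by rw [hK, ← pow_mul]
  obtain ⟨H', hH', h3, h4⟩ := exists_freiman_hom H φ hHne K hK1 hKd (by
    rw [hK13]
    calc (32 : ℝ) * τ⁻¹ ^ 1872 ≤ τ⁻¹ ^ 5 * τ⁻¹ ^ 1872 := by
          have := htwo 5
          gcongr
          linarith
      _ = τ⁻¹ ^ 1877 := by rw [← pow_add]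
      _ ≤ p := hp)
  have h5 : τ ^ 1894 * p ^ 2 ≤ H'.card := by
    rw [hK13] at h3
    have h6 : τ ^ 12 / 8 * (τ * p ^ 2) ≤ 64 * τ⁻¹ ^ 1872 * H'.card :=
      ((mul_le_mul_of_nonneg_left hBcard (by positivity)).trans h1).trans h3
    have e : τ ^ 1872 * τ⁻¹ ^ 1872 = 1 := by
      rw [← mul_pow, mul_inv_cancel₀ hτ0.ne', one_pow]
    have h7 : τ ^ 1885 / 512 * p ^ 2 ≤ H'.card := by
      have h8 := mul_le_mul_of_nonneg_left h6 (show 0 ≤ τ ^ 1872 / 64 by positivity)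
      have e2 : τ ^ 1872 / 64 * (64 * τ⁻¹ ^ 1872 * (H'.card : ℝ)) = H'.card := by
        calc _ = (τ ^ 1872 * τ⁻¹ ^ 1872) * (H'.card : ℝ) := by ring
          _ = _ := by rw [e, one_mul]
      rw [e2] at h8
      refine le_trans (le_of_eq ?_) h8
      ring
    refine le_trans ?_ h7
    rw [show (1894 : ℕ) = 1885 + 9 from rfl, pow_add]
    have : τ ^ 9 ≤ 1 / 512 := by
      calc τ ^ 9 ≤ (1 / 2) ^ 9 := by gcongr
        _ = _ := by norm_num
    rw [div_eq_mul_one_div (τ ^ 1885)]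
    gcongr
  refine ⟨H', fun h hh => hBφ h (hHB (hH' hh)), h5, ?_, h4⟩
  refine Finset.card_pos.1 ?_
  have : (0 : ℝ) < H'.card := lt_of_lt_of_le (by positivity) h5
  exact_mod_cast this

end Restriction

section Grid

open scoped Pointwise

/-- The square box `{0, …, m - 1}²`. -/
noncomputable def box (m : ℕ) : Finset (ℤ × ℤ) := Finset.Ico (0 : ℤ) m ×ˢ Finset.Ico (0 : ℤ) m

lemma mem_box {m : ℕ} {k : ℤ × ℤ} : k ∈ box m ↔ (0 ≤ k.1 ∧ k.1 < m) ∧ 0 ≤ k.2 ∧ k.2 < m := by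
  simp [box]

lemma card_box (m : ℕ) : (box m).card = m ^ 2 := by
  simp [box, sq]

/-- Reduction of an integer point modulo `p`. -/
def reduce (p : ℕ) : ℤ × ℤ →+ Plane p := (Int.castAddHom _).prodMap (Int.castAddHom _)

lemma reduce_apply (p : ℕ) (k : ℤ × ℤ) : reduce p k = ((k.1 : ZMod p), (k.2 : ZMod p)) := rfl

lemma eq_of_reduce_eq {p : ℕ} {k l : ℤ × ℤ} (h : reduce p k = reduce p l)
    (h1 : |k.1 - l.1| < p) (h2 : |k.2 - l.2| < p) : k = l := by
  have key : ∀ a b : ℤ, |a - b| < p → (a : ZMod p) = b → a = b := by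
    intro a b hab he
    have hd := (ZMod.intCast_eq_intCast_iff_dvd_sub b a p).1 he.symm
    have := Int.eq_zero_of_abs_lt_dvd hd hab
    linarith
  rw [reduce_apply, reduce_apply, Prod.mk.injEq] at h
  exact Prod.ext (key _ _ h1 h.1) (key _ _ h2 h.2)

lemma injOn_reduce_smul {p : ℕ} {w m : ℕ} (hw : 1 ≤ w) (h : w * m ≤ p) :
    Set.InjOn (fun k => reduce p ((w : ℤ) • k)) (box m : Set (ℤ × ℤ)) := by
  intro k hk l hl hkl
  have hk := mem_box.1 hk
  have hl := mem_box.1 hl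
  have hw' : (1 : ℤ) ≤ w := by exact_mod_cast hw
  have h' : (w : ℤ) * m ≤ p := by exact_mod_cast h
  have key : ∀ a b : ℤ, 0 ≤ a ∧ a < m → 0 ≤ b ∧ b < m → |(w : ℤ) * a - w * b| < p := by
    intro a b ha hb
    rw [abs_lt]
    constructor <;> nlinarith
  have := eq_of_reduce_eq hkl (key _ _ hk.1 hl.1) (key _ _ hk.2 hl.2)
  have hw0 : (w : ℤ) ≠ 0 := by omega
  exact smul_right_injective _ hw0 this

lemma chi_zsmul_left {p : ℕ} [NeZero p] (n : ℤ) (ξ x : Plane p) :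
    chi (n • ξ) x = chi ξ (n • x) := by
  unfold chi
  congr 1
  simp only [Prod.smul_fst, Prod.smul_snd]
  simp only [zsmul_eq_mul]
  ring

section

variable {p : ℕ} [Fact p.Prime]

lemma card_image_add_image_le (w m : ℕ) [DecidableEq (Plane p)] :
    ((box m).image (fun k => reduce p ((w : ℤ) • k)) +
      (box m).image (fun k => reduce p ((w : ℤ) • k))).card ≤ 4 * m ^ 2 := by
  have : (box m).image (fun k => reduce p ((w : ℤ) • k)) +
      (box m).image (fun k => reduce p ((w : ℤ) • k)) ⊆
      (box (2 * m)).image (fun k => reduce p ((w : ℤ) • k)) := by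
    intro x hx
    obtain ⟨a, ha, b, hb, rfl⟩ := Finset.mem_add.1 hx
    obtain ⟨k, hk, rfl⟩ := Finset.mem_image.1 ha
    obtain ⟨l, hl, rfl⟩ := Finset.mem_image.1 hb
    refine Finset.mem_image.2 ⟨k + l, ?_, by simp⟩
    rw [mem_box] at *
    simp only [Prod.fst_add, Prod.snd_add]
    push_cast
    omega
  refine (Finset.card_le_card this).trans (Finset.card_image_le.trans ?_)
  rw [card_box]
  apply le_of_eq
  ring

theorem norm_chi_grid_sub_one_le (ψ₁ ψ₂ : Plane p) (d q m : ℕ) (ε : ℝ)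
    (hα : ∀ α ∈ [(d : ℝ) * ((ψ₁.1.val : ℝ) / p), d * ((ψ₁.2.val : ℝ) / p),
      d * ((ψ₂.1.val : ℝ) / p), d * ((ψ₂.2.val : ℝ) / p)], ∃ z : ℤ, |(q : ℝ) ^ 2 * α - z| ≤ ε)
    (i j : ℤ) (hi : |i| ≤ m) (hj : |j| ≤ m) (k : ℤ × ℤ) (hk : k ∈ box m) :
    ‖chi ((q * i) • ψ₁ + (q * j) • ψ₂) (reduce p (((d * q : ℕ) : ℤ) • k)) - 1‖ ≤
      8 * Real.pi * m ^ 2 * ε := by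
  have key : ∀ (ψ : Plane p) (i : ℤ), |i| ≤ m →
      (∃ z : ℤ, |(q : ℝ) ^ 2 * (d * ((ψ.1.val : ℝ) / p)) - z| ≤ ε) →
      (∃ z : ℤ, |(q : ℝ) ^ 2 * (d * ((ψ.2.val : ℝ) / p)) - z| ≤ ε) →
      ‖chi ((q * i) • ψ) (reduce p (((d * q : ℕ) : ℤ) • k)) - 1‖ ≤ 4 * Real.pi * m ^ 2 * ε := by
    intro ψ i hi h1 h2
    have hk := mem_box.1 hk
    have hb : ∀ a : ℤ, 0 ≤ a ∧ a < m → |((i * a : ℤ) : ℝ)| ≤ (m : ℝ) ^ 2 := by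
      intro a ha
      have : |i * a| ≤ (m : ℤ) ^ 2 := by
        rw [abs_mul, sq, abs_of_nonneg ha.1]
        exact mul_le_mul hi ha.2.le ha.1 (by positivity)
      exact_mod_cast this
    have := norm_chi_sub_one_le ψ (q ^ 2 * d) ε
      (by obtain ⟨z, hz⟩ := h1; exact ⟨z, by push_cast; rwa [mul_assoc]⟩)
      (by obtain ⟨z, hz⟩ := h2; exact ⟨z, by push_cast; rwa [mul_assoc]⟩)
      ((m : ℝ) ^ 2) (i * k.1) (i * k.2) (hb _ hk.1) (hb _ hk.2)
    have e : (q * i) • reduce p (((d * q : ℕ) : ℤ) • k) =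
        ((((q ^ 2 * d : ℕ) * (i * k.1) : ℤ) : ZMod p), (((q ^ 2 * d : ℕ) * (i * k.2) : ℤ) : ZMod p)) := by
      rw [← map_zsmul, reduce_apply]
      simp only [Prod.smul_fst, Prod.smul_snd, smul_eq_mul]
      push_cast
      congr 1 <;> ring
    rwa [chi_zsmul_left, e]
  simp only [List.mem_cons, List.not_mem_nil, or_false, forall_eq_or_imp, forall_eq] at hα
  have h1 := key ψ₁ i hi hα.1 hα.2.1
  have h2 := key ψ₂ j hj hα.2.2.1 hα.2.2.2
  rw [chi_add_left]
  set a := chi ((q * i) • ψ₁) (reduce p (((d * q : ℕ) : ℤ) • k))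
  set b := chi ((q * j) • ψ₂) (reduce p (((d * q : ℕ) : ℤ) • k)) with hb
  calc ‖a * b - 1‖ = ‖(a - 1) * b + (b - 1)‖ := by congr 1; ring
    _ ≤ ‖a - 1‖ * ‖b‖ + ‖b - 1‖ := by
        rw [← norm_mul]; exact norm_add_le _ _
    _ ≤ _ := by
        rw [hb, norm_chi, mul_one]
        linarith


end

/-- A function with many correlated derivatives correlates with characters on the translates of
a grid of bounded mesh. -/
theorem exists_grid_correlation : ∃ C : ℕ, ∀ (p : ℕ) [Fact p.Prime] (f : Plane p → ℝ),
    (∀ x, |f x| ≤ 1) → ∀ (φ : Plane p → Plane p) (τ : ℝ), 0 < τ → τ ≤ 1 / 2 →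
    2 * τ * p ^ 4 ≤ ∑ h, ‖∑ x, ((f x * f (x + h) : ℝ) : ℂ) * chi (φ h) x‖ →
    τ⁻¹ ^ 1877 ≤ p → ∀ L : ℕ, 64 * τ⁻¹ ≤ L →
    ∃ w : ℕ, 1 ≤ w ∧ (w : ℝ) ≤ (L : ℝ) ^ (C * τ⁻¹ ^ 3788) ∧
      (w * L ^ 6 ≤ p → ∃ ξ : Plane p → Plane p, τ ^ 1895 / 4 * (p ^ 2 * L ^ 12) ≤
        ∑ x, ‖∑ k ∈ box (L ^ 6), ((f (x + reduce p ((w : ℤ) • k)) : ℝ) : ℂ) *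
          chi (ξ x) (reduce p ((w : ℤ) • k))‖) := by
  classical
  obtain ⟨C, hC⟩ := exists_simultaneous_sq_approx 4
  refine ⟨65 * C + 28, fun p _ f hf φ τ hτ0 hτ1 hφ hp L hL => ?_⟩
  obtain ⟨H, hHτ, hHcard, hHne, hHφ⟩ := exists_freiman_restriction f hf φ τ hτ0 hτ1 hφ hp
  have hinv : 2 ≤ τ⁻¹ := by
    rw [le_inv_comm₀ (by norm_num) hτ0]; simpa using hτ1
  have hL128 : (128 : ℝ) ≤ L := by linarith
  have hL1 : (1 : ℝ) ≤ L := by linarith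
  have hL1' : 1 ≤ L := by exact_mod_cast hL1
  have hL2' : 2 ≤ L := by have : 128 ≤ L := by exact_mod_cast hL128
                          omega
  obtain ⟨d, hd1, hd, ψ₁, ψ₂, hψ⟩ := exists_linear_on_grid H φ hHne hHφ (τ ^ 1894)
    (by positivity) hHcard (L ^ (13 * C + 6)) (Nat.one_le_pow _ _ hL1')
  obtain ⟨q, hq1, hq, hα⟩ := hC (L ^ 13) (hL2'.trans (Nat.le_self_pow (by norm_num) _))
    [(d : ℝ) * ((ψ₁.1.val : ℝ) / p), d * ((ψ₁.2.val : ℝ) / p),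
      d * ((ψ₂.1.val : ℝ) / p), d * ((ψ₂.2.val : ℝ) / p)] rfl
  refine ⟨d * q, Nat.mul_pos hd1 hq1, ?_, fun hwp => ?_⟩
  · have hs : (1 : ℝ) ≤ τ⁻¹ ^ 3788 := one_le_pow₀ (by linarith)
    have e1 : (((τ : ℝ) ^ 1894)⁻¹) ^ 2 = τ⁻¹ ^ 3788 := by
      rw [← inv_pow, ← pow_mul]
    rw [e1] at hd
    have hd' : (d : ℝ) ≤ (L : ℝ) ^ (((13 * C + 7 : ℕ) : ℝ) * (4 * τ⁻¹ ^ 3788)) := by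
      refine hd.trans ?_
      rw [Real.rpow_mul (Nat.cast_nonneg L), Real.rpow_natCast]
      refine Real.rpow_le_rpow (by positivity) ?_ (by positivity)
      push_cast
      rw [show 13 * C + 7 = (13 * C + 6) + 1 from rfl, pow_succ _ (13 * C + 6), mul_comm]
      gcongr
      linarith
    have hq' : (q : ℝ) ≤ (L : ℝ) ^ ((13 * C : ℕ) : ℝ) := by
      rw [Real.rpow_natCast, pow_mul]
      exact_mod_cast hq
    push_cast
    refine (mul_le_mul hd' hq' (by positivity) (by positivity)).trans ?_
    rw [← Real.rpow_add (by positivity)]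
    refine Real.rpow_le_rpow_of_exponent_le hL1 ?_
    push_cast
    have : (0 : ℝ) ≤ 13 * C := by positivity
    nlinarith
  · have hinj := injOn_reduce_smul (p := p) (Nat.mul_pos hd1 hq1) hwp
    set P := (box (L ^ 6)).image fun k => reduce p (((d * q : ℕ) : ℤ) • k) with hP
    have hPcard : P.card = L ^ 12 := by
      rw [hP, Finset.card_image_of_injOn hinj, card_box]
      ring
    have hPPcard : (P + P).card ≤ 4 * P.card := by
      rw [hPcard]
      refine (card_image_add_image_le _ _).trans (le_of_eq (by ring))
    have hη : ∀ h ∈ H, ∀ h' ∈ H, h' - h ∈ P - P → ∀ k ∈ P,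
        ‖chi (φ h' - φ h) k - 1‖ ≤ τ / 2 := by
      intro h hh h' hh' hd' k hk
      obtain ⟨a, ha, b, hb, hab⟩ := Finset.mem_sub.1 hd'
      obtain ⟨k, hkb, rfl⟩ := Finset.mem_image.1 hk
      obtain ⟨k₁, hk₁, rfl⟩ := Finset.mem_image.1 ha
      obtain ⟨k₂, hk₂, rfl⟩ := Finset.mem_image.1 hb
      have hb1 : |k₁.1 - k₂.1| ≤ ((L ^ 6 : ℕ) : ℤ) ∧ |k₁.2 - k₂.2| ≤ ((L ^ 6 : ℕ) : ℤ) := by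
        rw [mem_box] at hk₁ hk₂
        rw [abs_le, abs_le]
        omega
      have hb2 : ∀ a : ℤ, |a| ≤ ((L ^ 6 : ℕ) : ℤ) → |q * a| ≤ ((L ^ (13 * C + 6) : ℕ) : ℤ) := by
        intro a ha
        rw [abs_mul, pow_add, Nat.cast_mul, Nat.abs_cast]
        rw [← pow_mul] at hq
        exact mul_le_mul (by exact_mod_cast hq) ha (abs_nonneg _) (by positivity)
      have hh'e : h + (((d * (q * (k₁.1 - k₂.1)) : ℤ) : ZMod p),
          ((d * (q * (k₁.2 - k₂.2)) : ℤ) : ZMod p)) = h' := by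
        rw [sub_eq_iff_eq_add'.1 hab.symm, ← map_sub, ← smul_sub, reduce_apply]
        congr 2
        · simp only [Prod.smul_fst, Prod.fst_sub, smul_eq_mul]
          push_cast
          ring
        · simp only [Prod.smul_snd, Prod.snd_sub, smul_eq_mul]
          push_cast
          ring
      have h1 := hψ _ _ (hb2 _ hb1.1) (hb2 _ hb1.2) h hh (by rwa [hh'e])
      rw [hh'e] at h1
      rw [h1, add_sub_cancel_left]
      refine (norm_chi_grid_sub_one_le ψ₁ ψ₂ d q (L ^ 6) _ hα _ _ hb1.1 hb1.2 k hkb).trans ?_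
      have hpi := Real.pi_lt_four
      have hτL : 64 ≤ τ * L := by
        have := mul_le_mul_of_nonneg_left hL hτ0.le
        rwa [mul_left_comm, mul_inv_cancel₀ hτ0.ne', mul_one] at this
      have hL0 : (0 : ℝ) < L := by linarith
      push_cast
      rw [show 8 * Real.pi * ((L : ℝ) ^ 6) ^ 2 * (1 / (L : ℝ) ^ 13) = 8 * Real.pi / L by
        field_simp, div_le_iff₀ hL0]
      linarith
    obtain ⟨ξ, hξ⟩ := exists_local_correlation f hf H φ τ hHτ P
      (Finset.card_pos.1 (by rw [hPcard]; positivity)) hPPcard hη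
    refine ⟨ξ, ?_⟩
    have e : ∀ x, ∑ k ∈ P, ((f (x + k) : ℝ) : ℂ) * chi (ξ x) k =
        ∑ k ∈ box (L ^ 6), ((f (x + reduce p (((d * q : ℕ) : ℤ) • k)) : ℝ) : ℂ) *
          chi (ξ x) (reduce p (((d * q : ℕ) : ℤ) • k)) := fun x => by
      rw [hP, Finset.sum_image hinj]
    rw [← Finset.sum_congr rfl fun x _ => congrArg norm (e x)]
    refine le_trans ?_ hξ
    rw [hPcard]
    push_cast
    calc τ ^ 1895 / 4 * ((p : ℝ) ^ 2 * L ^ 12) = τ / 4 * (τ ^ 1894 * p ^ 2) * L ^ 12 := by ring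
      _ ≤ _ := by gcongr

end Grid

section Shift

lemma norm_sum_box_shift_sub_le {E : Type*} [NormedAddCommGroup E] (G : ℤ × ℤ → E)
    (hG : ∀ k, ‖G k‖ ≤ 1) (m t : ℕ) (s : ℤ × ℤ) (h1 : 0 ≤ s.1) (h1' : s.1 ≤ t) (h2 : 0 ≤ s.2)
    (h2' : s.2 ≤ t) :
    ‖∑ k ∈ box m, G (k + s) - ∑ k ∈ box m, G k‖ ≤ 4 * m * t := by
  classical
  set B := (box m).map (addRightEmbedding s) with hB
  have e : ∑ k ∈ box m, G (k + s) = ∑ k ∈ B, G k := by simp [hB]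
  have hcard : (box m \ B).card ≤ 2 * m * t := by
    have hsub : box m \ B ⊆ (Finset.Ico (0 : ℤ) t ×ˢ Finset.Ico (0 : ℤ) m) ∪
        (Finset.Ico (0 : ℤ) m ×ˢ Finset.Ico (0 : ℤ) t) := by
      intro k hk
      rw [Finset.mem_sdiff, mem_box] at hk
      obtain ⟨hk, hkB⟩ := hk
      have : ¬ ((s.1 ≤ k.1) ∧ s.2 ≤ k.2) := by
        intro h
        apply hkB
        rw [hB, Finset.mem_map]
        refine ⟨k - s, ?_, by simp⟩
        rw [mem_box]
        simp only [Prod.fst_sub, Prod.snd_sub]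
        omega
      simp only [Finset.mem_union, Finset.mem_product, Finset.mem_Ico]
      omega
    refine (Finset.card_le_card hsub).trans ((Finset.card_union_le _ _).trans ?_)
    simp only [Finset.card_product, Int.card_Ico, sub_zero, Int.toNat_natCast]
    apply le_of_eq
    ring
  have hcard' : (B \ box m).card ≤ 2 * m * t := by
    rwa [Finset.card_sdiff_comm (by rw [hB, Finset.card_map])]
  have hle : ∀ S : Finset (ℤ × ℤ), S.card ≤ 2 * m * t → ‖∑ k ∈ S, G k‖ ≤ 2 * m * t := by
    intro S hS
    refine (norm_sum_le _ _).trans ((Finset.sum_le_card_nsmul _ _ 1 fun k _ => hG k).trans ?_)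
    rw [nsmul_eq_mul, mul_one]
    exact_mod_cast hS
  rw [e, ← Finset.sum_sdiff_sub_sum_sdiff]
  refine (norm_sub_le _ _).trans ?_
  have := hle _ hcard
  have := hle _ hcard'
  linarith

lemma norm_sum_subgrid_sub_le {E : Type*} [NormedAddCommGroup E] (G : ℤ × ℤ → E)
    (hG : ∀ k, ‖G k‖ ≤ 1) (L r : ℕ) (hr : r ≤ L ^ 4) :
    ‖∑ k ∈ box (L ^ 6), ∑ u ∈ box L, G (k + (r : ℤ) • u) - L ^ 2 • ∑ k ∈ box (L ^ 6), G k‖ ≤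
      4 * L ^ 13 := by
  have hshift : ∀ u ∈ box L, ‖∑ k ∈ box (L ^ 6), G (k + (r : ℤ) • u) -
      ∑ k ∈ box (L ^ 6), G k‖ ≤ 4 * L ^ 11 := by
    intro u hu
    have hu := mem_box.1 hu
    have hb : ∀ a : ℤ, 0 ≤ a ∧ a < L → (r : ℤ) * a ≤ ((L ^ 5 : ℕ) : ℤ) := by
      intro a ha
      calc (r : ℤ) * a ≤ ((L ^ 4 : ℕ) : ℤ) * L :=
            mul_le_mul (by exact_mod_cast hr) ha.2.le ha.1 (by positivity)
        _ = _ := by push_cast; ring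
    have := norm_sum_box_shift_sub_le G hG (L ^ 6) (L ^ 5) ((r : ℤ) • u)
      (mul_nonneg (by positivity) hu.1.1) (hb _ hu.1)
      (mul_nonneg (by positivity) hu.2.1) (hb _ hu.2)
    refine this.trans (le_of_eq ?_)
    push_cast
    ring
  rw [Finset.sum_comm, ← card_box, ← Finset.sum_const, ← Finset.sum_sub_distrib]
  refine (norm_sum_le _ _).trans ((Finset.sum_le_card_nsmul _ _ _ hshift).trans (le_of_eq ?_))
  rw [nsmul_eq_mul, card_box]
  push_cast
  ring

end Shift

section LinearPhase

variable {p : ℕ} [NeZero p]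

/-- A character on a long grid is almost constant on a suitable subgrid, so correlation with it
yields large averages on subgrids. -/
theorem exists_subgrid (f : Plane p → ℝ) (hf : ∀ x, |f x| ≤ 1) (ξ x : Plane p) (w L : ℕ)
    (hL : 1 ≤ L) :
    ∃ r : ℕ, 1 ≤ r ∧ r ≤ L ^ 4 ∧
      ‖∑ k ∈ box (L ^ 6), ((f (x + reduce p ((w : ℤ) • k)) : ℝ) : ℂ) *
        chi ξ (reduce p ((w : ℤ) • k))‖ * L ^ 2 ≤
      ∑ v ∈ box (L ^ 6), |∑ u ∈ box L,
        f (x + reduce p ((w : ℤ) • v) + reduce p (((w * r : ℕ) : ℤ) • u))| + 20 * L ^ 13 := by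
  obtain ⟨r, hr1, hr, hrα⟩ := exists_simultaneous_approx (Finset.univ : Finset (Fin 2))
    ![w * ((ξ.1.val : ℝ) / p), w * ((ξ.2.val : ℝ) / p)] (L ^ 2) (Nat.one_le_pow _ _ hL)
  have hr4 : r ≤ L ^ 4 := by
    simpa [← pow_mul] using hr
  refine ⟨r, hr1, hr4, ?_⟩
  have hL0 : (0 : ℝ) < L := by exact_mod_cast hL
  have h1 := hrα 0 (Finset.mem_univ _)
  have h2 := hrα 1 (Finset.mem_univ _)
  simp only [Matrix.cons_val_zero, Matrix.cons_val_one] at h1 h2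
  have hphase : ∀ u ∈ box L, ‖chi ξ (reduce p (((w * r : ℕ) : ℤ) • u)) - 1‖ ≤ 16 / L := by
    intro u hu
    have hu := mem_box.1 hu
    have hb : ∀ a : ℤ, 0 ≤ a ∧ a < L → |(a : ℝ)| ≤ (L : ℝ) := by
      intro a ha
      have : |a| ≤ (L : ℤ) := by rw [abs_of_nonneg ha.1]; exact ha.2.le
      exact_mod_cast this
    have := norm_chi_sub_one_le ξ (w * r) (1 / ((L ^ 2 : ℕ) : ℝ))
      (by obtain ⟨z, hz⟩ := h1
          exact ⟨z, by push_cast at hz ⊢; rwa [mul_comm (w : ℝ), mul_assoc]⟩)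
      (by obtain ⟨z, hz⟩ := h2
          exact ⟨z, by push_cast at hz ⊢; rwa [mul_comm (w : ℝ), mul_assoc]⟩)
      L u.1 u.2 (hb _ hu.1) (hb _ hu.2)
    refine le_trans (le_of_eq rfl) (this.trans ?_)
    have hpi := Real.pi_lt_four
    push_cast
    rw [show 4 * Real.pi * L * (1 / (L : ℝ) ^ 2) = 4 * Real.pi / L by field_simp]
    gcongr
    linarith
  set G : ℤ × ℤ → ℂ := fun k => ((f (x + reduce p ((w : ℤ) • k)) : ℝ) : ℂ) *
        chi ξ (reduce p ((w : ℤ) • k)) with hGdef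
  have hG : ∀ k, ‖G k‖ ≤ 1 := fun k => by
    rw [hGdef, norm_mul, norm_chi, mul_one, Complex.norm_real]
    exact hf _
  have hcardL : ((box L).card : ℝ) = L ^ 2 := by rw [card_box]; push_cast; rfl
  have hinner : ∀ k, ‖∑ u ∈ box L, G (k + (r : ℤ) • u)‖ ≤ |∑ u ∈ box L,
      f (x + reduce p ((w : ℤ) • k) + reduce p (((w * r : ℕ) : ℤ) • u))| + 16 * L := by
    intro k
    have e1 : ∀ u, G (k + (r : ℤ) • u) = chi ξ (reduce p ((w : ℤ) • k)) *
        (((f (x + reduce p ((w : ℤ) • k) + reduce p (((w * r : ℕ) : ℤ) • u)) : ℝ) : ℂ) +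
        ((f (x + reduce p ((w : ℤ) • k) + reduce p (((w * r : ℕ) : ℤ) • u)) : ℝ) : ℂ) *
          (chi ξ (reduce p (((w * r : ℕ) : ℤ) • u)) - 1)) := by
      intro u
      simp only [hGdef]
      rw [smul_add, smul_smul, map_add, ← add_assoc, chi_add_right, Nat.cast_mul]
      ring
    simp only [e1]
    rw [← Finset.mul_sum, norm_mul, norm_chi, one_mul, Finset.sum_add_distrib]
    refine (norm_add_le _ _).trans ?_
    rw [← Complex.ofReal_sum, Complex.norm_real, Real.norm_eq_abs]
    refine add_le_add le_rfl ?_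
    refine (norm_sum_le _ _).trans ((Finset.sum_le_card_nsmul _ _ (16 / (L : ℝ)) ?_).trans ?_)
    · intro u hu
      rw [norm_mul, Complex.norm_real, Real.norm_eq_abs]
      calc _ ≤ 1 * (16 / (L : ℝ)) := mul_le_mul (hf _) (hphase u hu) (norm_nonneg _) zero_le_one
        _ = _ := one_mul _
    · rw [nsmul_eq_mul, hcardL]
      apply le_of_eq
      field_simp
  have hsum := norm_sum_subgrid_sub_le G hG L r hr4
  have hsum2 : ‖∑ k ∈ box (L ^ 6), ∑ u ∈ box L, G (k + (r : ℤ) • u)‖ ≤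
      ∑ v ∈ box (L ^ 6), |∑ u ∈ box L,
        f (x + reduce p ((w : ℤ) • v) + reduce p (((w * r : ℕ) : ℤ) • u))| + 16 * L ^ 13 := by
    refine (norm_sum_le _ _).trans ((Finset.sum_le_sum fun k _ => hinner k).trans ?_)
    rw [Finset.sum_add_distrib, Finset.sum_const, card_box, nsmul_eq_mul]
    apply le_of_eq
    push_cast
    ring
  have h3 := norm_sub_norm_le (L ^ 2 • ∑ k ∈ box (L ^ 6), G k)
    (∑ k ∈ box (L ^ 6), ∑ u ∈ box L, G (k + (r : ℤ) • u))
  rw [norm_sub_rev] at h3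
  have h4 : ‖L ^ 2 • ∑ k ∈ box (L ^ 6), G k‖ = ‖∑ k ∈ box (L ^ 6), G k‖ * L ^ 2 := by
    rw [nsmul_eq_mul, norm_mul, Complex.norm_natCast, mul_comm]
    push_cast
    rfl
  rw [h4] at h3
  linarith

/-- A function of mean zero supported on the reduction of a large box, correlating with
characters on translates of a grid, has large average on a subgrid contained in the box. -/
theorem exists_dense_subgrid (f : Plane p → ℝ) (hf : ∀ x, |f x| ≤ 1) (hsum : ∑ x, f x = 0)
    (n : ℕ) (hn : 4 * n < p) (hsupp : ∀ x, f x ≠ 0 → ∃ b ∈ box n, reduce p b = x)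
    (w L : ℕ) (hL : 1 ≤ L) (c : ℝ) (hc : 0 < c) (hcL : 48 ≤ c * L)
    (hw : 8 * (w * L ^ 5 : ℕ) ≤ c * n) (hwn : w * L ^ 5 ≤ n) (ξ : Plane p → Plane p)
    (hξ : c * (p ^ 2 * L ^ 12) ≤
        ∑ x, ‖∑ k ∈ box (L ^ 6), ((f (x + reduce p ((w : ℤ) • k)) : ℝ) : ℂ) *
          chi (ξ x) (reduce p ((w : ℤ) • k))‖) :
    ∃ b : ℤ × ℤ, ∃ r : ℕ, 1 ≤ r ∧ (∀ u ∈ box L, b + ((w * r : ℕ) : ℤ) • u ∈ box n) ∧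
      c / 8 * L ^ 2 ≤ ∑ u ∈ box L, f (reduce p (b + ((w * r : ℕ) : ℤ) • u)) := by
  classical
  choose r hr1 hr4 hr using fun x => exists_subgrid f hf (ξ x) x w L hL
  set D : ℕ → Plane p → ℝ := fun r y => ∑ u ∈ box L, f (y + reduce p (((w * r : ℕ) : ℤ) • u))
    with hD
  have hL0 : (0 : ℝ) < L := by exact_mod_cast hL
  have hp0 : (0 : ℝ) < p := by exact_mod_cast (NeZero.pos p)
  have hcardu : ((Finset.univ : Finset (Plane p)).card : ℝ) = (p : ℝ) ^ 2 := by
    rw [Finset.card_univ, card_plane]; push_cast; rfl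
  have hDle : ∀ r y, |D r y| ≤ L ^ 2 := by
    intro r y
    refine (Finset.abs_sum_le_sum_abs _ _).trans
      ((Finset.sum_le_card_nsmul _ _ 1 fun u _ => hf _).trans (le_of_eq ?_))
    rw [nsmul_eq_mul, card_box]
    push_cast
    ring
  by_contra! hcon
  set W := w * L ^ 5 with hW
  have hWr : ∀ r : ℕ, r ≤ L ^ 4 → ∀ a : ℤ, 0 ≤ a ∧ a < L →
      0 ≤ ((w * r : ℕ) : ℤ) * a ∧ ((w * r : ℕ) : ℤ) * a ≤ (W : ℤ) := by
    intro r hr a ha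
    refine ⟨mul_nonneg (by positivity) ha.1, ?_⟩
    calc ((w * r : ℕ) : ℤ) * a ≤ ((w * L ^ 4 : ℕ) : ℤ) * L :=
          mul_le_mul (by exact_mod_cast Nat.mul_le_mul_left _ hr) ha.2.le ha.1 (by positivity)
      _ = _ := by rw [hW]; push_cast; ring
  set bad := ((Finset.Ico (-W : ℤ) n ×ˢ Finset.Ico (-W : ℤ) n) \ box (n - W)).image (reduce p)
    with hbad
  have hbadcard : (bad.card : ℝ) ≤ 4 * n * W := by
    have h1 : bad.card ≤ (n + W) ^ 2 - (n - W) ^ 2 := by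
      refine Finset.card_image_le.trans ?_
      rw [Finset.card_sdiff_of_subset, card_box, Finset.card_product, Int.card_Ico]
      · rw [show ((n : ℤ) - (-W : ℤ)).toNat = n + W by omega, sq (n + W)]
      · intro k hk
        have := mem_box.1 hk
        simp only [Finset.mem_product, Finset.mem_Ico]
        omega
    have h2 : (n - W) ^ 2 + 4 * n * W = (n + W) ^ 2 := by
      zify [hwn]
      ring
    have h3 : bad.card ≤ 4 * n * W := by omega
    exact_mod_cast h3
  have hpoint : ∀ r y, 1 ≤ r → r ≤ L ^ 4 →
      |D r y| + D r y ≤ c / 4 * L ^ 2 + if y ∈ bad then 2 * (L : ℝ) ^ 2 else 0 := by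
    intro r y hr1 hr4
    have hpos : 0 < c / 4 * (L : ℝ) ^ 2 := by positivity
    by_cases hy : ∃ b ∈ box (n - W), reduce p b = y
    · obtain ⟨b, hb, rfl⟩ := hy
      have h1 := hcon b r hr1 (by
        intro u hu
        have hb := mem_box.1 hb
        have hu := mem_box.1 hu
        have h1 := hWr r hr4 _ hu.1
        have h2 := hWr r hr4 _ hu.2
        rw [mem_box]
        simp only [Prod.fst_add, Prod.snd_add, Prod.smul_fst, Prod.smul_snd, smul_eq_mul]
        omega)
      simp only [map_add] at h1
      have h2 : D r (reduce p b) < c / 8 * L ^ 2 := h1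
      have h3 : (0 : ℝ) ≤ if reduce p b ∈ bad then 2 * (L : ℝ) ^ 2 else 0 := by
        split_ifs <;> positivity
      rcases abs_cases (D r (reduce p b)) with h | h <;> linarith
    · split_ifs with hyb
      · have := hDle r y
        have := le_abs_self (D r y)
        linarith
      · have : D r y = 0 := by
          refine Finset.sum_eq_zero fun u hu => ?_
          by_contra hne
          obtain ⟨s, hs, hse⟩ := hsupp _ hne
          have hy' : reduce p (s - ((w * r : ℕ) : ℤ) • u) = y := by
            rw [map_sub, hse, add_sub_cancel_right]
          refine hyb (Finset.mem_image.2 ⟨_, Finset.mem_sdiff.2 ⟨?_, ?_⟩, hy'⟩)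
          · have hs := mem_box.1 hs
            have hu := mem_box.1 hu
            have h1 := hWr r hr4 _ hu.1
            have h2 := hWr r hr4 _ hu.2
            simp only [Finset.mem_product, Finset.mem_Ico, Prod.fst_sub, Prod.snd_sub,
              Prod.smul_fst, Prod.smul_snd, smul_eq_mul]
            omega
          · exact fun hmem => hy ⟨_, hmem, hy'⟩
        rw [this]
        simp only [abs_zero, add_zero]
        exact hpos.le
  have hcardm : ((box (L ^ 6)).card : ℝ) = L ^ 12 := by
    rw [card_box]; push_cast; ring
  have hshiftsum : ∀ (g : Plane p → ℝ) (v : Plane p), ∑ x, g (x + v) = ∑ x, g x := fun g v =>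
    Fintype.sum_equiv (Equiv.addRight v) (fun x => g (x + v)) g fun _ => rfl
  have hupper : ∑ x, ∑ v ∈ box (L ^ 6), (|D (r x) (x + reduce p ((w : ℤ) • v))| +
      D (r x) (x + reduce p ((w : ℤ) • v))) ≤
      L ^ 12 * (p ^ 2 * (c / 4 * L ^ 2) + 2 * L ^ 2 * bad.card) := by
    calc _ ≤ ∑ x, ∑ v ∈ box (L ^ 6), (c / 4 * (L : ℝ) ^ 2 +
          if x + reduce p ((w : ℤ) • v) ∈ bad then 2 * (L : ℝ) ^ 2 else 0) :=
          Finset.sum_le_sum fun x _ => Finset.sum_le_sum fun v _ => hpoint _ _ (hr1 x) (hr4 x)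
      _ = ∑ v ∈ box (L ^ 6), ∑ x : Plane p, (c / 4 * (L : ℝ) ^ 2 +
          if x ∈ bad then 2 * (L : ℝ) ^ 2 else 0) := by
          rw [Finset.sum_comm]
          refine Finset.sum_congr rfl fun v _ => ?_
          exact hshiftsum (fun x => c / 4 * (L : ℝ) ^ 2 + if x ∈ bad then 2 * (L : ℝ) ^ 2 else 0) _
      _ = _ := by
          rw [Finset.sum_const, nsmul_eq_mul, hcardm, Finset.sum_add_distrib, ← Finset.sum_filter,
            Finset.filter_mem_eq_inter, Finset.univ_inter, Finset.sum_const, Finset.sum_const,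
            nsmul_eq_mul, nsmul_eq_mul, hcardu]
          ring
  have hlow1 : c * (p ^ 2 * L ^ 12) * L ^ 2 ≤
      ∑ x, ∑ v ∈ box (L ^ 6), |D (r x) (x + reduce p ((w : ℤ) • v))| + p ^ 2 * (20 * L ^ 13) := by
    refine (mul_le_mul_of_nonneg_right hξ (by positivity)).trans ?_
    rw [Finset.sum_mul]
    refine (Finset.sum_le_sum fun x _ => hr x).trans (le_of_eq ?_)
    rw [Finset.sum_add_distrib, Finset.sum_const, nsmul_eq_mul, hcardu]
  have hlow2 : 0 ≤ ∑ x, ∑ v ∈ box (L ^ 6), D (r x) (x + reduce p ((w : ℤ) • v)) +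
      p ^ 2 * (4 * L ^ 13) := by
    have h1 : ∑ x, ((L ^ 2 : ℕ) : ℝ) * ∑ k ∈ box (L ^ 6), f (x + reduce p ((w : ℤ) • k)) = 0 := by
      rw [← Finset.mul_sum, Finset.sum_comm]
      simp only [hshiftsum f, hsum, Finset.sum_const_zero, mul_zero]
    rw [← h1, ← hcardu, ← nsmul_eq_mul (Finset.card _), ← Finset.sum_const,
      ← Finset.sum_add_distrib]
    refine Finset.sum_le_sum fun x _ => ?_
    have h2 := norm_sum_subgrid_sub_le (fun k => f (x + reduce p ((w : ℤ) • k))) (fun k => hf _) L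
      (r x) (hr4 x)
    rw [nsmul_eq_mul, Real.norm_eq_abs] at h2
    have h3 := (abs_le.1 h2).1
    have h4 : ∑ v ∈ box (L ^ 6), D (r x) (x + reduce p ((w : ℤ) • v)) =
        ∑ k ∈ box (L ^ 6), ∑ u ∈ box L, f (x + reduce p ((w : ℤ) • (k + (r x : ℤ) • u))) := by
      refine Finset.sum_congr rfl fun v _ => Finset.sum_congr rfl fun u _ => ?_
      rw [smul_add, smul_smul, map_add, ← add_assoc, Nat.cast_mul]
    rw [h4]
    linarith
  simp only [Finset.sum_add_distrib] at hupper
  have hfin : c * (p ^ 2 * L ^ 12) * L ^ 2 ≤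
      L ^ 12 * (p ^ 2 * (c / 4 * L ^ 2) + 2 * L ^ 2 * bad.card) + p ^ 2 * (24 * L ^ 13) := by
    linarith
  have h5 : (p : ℝ) ^ 2 * (24 * L ^ 13) ≤ c / 2 * (p ^ 2 * L ^ 14) := by
    have : (p : ℝ) ^ 2 * L ^ 13 * 48 ≤ p ^ 2 * L ^ 13 * (c * L) := by gcongr
    nlinarith
  have h6 : c / 4 * (p : ℝ) ^ 2 ≤ 2 * bad.card := by
    refine le_of_mul_le_mul_right (a := (L : ℝ) ^ 14) ?_ (by positivity)
    nlinarith
  have h7 : (4 * n : ℝ) < p := by exact_mod_cast hn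
  have h8 : 2 * (bad.card : ℝ) ≤ c * n ^ 2 := by
    have : (n : ℝ) * (8 * (W : ℕ)) ≤ n * (c * n) := by gcongr
    nlinarith
  have h9 : (n : ℝ) ^ 2 * 16 < p ^ 2 := by
    have : (0 : ℝ) ≤ n := by positivity
    nlinarith
  nlinarith

end LinearPhase

section Squares

/-- Rotation by a right angle. -/
def quarterTurn (R : Type*) [Ring R] : R × R →+ R × R where
  toFun d := (-d.2, d.1)
  map_zero' := by simp
  map_add' a b := by ext <;> simp [add_comm]

lemma quarterTurn_apply {R : Type*} [Ring R] (d : R × R) : quarterTurn R d = (-d.2, d.1) := rfl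

lemma quarterTurn_quarterTurn {R : Type*} [Ring R] (d : R × R) :
    quarterTurn R (quarterTurn R d) = -d := rfl

lemma quarterTurn_bijective (R : Type*) [Ring R] : Function.Bijective (quarterTurn R) := by
  refine Function.bijective_iff_has_inverse.2 ⟨fun d => -quarterTurn R d, fun d => ?_, fun d => ?_⟩
  · exact neg_eq_iff_eq_neg.2 (quarterTurn_quarterTurn d)
  · exact (map_neg _ _).trans (neg_eq_iff_eq_neg.2 (quarterTurn_quarterTurn d))

lemma reduce_quarterTurn (p : ℕ) (d : ℤ × ℤ) :
    reduce p (quarterTurn ℤ d) = quarterTurn (ZMod p) (reduce p d) := by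
  simp [reduce_apply, quarterTurn_apply]

/-- The set `A` contains the vertices of a (tilted) square. -/
def HasSquare (A : Finset (ℤ × ℤ)) : Prop :=
  ∃ x d : ℤ × ℤ, d ≠ 0 ∧ x ∈ A ∧ x + d ∈ A ∧ x + (-d.2, d.1) ∈ A ∧ x + d + (-d.2, d.1) ∈ A

variable {p : ℕ} [Fact p.Prime]

/-- The form counting squares in the plane over `ZMod p`. -/
noncomputable def squareForm (g₀ g₁ g₂ g₃ : Plane p → ℝ) : ℝ :=
  ∑ x, ∑ d, g₀ x * g₁ (x + d) * g₂ (x + quarterTurn (ZMod p) d) *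
    g₃ (x + (d + quarterTurn (ZMod p) d))

lemma squareForm_rotate (g₀ g₁ g₂ g₃ : Plane p → ℝ) :
    squareForm g₀ g₁ g₂ g₃ = squareForm g₁ g₃ g₀ g₂ := by
  unfold squareForm
  rw [Finset.sum_comm, Finset.sum_comm (f := fun x d => g₁ x * g₃ (x + d) *
    g₀ (x + quarterTurn (ZMod p) d) * g₂ (x + (d + quarterTurn (ZMod p) d)))]
  refine Fintype.sum_equiv (Equiv.ofBijective _ (quarterTurn_bijective (ZMod p))) _ _ fun d => ?_
  refine Fintype.sum_equiv (Equiv.addRight d) _ _ fun x => ?_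
  simp only [Equiv.ofBijective_apply, quarterTurn_quarterTurn, Equiv.coe_addRight]
  rw [show x + d + -d = x by abel, show x + d + (quarterTurn (ZMod p) d + -d) =
    x + quarterTurn (ZMod p) d by abel, add_assoc]
  ring

lemma squareForm_le (hp2 : p ≠ 2) (f g₁ g₂ g₃ : Plane p → ℝ) (h₁ : ∀ x, |g₁ x| ≤ 1)
    (h₂ : ∀ x, |g₂ x| ≤ 1) (h₃ : ∀ x, |g₃ x| ≤ 1) :
    ∃ φ : Plane p → Plane p, squareForm f g₁ g₂ g₃ ^ 2 ≤
      (p : ℝ) ^ 4 * ∑ h, ‖∑ x, ((f x * f (x + h) : ℝ) : ℂ) * chi (φ h) x‖ := by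
  have h2 : (2 : ZMod p) ≠ 0 := by
    intro h
    have : ((2 : ℕ) : ZMod p) = 0 := by exact_mod_cast h
    rw [ZMod.natCast_eq_zero_iff] at this
    exact hp2 ((Nat.prime_dvd_prime_iff_eq Fact.out Nat.prime_two).1 this)
  have key : ∀ a b : ZMod p, a + b = 0 → a - b = 0 → a = 0 ∧ b = 0 := by
    intro a b h1 h3
    have ha : 2 * a = 0 := by linear_combination h1 + h3
    have hb : 2 * b = 0 := by linear_combination h1 - h3
    exact ⟨(mul_eq_zero.1 ha).resolve_left h2, (mul_eq_zero.1 hb).resolve_left h2⟩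
  have hsub : Function.Injective (AddMonoidHom.id (Plane p) - quarterTurn (ZMod p)) := by
    rw [injective_iff_map_eq_zero]
    rintro ⟨a, b⟩ h
    simp only [AddMonoidHom.sub_apply, AddMonoidHom.id_apply, quarterTurn_apply, Prod.mk_sub_mk,
      Prod.mk_eq_zero] at h
    obtain ⟨h1, h3⟩ := h
    obtain ⟨rfl, rfl⟩ := key a b (by linear_combination h1) (by linear_combination -h3)
    rfl
  have hadd : Function.Injective (AddMonoidHom.id (Plane p) + quarterTurn (ZMod p)) := by
    rw [injective_iff_map_eq_zero]
    rintro ⟨a, b⟩ h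
    simp only [AddMonoidHom.add_apply, AddMonoidHom.id_apply, quarterTurn_apply, Prod.mk_add_mk,
      Prod.mk_eq_zero] at h
    obtain ⟨h1, h3⟩ := h
    obtain ⟨rfl, rfl⟩ := key a b (by linear_combination h3) (by linear_combination h1)
    rfl
  obtain ⟨φ, hφ⟩ := von_neumann f g₁ g₂ g₃ h₁ h₂ h₃ (AddMonoidHom.id _) (quarterTurn (ZMod p))
    (AddMonoidHom.id _ + quarterTurn (ZMod p)) Function.injective_id
    (quarterTurn_bijective _).injective hsub hadd
  simp only [AddMonoidHom.add_apply, AddMonoidHom.id_apply] at hφ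
  exact ⟨φ, hφ⟩

lemma exists_large_squareForm (a b : Plane p → ℝ) (hp2 : p ≠ 2) (ha : ∀ x, |a x| ≤ 1)
    (hb : ∀ x, |b x| ≤ 1) (t : ℝ) (ht : 0 ≤ t)
    (h : 4 * t * p ^ 4 ≤ squareForm b b b b - squareForm a a a a) :
    ∃ φ : Plane p → Plane p, t ^ 2 * p ^ 4 ≤
      ∑ h, ‖∑ x, (((a x - b x) * (a (x + h) - b (x + h)) : ℝ) : ℂ) * chi (φ h) x‖ := by
  set f : Plane p → ℝ := fun x => a x - b x with hf
  have hp0 : (0 : ℝ) < p := by exact_mod_cast (Fact.out : p.Prime).pos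
  have hdone : ∀ g₁ g₂ g₃ : Plane p → ℝ, (∀ x, |g₁ x| ≤ 1) → (∀ x, |g₂ x| ≤ 1) →
      (∀ x, |g₃ x| ≤ 1) → t * p ^ 4 ≤ |squareForm f g₁ g₂ g₃| →
      ∃ φ : Plane p → Plane p, t ^ 2 * p ^ 4 ≤
        ∑ h, ‖∑ x, ((f x * f (x + h) : ℝ) : ℂ) * chi (φ h) x‖ := by
    intro g₁ g₂ g₃ h₁ h₂ h₃ hT
    obtain ⟨φ, hφ⟩ := squareForm_le hp2 f g₁ g₂ g₃ h₁ h₂ h₃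
    refine ⟨φ, le_of_mul_le_mul_left (a := (p : ℝ) ^ 4) ?_ (by positivity)⟩
    calc (p : ℝ) ^ 4 * (t ^ 2 * p ^ 4) = (t * p ^ 4) ^ 2 := by ring
      _ ≤ |squareForm f g₁ g₂ g₃| ^ 2 := by gcongr
      _ = squareForm f g₁ g₂ g₃ ^ 2 := sq_abs _
      _ ≤ _ := hφ
  have htel : squareForm a a a a - squareForm b b b b = squareForm f a a a + squareForm b f a a +
      squareForm b b f a + squareForm b b b f := by
    simp only [squareForm, hf, ← Finset.sum_sub_distrib, ← Finset.sum_add_distrib]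
    refine Finset.sum_congr rfl fun x _ => Finset.sum_congr rfl fun d _ => ?_
    ring
  rw [squareForm_rotate b f a a, squareForm_rotate b b f a, squareForm_rotate b a b f,
    squareForm_rotate a f b b, squareForm_rotate b b b f, squareForm_rotate b f b b] at htel
  by_contra! hcon
  have hlt : ∀ g₁ g₂ g₃ : Plane p → ℝ, (∀ x, |g₁ x| ≤ 1) → (∀ x, |g₂ x| ≤ 1) →
      (∀ x, |g₃ x| ≤ 1) → |squareForm f g₁ g₂ g₃| < t * p ^ 4 := by
    intro g₁ g₂ g₃ h₁ h₂ h₃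
    by_contra! hT
    obtain ⟨φ, hφ⟩ := hdone g₁ g₂ g₃ h₁ h₂ h₃ hT
    exact absurd hφ (not_le.2 (hcon φ))
  have e1 := (abs_lt.1 (hlt a a a ha ha ha)).1
  have e2 := (abs_lt.1 (hlt a b a ha hb ha)).1
  have e3 := (abs_lt.1 (hlt b a b hb ha hb)).1
  have e4 := (abs_lt.1 (hlt b b b hb hb hb)).1
  linarith

end Squares

section Counting

open scoped Classical in
/-- The indicator function of the reduction of a finite set of integer points. -/
noncomputable def indic (p : ℕ) (A : Finset (ℤ × ℤ)) (x : Plane p) : ℝ :=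
  if ∃ a ∈ A, reduce p a = x then 1 else 0

variable {p : ℕ}

lemma indic_nonneg (A : Finset (ℤ × ℤ)) (x : Plane p) : 0 ≤ indic p A x := by
  unfold indic; split_ifs <;> norm_num

lemma indic_le_one (A : Finset (ℤ × ℤ)) (x : Plane p) : indic p A x ≤ 1 := by
  unfold indic; split_ifs <;> norm_num

lemma indic_eq_zero_or_exists (A : Finset (ℤ × ℤ)) (x : Plane p) :
    indic p A x = 0 ∨ ∃ a ∈ A, reduce p a = x := by
  by_cases h : ∃ a ∈ A, reduce p a = x
  · exact Or.inr h
  · exact Or.inl (if_neg h)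

lemma indic_reduce {A : Finset (ℤ × ℤ)} {a : ℤ × ℤ} (ha : a ∈ A) : indic p A (reduce p a) = 1 :=
  if_pos ⟨a, ha, rfl⟩

lemma injOn_reduce_box {n : ℕ} (hn : n ≤ p) : Set.InjOn (reduce p) (box n : Set (ℤ × ℤ)) := by
  simpa using injOn_reduce_smul (p := p) (w := 1) (m := n) le_rfl (by simpa using hn)

lemma indic_reduce_of_mem_box {n : ℕ} (hn : n ≤ p) {A : Finset (ℤ × ℤ)} (hA : A ⊆ box n)
    {a : ℤ × ℤ} (ha : a ∈ box n) [Decidable (a ∈ A)] :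
    indic p A (reduce p a) = if a ∈ A then 1 else 0 := by
  split_ifs with h
  · exact indic_reduce h
  · refine if_neg ?_
    rintro ⟨b, hb, hba⟩
    exact h (injOn_reduce_box hn (hA hb) ha hba ▸ hb)

/-- The balanced function of a set of density `δ` in a box, reduced modulo `p`. -/
noncomputable def balanced (p n : ℕ) (A : Finset (ℤ × ℤ)) (δ : ℝ) (x : Plane p) : ℝ :=
  indic p A x - δ * indic p (box n) x

lemma abs_balanced_le {n : ℕ} {A : Finset (ℤ × ℤ)} {δ : ℝ} (h0 : 0 ≤ δ) (h1 : δ ≤ 1)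
    (x : Plane p) : |balanced p n A δ x| ≤ 1 := by
  have e1 := indic_nonneg A x
  have e2 := indic_le_one A x
  have e3 := mul_nonneg h0 (indic_nonneg (box n) x)
  have e4 := mul_le_one₀ h1 (indic_nonneg (box n) x) (indic_le_one (box n) x)
  rw [balanced, abs_le]
  constructor <;> linarith

variable [Fact p.Prime]

lemma sum_indic {n : ℕ} (hn : n ≤ p) {A : Finset (ℤ × ℤ)} (hA : A ⊆ box n) :
    ∑ x, indic p A x = A.card := by
  classical
  have h1 : A.card = (A.image (reduce p)).card :=
    (Finset.card_image_of_injOn ((injOn_reduce_box hn).mono (by exact_mod_cast hA))).symm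
  rw [h1]
  simp only [indic, Finset.sum_boole]
  congr 2
  ext x
  simp only [Finset.mem_filter, Finset.mem_univ, true_and, Finset.mem_image]

/-- A set without squares has only trivial squares modulo a large prime. -/
lemma squareForm_indic_le {n : ℕ} (hn : 4 * n < p) {A : Finset (ℤ × ℤ)} (hA : A ⊆ box n)
    (hsq : ¬ HasSquare A) :
    squareForm (indic p A) (indic p A) (indic p A) (indic p A) ≤ A.card := by
  rw [← sum_indic (p := p) (by omega) hA]
  unfold squareForm
  refine Finset.sum_le_sum fun x _ => ?_
  rw [Finset.sum_eq_single 0]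
  · simp only [map_zero, add_zero]
    have h0 := indic_nonneg A x
    have h1 := indic_le_one A x
    have h2 : indic p A x * indic p A x ≤ 1 := mul_le_one₀ h1 h0 h1
    have h3 : indic p A x * indic p A x * indic p A x ≤ 1 := mul_le_one₀ h2 h0 h1
    exact mul_le_of_le_one_left h0 h3
  · intro d _ hd
    by_contra hne
    simp only [mul_eq_zero, not_or] at hne
    obtain ⟨⟨⟨h0, h1⟩, h2⟩, h3⟩ := hne
    obtain ⟨a, ha, rfl⟩ := (indic_eq_zero_or_exists A _).resolve_left h0
    obtain ⟨b, hb, hb'⟩ := (indic_eq_zero_or_exists A _).resolve_left h1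
    obtain ⟨c, hc, hc'⟩ := (indic_eq_zero_or_exists A _).resolve_left h2
    obtain ⟨e, he, he'⟩ := (indic_eq_zero_or_exists A _).resolve_left h3
    have hd' : d = reduce p (b - a) := by rw [map_sub, hb', add_sub_cancel_left]
    rw [hd', ← reduce_quarterTurn, ← map_add] at hc'
    rw [hd', ← reduce_quarterTurn, ← map_add, ← map_add] at he'
    have hA' := mem_box.1 (hA ha)
    have hB' := mem_box.1 (hA hb)
    have hC' := mem_box.1 (hA hc)
    have hE' := mem_box.1 (hA he)
    have hc2 : c = a + quarterTurn ℤ (b - a) := by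
      refine eq_of_reduce_eq hc' ?_ ?_ <;>
      · simp only [quarterTurn_apply, Prod.fst_add, Prod.snd_add, Prod.fst_sub, Prod.snd_sub]
        rw [abs_lt]
        omega
    have he2 : e = a + ((b - a) + quarterTurn ℤ (b - a)) := by
      refine eq_of_reduce_eq he' ?_ ?_ <;>
      · simp only [quarterTurn_apply, Prod.fst_add, Prod.snd_add, Prod.fst_sub, Prod.snd_sub]
        rw [abs_lt]
        omega
    refine hsq ⟨a, b - a, ?_, ha, by rwa [add_sub_cancel], ?_, ?_⟩
    · intro h
      rw [h, map_zero] at hd'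
      exact hd hd'
    · rw [← quarterTurn_apply, ← hc2]
      exact hc
    · rw [← quarterTurn_apply, add_assoc, ← he2]
      exact he
  · simp

/-- A box contains many squares. -/
lemma le_squareForm_indic_box {n k : ℕ} (hn : n < p) (hk : 3 * k ≤ n) :
    (k : ℝ) ^ 4 ≤ squareForm (indic p (box n)) (indic p (box n)) (indic p (box n))
      (indic p (box n)) := by
  classical
  set Q : Finset ((ℤ × ℤ) × (ℤ × ℤ)) :=
    (Finset.Ico (k : ℤ) (2 * k : ℕ) ×ˢ Finset.Ico (0 : ℤ) k) ×ˢ box k with hQ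
  have hmem : ∀ q ∈ Q, ((k ≤ q.1.1 ∧ q.1.1 < 2 * k) ∧ 0 ≤ q.1.2 ∧ q.1.2 < k) ∧
      (0 ≤ q.2.1 ∧ q.2.1 < k) ∧ 0 ≤ q.2.2 ∧ q.2.2 < k := by
    intro q hq
    simp only [hQ, box, Finset.mem_product, Finset.mem_Ico] at hq
    push_cast at hq
    exact hq
  have hinj : Set.InjOn (Prod.map (reduce p) (reduce p)) (Q : Set ((ℤ × ℤ) × (ℤ × ℤ))) := by
    intro q hq q' hq' h
    have hq := hmem q hq
    have hq' := hmem q' hq'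
    simp only [Prod.map_apply', Prod.mk.injEq] at h
    refine Prod.ext (eq_of_reduce_eq h.1 ?_ ?_) (eq_of_reduce_eq h.2 ?_ ?_) <;>
    · rw [abs_lt]
      omega
  have hcard : (k : ℝ) ^ 4 = ∑ q ∈ Q.image (Prod.map (reduce p) (reduce p)), (1 : ℝ) := by
    rw [Finset.sum_const, Finset.card_image_of_injOn hinj, hQ, Finset.card_product,
      Finset.card_product, card_box, Int.card_Ico, Int.card_Ico, nsmul_eq_mul, mul_one]
    rw [show (((2 * k : ℕ) : ℤ) - k).toNat = k by omega, show ((k : ℤ) - 0).toNat = k by omega]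
    push_cast
    ring
  unfold squareForm
  rw [hcard, ← sum_plane_prod (fun q => indic p (box n) q.1 * indic p (box n) (q.1 + q.2) *
    indic p (box n) (q.1 + quarterTurn (ZMod p) q.2) *
    indic p (box n) (q.1 + (q.2 + quarterTurn (ZMod p) q.2)))]
  refine (Finset.sum_le_sum fun q hq => ?_).trans
    (Finset.sum_le_sum_of_subset_of_nonneg (Finset.subset_univ _) fun q _ _ => ?_)
  · obtain ⟨q, hqQ, rfl⟩ := Finset.mem_image.1 hq
    have hq := hmem q hqQ
    simp only [Prod.map_apply', ← reduce_quarterTurn, ← map_add]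
    rw [indic_reduce, indic_reduce, indic_reduce, indic_reduce]
    · norm_num
    all_goals
      simp only [mem_box, quarterTurn_apply, Prod.fst_add, Prod.snd_add]
      omega
  · exact mul_nonneg (mul_nonneg (mul_nonneg (indic_nonneg _ _) (indic_nonneg _ _))
      (indic_nonneg _ _)) (indic_nonneg _ _)

/-- The derivatives of the balanced function of a set without squares are correlated with
characters. -/
theorem exists_correlation_of_not_hasSquare {n : ℕ} (hn : 4 * n < p) (hpn : p ≤ 8 * n)
    (hn8 : 8 ≤ n) {A : Finset (ℤ × ℤ)} (hA : A ⊆ box n) (hsq : ¬ HasSquare A) {δ : ℝ}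
    (hδ0 : 0 < δ) (hδ1 : δ ≤ 1) (hδp : 2 ^ 17 ≤ δ ^ 4 * p ^ 2) :
    ∃ φ : Plane p → Plane p, (δ ^ 4 / 2 ^ 23) ^ 2 * p ^ 4 ≤ ∑ h, ‖∑ x,
      ((balanced p n A δ x * balanced p n A δ (x + h) : ℝ) : ℂ) * chi (φ h) x‖ := by
  refine exists_large_squareForm (indic p A) (fun x => δ * indic p (box n) x) (by omega)
    (fun x => abs_le.2 ⟨by linarith [indic_nonneg A x], indic_le_one A x⟩)
    (fun x => abs_le.2 ⟨by linarith [mul_nonneg hδ0.le (indic_nonneg (box n) x)],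
      mul_le_one₀ hδ1 (indic_nonneg (box n) x) (indic_le_one (box n) x)⟩) _ (by positivity) ?_
  have h1 := squareForm_indic_le hn hA hsq
  have h2 := le_squareForm_indic_box (p := p) (n := n) (k := n / 3) (by omega) (by omega)
  have h3 : squareForm (fun x => δ * indic p (box n) x) (fun x => δ * indic p (box n) x)
      (fun x => δ * indic p (box n) x) (fun x => δ * indic p (box n) x) =
      δ ^ 4 * squareForm (indic p (box n)) (indic p (box n)) (indic p (box n))
        (indic p (box n)) := by
    simp only [squareForm, Finset.mul_sum]
    refine Finset.sum_congr rfl fun x _ => Finset.sum_congr rfl fun d _ => ?_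
    ring
  have h4 : (A.card : ℝ) ≤ n ^ 2 := by
    rw [← Nat.cast_pow, ← card_box]
    exact_mod_cast Finset.card_le_card hA
  have h5 : (p : ℝ) / 32 ≤ (n / 3 : ℕ) := by
    rw [div_le_iff₀ (by norm_num)]
    have : p ≤ n / 3 * 32 := by omega
    exact_mod_cast this
  have h6 : (p : ℝ) ^ 4 / 2 ^ 20 ≤ ((n / 3 : ℕ) : ℝ) ^ 4 := by
    calc (p : ℝ) ^ 4 / 2 ^ 20 = (p / 32) ^ 4 := by rw [div_pow]; norm_num
      _ ≤ _ := by gcongr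
  have h7 : δ ^ 4 * ((p : ℝ) ^ 4 / 2 ^ 20) ≤ δ ^ 4 * squareForm (indic p (box n))
      (indic p (box n)) (indic p (box n)) (indic p (box n)) := by
    have := h6.trans h2
    gcongr
  have h8 : (4 * n : ℝ) < p := by exact_mod_cast hn
  have h9 : (n : ℝ) ^ 2 * 16 ≤ p ^ 2 := by
    have : (0 : ℝ) ≤ n := by positivity
    nlinarith
  have h10 : 2 ^ 17 * (p : ℝ) ^ 2 ≤ δ ^ 4 * p ^ 2 * p ^ 2 := by gcongr
  rw [h3]
  nlinarith

end Counting

lemma HasSquare.of_filter {A B : Finset (ℤ × ℤ)} (b : ℤ × ℤ) {s : ℤ} (hs : s ≠ 0)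
    [DecidablePred fun u => b + s • u ∈ A] (h : HasSquare (B.filter fun u => b + s • u ∈ A)) :
    HasSquare A := by
  obtain ⟨x, d, hd, h0, h1, h2, h3⟩ := h
  rw [Finset.mem_filter] at h0 h1 h2 h3
  refine ⟨b + s • x, s • d, smul_ne_zero hs hd, h0.2, ?_, ?_, ?_⟩
  · convert h1.2 using 1
    rw [smul_add, add_assoc]
  · convert h2.2 using 1
    ext <;> simp <;> ring
  · convert h3.2 using 1
    ext <;> simp <;> ring

lemma balanced_dense_subgrid {p n L : ℕ} (hn : n ≤ p) {A : Finset (ℤ × ℤ)} (hA : A ⊆ box n)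
    (hsq : ¬ HasSquare A) {δ η : ℝ} {b : ℤ × ℤ} {s : ℕ} (hs : 1 ≤ s)
    (hb : ∀ u ∈ box L, b + (s : ℤ) • u ∈ box n)
    (h : η * L ^ 2 ≤ ∑ u ∈ box L, balanced p n A δ (reduce p (b + (s : ℤ) • u))) :
    ∃ A' ⊆ box L, ¬ HasSquare A' ∧ (δ + η) * L ^ 2 ≤ A'.card := by
  classical
  refine ⟨(box L).filter fun u => b + (s : ℤ) • u ∈ A, Finset.filter_subset _ _,
    fun h => hsq (h.of_filter b (by omega)), ?_⟩
  have e : ∀ u ∈ box L, balanced p n A δ (reduce p (b + (s : ℤ) • u)) =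
      (if b + (s : ℤ) • u ∈ A then 1 else 0) - δ := by
    intro u hu
    rw [balanced, indic_reduce_of_mem_box hn hA (hb u hu), indic_reduce (hb u hu), mul_one]
  rw [Finset.sum_congr rfl e, Finset.sum_sub_distrib, Finset.sum_boole, Finset.sum_const, card_box,
    nsmul_eq_mul] at h
  push_cast at h
  linarith

/-- Density increment: a dense set without squares in a large box gives rise to a denser set
without squares in a smaller, still large, box. -/
theorem exists_density_increment : ∃ C : ℕ, ∀ x : ℝ, 0 < x → x ≤ 1 / 2 → ∀ L n : ℕ,
    x⁻¹ ^ C ≤ L → (L : ℝ) ^ (x⁻¹ ^ C) ≤ n → ∀ δ : ℝ, 2 * x ≤ δ → ∀ A ⊆ box n,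
    ¬ HasSquare A → (A.card : ℝ) = δ * n ^ 2 →
    ∃ A' ⊆ box L, ¬ HasSquare A' ∧ (δ + x ^ C) * L ^ 2 ≤ A'.card := by
  obtain ⟨C₀, hC₀⟩ := exists_grid_correlation
  refine ⟨C₀ + 178040, fun x hx0 hx1 L n hL hn δ hδ A hA hsq hcard => ?_⟩
  set C := C₀ + 178040 with hC
  have hinv : 2 ≤ x⁻¹ := by
    rw [le_inv_comm₀ (by norm_num) hx0]; simpa using hx1
  have hinv1 : 1 ≤ x⁻¹ := by linarith
  have hpow : ∀ k ≤ C, x⁻¹ ^ k ≤ x⁻¹ ^ C := fun k hk => pow_le_pow_right₀ hinv1 hk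
  have htwo : ∀ k : ℕ, (2 : ℝ) ^ k ≤ x⁻¹ ^ k := fun k => by gcongr
  have hLk : ∀ k ≤ C, x⁻¹ ^ k ≤ L := fun k hk => (hpow k hk).trans hL
  have hcancel : ∀ k : ℕ, x ^ k * x⁻¹ ^ k = 1 := fun k => by
    rw [← mul_pow, mul_inv_cancel₀ hx0.ne', one_pow]
  have hL8 : (8 : ℝ) ≤ L := by
    have := (htwo 3).trans (hLk 3 (by omega))
    linarith
  have hL1 : (1 : ℝ) ≤ L := by linarith
  have hL0 : (0 : ℝ) < L := by linarith
  have hLn : (L : ℝ) ≤ n := by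
    refine le_trans ?_ hn
    conv_lhs => rw [← Real.rpow_one (L : ℝ)]
    exact Real.rpow_le_rpow_of_exponent_le hL1 (one_le_pow₀ hinv1)
  have hn8 : 8 ≤ n := by exact_mod_cast hL8.trans hLn
  have hn0 : (0 : ℝ) < n := by linarith
  have hδ0 : 0 < δ := by linarith
  have hδ1 : δ ≤ 1 := by
    refine le_of_mul_le_mul_right (a := (n : ℝ) ^ 2) ?_ (by positivity)
    rw [one_mul, ← hcard, ← Nat.cast_pow, ← card_box]
    exact_mod_cast Finset.card_le_card hA
  obtain ⟨p, hp, hpn, hpn'⟩ := Nat.exists_prime_lt_and_le_two_mul (4 * n) (by omega)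
  have : Fact p.Prime := ⟨hp⟩
  have hnp : n ≤ p := by omega
  have hnp' : (n : ℝ) ≤ p := by exact_mod_cast hnp
  have hLp : ∀ k ≤ C, x⁻¹ ^ k ≤ p := fun k hk => (hLk k hk).trans (hLn.trans hnp')
  obtain ⟨φ, hφ⟩ := exists_correlation_of_not_hasSquare hpn (by omega) hn8 hA hsq hδ0 hδ1 (by
    calc (2 : ℝ) ^ 17 ≤ x⁻¹ ^ 17 := htwo 17
      _ ≤ x⁻¹ ^ 18 := pow_le_pow_right₀ hinv1 (by norm_num)
      _ = x ^ 4 * (x⁻¹ ^ 11) ^ 2 := by rw [← pow_mul, show 11 * 2 = 4 + 18 from rfl, pow_add,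
          ← mul_assoc, hcancel, one_mul]
      _ ≤ δ ^ 4 * p ^ 2 := by
          have := hLp 11 (by omega)
          have : x ≤ δ := by linarith
          gcongr)
  set τ := x ^ 47 with hτ
  have hτinv : ∀ k : ℕ, τ⁻¹ ^ k = x⁻¹ ^ (47 * k) := fun k => by rw [hτ, ← inv_pow, ← pow_mul]
  have hτ0 : 0 < τ := by positivity
  have hhalf : ∀ k : ℕ, x ^ k ≤ (1 / 2) ^ k := fun k => by gcongr
  have hτ1 : τ ≤ 1 / 2 := (hhalf 47).trans (by norm_num)
  have hτt : 2 * τ ≤ (δ ^ 4 / 2 ^ 23) ^ 2 := by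
    calc 2 * τ = 2 * (x ^ 8 * x ^ 39) := by rw [hτ, ← pow_add]
      _ ≤ 2 * (x ^ 8 * (1 / 2) ^ 39) := by
          have := hhalf 39
          gcongr
      _ = ((2 * x) ^ 4 / 2 ^ 23) ^ 2 := by ring
      _ ≤ _ := by gcongr
  obtain ⟨w, hw1, hw, hcorr⟩ := hC₀ p (balanced p n A δ) (abs_balanced_le hδ0.le hδ1) φ τ hτ0 hτ1
    (le_trans (by gcongr) hφ) (by rw [hτinv]; exact hLp _ (by omega)) L (by
      rw [← pow_one τ⁻¹, hτinv]
      calc 64 * x⁻¹ ^ (47 * 1) = 2 ^ 6 * x⁻¹ ^ (47 * 1) := by norm_num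
        _ ≤ x⁻¹ ^ 6 * x⁻¹ ^ (47 * 1) := by
          have := htwo 6
          gcongr
        _ = x⁻¹ ^ 53 := by rw [← pow_add]
        _ ≤ L := hLk 53 (by omega))
  have hwL : (w : ℝ) * L ^ 6 ≤ n := by
    refine le_trans ?_ hn
    calc (w : ℝ) * L ^ 6 ≤ (L : ℝ) ^ (C₀ * τ⁻¹ ^ 3788) * (L : ℝ) ^ ((6 : ℕ) : ℝ) := by
          rw [Real.rpow_natCast]
          gcongr
      _ = (L : ℝ) ^ (C₀ * τ⁻¹ ^ 3788 + ((6 : ℕ) : ℝ)) := (Real.rpow_add hL0 _ _).symm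
      _ ≤ _ := by
          refine Real.rpow_le_rpow_of_exponent_le hL1 ?_
          rw [hτinv]
          have h1 : (C₀ : ℝ) ≤ x⁻¹ ^ C₀ := by
            refine le_trans ?_ (htwo C₀)
            exact_mod_cast Nat.lt_two_pow_self.le
          have h2 : (6 : ℝ) ≤ x⁻¹ ^ 3 := le_trans (by norm_num) (htwo 3)
          have h3 : x⁻¹ ^ 3 ≤ x⁻¹ ^ (C - 1) := pow_le_pow_right₀ hinv1 (by omega)
          have h4 : (C₀ : ℝ) * x⁻¹ ^ (47 * 3788) ≤ x⁻¹ ^ (C - 1) := by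
            calc (C₀ : ℝ) * x⁻¹ ^ (47 * 3788) ≤ x⁻¹ ^ C₀ * x⁻¹ ^ (47 * 3788) := by gcongr
              _ = x⁻¹ ^ (C₀ + 47 * 3788) := (pow_add _ _ _).symm
              _ ≤ _ := pow_le_pow_right₀ hinv1 (by omega)
          have h5 : x⁻¹ ^ C = x⁻¹ * x⁻¹ ^ (C - 1) := by
            rw [← pow_succ', show C - 1 + 1 = C by omega]
          have h6 : (2 : ℝ) * x⁻¹ ^ (C - 1) ≤ x⁻¹ * x⁻¹ ^ (C - 1) := by gcongr
          rw [h5]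
          push_cast
          linarith
  have hwL' : w * L ^ 6 ≤ n := by exact_mod_cast hwL
  obtain ⟨ξ, hξ⟩ := hcorr (hwL'.trans hnp)
  set c := τ ^ 1895 / 4 with hc
  have hcx : x ^ 89067 ≤ c := by
    have h1 : τ ^ 1895 = x ^ 89065 := by rw [hτ, ← pow_mul]
    have h2 : x ^ 2 ≤ 1 / 4 := (hhalf 2).trans (by norm_num)
    rw [hc, h1, show 89067 = 89065 + 2 from rfl, pow_add, div_eq_mul_one_div]
    gcongr
  have hc0 : 0 < c := by positivity
  have hcL : 48 ≤ c * L := by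
    calc (48 : ℝ) ≤ x⁻¹ ^ 6 := le_trans (by norm_num) (htwo 6)
      _ = x ^ 89067 * x⁻¹ ^ (89067 + 6) := by rw [pow_add, ← mul_assoc, hcancel, one_mul]
      _ ≤ c * L := mul_le_mul hcx (hLk _ (by omega)) (by positivity) hc0.le
  have hw5 : 8 * ((w * L ^ 5 : ℕ) : ℝ) ≤ c * n := by
    push_cast
    calc 8 * ((w : ℝ) * L ^ 5) ≤ c * L * (w * L ^ 5) := by
          gcongr
          linarith
      _ = c * (w * L ^ 6) := by ring
      _ ≤ c * n := by gcongr
  obtain ⟨b, r, hr1, hb, hD⟩ := exists_dense_subgrid (balanced p n A δ)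
    (abs_balanced_le hδ0.le hδ1) (by
      simp only [balanced]
      rw [Finset.sum_sub_distrib, ← Finset.mul_sum, sum_indic hnp hA, sum_indic hnp subset_rfl,
        card_box, hcard]
      push_cast
      ring) n hpn (by
      intro y hy
      rcases indic_eq_zero_or_exists A y with h | ⟨a, ha, hay⟩
      · refine (indic_eq_zero_or_exists (box n) y).resolve_left fun h' => hy ?_
        rw [balanced, h, h', mul_zero, sub_zero]
      · exact ⟨a, hA ha, hay⟩) w L (by exact_mod_cast hL1) c hc0 hcL hw5
    (le_trans (Nat.mul_le_mul_left _ (Nat.pow_le_pow_right (by exact_mod_cast hL1) (by norm_num)))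
      hwL') ξ hξ
  obtain ⟨A', hA', hsq', hA'c⟩ := balanced_dense_subgrid hnp hA hsq
    (Nat.mul_pos hw1 hr1) hb hD
  refine ⟨A', hA', hsq', le_trans ?_ hA'c⟩
  gcongr
  calc x ^ C ≤ x ^ (89067 + 3) := pow_le_pow_of_le_one hx0.le (by linarith) (by omega)
    _ = x ^ 89067 * x ^ 3 := pow_add _ _ _
    _ ≤ c * (1 / 8) := by
        have : x ^ 3 ≤ 1 / 8 := (hhalf 3).trans (by norm_num)
        gcongr
    _ = c / 8 := by ring

lemma card_le_of_subset_box {n : ℕ} {A : Finset (ℤ × ℤ)} (hA : A ⊆ box n) :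
    (A.card : ℝ) ≤ n ^ 2 := by
  rw [← Nat.cast_pow, ← card_box]
  exact_mod_cast Finset.card_le_card hA

/-- Iterating the density increment: a dense set without squares lives in a bounded box. -/
theorem exists_card_lt : ∃ C : ℕ, ∀ x : ℝ, 0 < x → x ≤ 1 / 2 → ∀ M : ℕ, x⁻¹ ^ C ≤ M → 1 ≤ M →
    ∀ n : ℕ, M ^ M ^ M ≤ n → ∀ A ⊆ box n, ¬ HasSquare A → (A.card : ℝ) < 2 * x * n ^ 2 := by
  obtain ⟨C, hC⟩ := exists_density_increment
  refine ⟨C, fun x hx0 hx1 M hM hM1 n hn A hA hsq => ?_⟩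
  have key : ∀ j n : ℕ, M ^ M ^ j ≤ n → ∀ δ : ℝ, 2 * x ≤ δ → ∀ A ⊆ box n, ¬ HasSquare A →
      δ * n ^ 2 ≤ A.card → δ + j * x ^ C ≤ 1 := by
    intro j
    induction j with
    | zero =>
      intro n hn δ _ A hA _ hcard
      have hn0 : 0 < n := lt_of_lt_of_le (by positivity) hn
      have hn0' : (0 : ℝ) < n := by exact_mod_cast hn0
      rw [Nat.cast_zero, zero_mul, add_zero]
      refine le_of_mul_le_mul_right (a := (n : ℝ) ^ 2) ?_ (by positivity)
      rw [one_mul]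
      exact hcard.trans (card_le_of_subset_box hA)
    | succ j ih =>
      intro n hn δ hδ A hA hsq hcard
      have hn0 : 0 < n := lt_of_lt_of_le (by positivity) hn
      have hn0' : (0 : ℝ) < n := by exact_mod_cast hn0
      have hδ' : δ ≤ A.card / n ^ 2 := by rwa [le_div_iff₀ (by positivity)]
      obtain ⟨A', hA', hsq', hcard'⟩ := hC x hx0 hx1 (M ^ M ^ j) n
        (hM.trans (by exact_mod_cast Nat.le_self_pow (by positivity) M))
        (by
          calc ((M ^ M ^ j : ℕ) : ℝ) ^ (x⁻¹ ^ C) ≤ ((M ^ M ^ j : ℕ) : ℝ) ^ (M : ℝ) :=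
                Real.rpow_le_rpow_of_exponent_le (by exact_mod_cast Nat.one_le_pow _ _ hM1) hM
            _ = ((M ^ M ^ (j + 1) : ℕ) : ℝ) := by
                rw [Real.rpow_natCast, ← Nat.cast_pow, ← pow_mul, ← pow_succ]
            _ ≤ n := by exact_mod_cast hn)
        (A.card / n ^ 2) (hδ.trans hδ') A hA hsq (by field_simp)
      have hpos : 0 < x ^ C := by positivity
      have := ih _ le_rfl _ (by linarith) A' hA' hsq' hcard'
      push_cast
      linarith
  by_contra! hcon
  have h1 := key M n hn _ le_rfl A hA hsq hcon
  have h2 : 1 ≤ M * x ^ C := by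
    rwa [inv_pow, inv_le_iff_one_le_mul₀ (by positivity)] at hM
  linarith

lemma pow_pow_self_le {M n : ℕ} (h : 2 * (M : ℝ) ^ 2 ≤ Real.log (Real.log n)) (hM : 1 ≤ M)
    (hlog : 0 < Real.log n) (hn : 0 < n) : M ^ M ^ M ≤ n := by
  have hM' : (1 : ℝ) ≤ M := by exact_mod_cast hM
  have hexp : (M : ℝ) ≤ Real.exp M := by linarith [Real.add_one_le_exp (M : ℝ)]
  have h1 : (M : ℝ) ^ (M + 1) ≤ Real.log n := by
    calc (M : ℝ) ^ (M + 1) ≤ Real.exp M ^ (M + 1) := by gcongr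
      _ = Real.exp (((M + 1 : ℕ) : ℝ) * M) := (Real.exp_nat_mul _ _).symm
      _ ≤ Real.exp (Real.log (Real.log n)) := by
          refine Real.exp_le_exp.2 (le_trans ?_ h)
          push_cast
          nlinarith
      _ = Real.log n := Real.exp_log hlog
  have h2 : (M : ℝ) ^ M ^ M ≤ n := by
    calc (M : ℝ) ^ M ^ M ≤ Real.exp M ^ M ^ M := by gcongr
      _ = Real.exp ((M : ℝ) ^ (M + 1)) := by
          rw [← Real.exp_nat_mul, pow_succ]
          push_cast
          rfl
      _ ≤ Real.exp (Real.log n) := Real.exp_le_exp.2 h1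
      _ = n := Real.exp_log (by exact_mod_cast hn)
  exact_mod_cast h2

/-- Density bound for sets without (tilted) squares: there exist `c₂ > 0`,
`C > 0` and `N₀` such that for all `n ≥ N₀`, every `A ⊆ [n] × [n] ⊂ ℤ²` with no
configuration `x, x + d, x + d⊥, x + d + d⊥` (`d ≠ 0`, `d⊥ = (-d₂, d₁)`)
satisfies `|A| ≤ C·n²/(log log n)^c₂`. -/
theorem no_tilted_square_density :
    ∃ c₂ : ℝ, 0 < c₂ ∧ ∃ C : ℝ, 0 < C ∧ ∃ N₀ : ℕ, ∀ n : ℕ, N₀ ≤ n →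
      ∀ A : Finset (ℤ × ℤ),
        A ⊆ Finset.Ico (0 : ℤ) (n : ℤ) ×ˢ Finset.Ico (0 : ℤ) (n : ℤ) →
        (¬ ∃ x d : ℤ × ℤ, d ≠ 0 ∧ x ∈ A ∧ x + d ∈ A ∧
          x + (-d.2, d.1) ∈ A ∧ x + d + (-d.2, d.1) ∈ A) →
        (A.card : ℝ) ≤ C * (n : ℝ) ^ 2 / (Real.log (Real.log n)) ^ c₂ := by
  obtain ⟨C, hC⟩ := exists_card_lt
  set k := 2 * (C + 1) with hk
  have hk0 : k ≠ 0 := by omega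
  refine ⟨(k : ℝ)⁻¹, by positivity, 2 * 8 ^ (k : ℝ)⁻¹, by positivity,
    ⌈Real.exp (Real.exp (8 * 2 ^ k))⌉₊, fun n hn A hA hsq => ?_⟩
  have hn' : Real.exp (Real.exp (8 * 2 ^ k)) ≤ n := Nat.ceil_le.1 hn
  have hn0 : (0 : ℝ) < n := (Real.exp_pos _).trans_le hn'
  have hlog : Real.exp (8 * 2 ^ k) ≤ Real.log n := (Real.le_log_iff_exp_le hn0).2 hn'
  have hlog0 : 0 < Real.log n := (Real.exp_pos _).trans_le hlog
  have hll : 8 * 2 ^ k ≤ Real.log (Real.log n) := (Real.le_log_iff_exp_le hlog0).2 hlog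
  set l := Real.log (Real.log n) with hl
  have hl0 : 0 < l := lt_of_lt_of_le (by positivity) hll
  set x := (8 / l) ^ (k : ℝ)⁻¹ with hx
  have hx0 : 0 < x := by positivity
  have hxk : x ^ k = 8 / l := Real.rpow_inv_natCast_pow (by positivity) hk0
  have hx1 : x ≤ 1 / 2 := by
    rw [← Real.pow_rpow_inv_natCast (show (0 : ℝ) ≤ 1 / 2 by norm_num) hk0, hx]
    refine Real.rpow_le_rpow (by positivity) ?_ (by positivity)
    rw [div_le_iff₀ hl0, one_div, inv_pow, inv_mul_eq_div, le_div_iff₀ (by positivity)]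
    exact hll
  have hinv1 : 1 ≤ x⁻¹ := (one_le_inv₀ hx0).2 (by linarith)
  have hM := hC x hx0 hx1 ⌈x⁻¹ ^ C⌉₊ (Nat.le_ceil _) (Nat.ceil_pos.2 (by positivity)) n
    (pow_pow_self_le (by
      have h1 : (⌈x⁻¹ ^ C⌉₊ : ℝ) ≤ 2 * x⁻¹ ^ C := by
        have := (Nat.ceil_lt_add_one (show 0 ≤ x⁻¹ ^ C by positivity)).le
        have : 1 ≤ x⁻¹ ^ C := one_le_pow₀ hinv1
        linarith
      calc 2 * (⌈x⁻¹ ^ C⌉₊ : ℝ) ^ 2 ≤ 2 * (2 * x⁻¹ ^ C) ^ 2 := by gcongr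
        _ = 8 * x⁻¹ ^ (2 * C) := by ring
        _ ≤ 8 * x⁻¹ ^ k := by
            have := pow_le_pow_right₀ hinv1 (show 2 * C ≤ k by omega)
            gcongr
        _ = l := by rw [inv_pow, hxk]; field_simp)
      (Nat.ceil_pos.2 (by positivity)) hlog0 (by exact_mod_cast hn0)) A hA hsq
  refine hM.le.trans (le_of_eq ?_)
  rw [hx, Real.div_rpow (by norm_num) hl0.le]
  ring
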